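/- Let H be a digraph with k arcs and δ(H) ≥ 1. There exist a constant C₀ and constants α, β, ε with 1/C₀ < α, β ≪ ε ≪ 1 such that for every C ≥ C₀ the following holds: if D is a digraph on n ≥ Ck vertices with minimum semi-degree δ⁰(D) ≥ n/2 + k which belongs to Extremal Case 1 (EC1) with parameter ε, then D is arbitrary Hamiltonian H-linked with parameters α, β. -/

import Mathlib

open scoped Classical

/-- The out-degree of a vertex `v` in the digraph with arc relation `A`. -/
noncomputable def outDeg {V : Type*} (A : V → V → Prop) (v : V) : ℕ :=
  {u | A v u}.ncard

/-- The in-degree of a vertex `v` in the digraph with arc relation `A`. -/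
noncomputable def inDeg {V : Type*} (A : V → V → Prop) (v : V) : ℕ :=
  {u | A u v}.ncard

/-- The number of arcs directed from `S` to `T`. -/
noncomputable def arcsCount {V : Type*} (A : V → V → Prop) (S T : Set V) : ℕ :=
  {p : V × V | p.1 ∈ S ∧ p.2 ∈ T ∧ A p.1 p.2}.ncard

/-- **Extremal Case 1 (EC1)** with parameter `ε`: the vertex set is partitioned into
`W 0, W 1, W 2, W 3` (corresponding to `W₁, W₂, W₃, W₄` of the paper) with
`||W₁| - |W₃||, ||W₂| - |W₄|| ≤ εn`, such that (A) each `(W i, W (i+1))` (indices mod 4)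
is `ε`-almost one-way complete, (B) `W₁` and `W₃` are `ε`-almost complete, and
(C) `(W₂, W₄)` is `ε`-almost complete bipartite. -/
def InEC1 {V : Type*} [Fintype V] (A : V → V → Prop) (ε : ℝ) : Prop :=
  ∃ W : Fin 4 → Set V,
    (∀ i j, i ≠ j → Disjoint (W i) (W j)) ∧
    (⋃ i, W i) = Set.univ ∧
    |((W 0).ncard : ℝ) - ((W 2).ncard : ℝ)| ≤ ε * Fintype.card V ∧
    |((W 1).ncard : ℝ) - ((W 3).ncard : ℝ)| ≤ ε * Fintype.card V ∧
    (∀ i : Fin 4,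
      ((W i).ncard : ℝ) * ((W (i + 1)).ncard : ℝ) - ε * (Fintype.card V : ℝ)^2 ≤
        (arcsCount A (W i) (W (i + 1)) : ℝ)) ∧
    (∀ i : Fin 4, i = 0 ∨ i = 2 →
      ((W i).ncard : ℝ)^2 - ε * (Fintype.card V : ℝ)^2 ≤ (arcsCount A (W i) (W i) : ℝ)) ∧
    (∀ i : Fin 4, i = 1 ∨ i = 3 →
      ((W i).ncard : ℝ) * ((W (i + 2)).ncard : ℝ) - ε * (Fintype.card V : ℝ)^2 ≤
        (arcsCount A (W i) (W (i + 2)) : ℝ))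

/-- `p` is a directed path from `u` to `v`, recorded as its list of vertices; for
`u = v` (a loop of `H`) it is a closed directed path. -/
def IsDipathFrom {V : Type*} (A : V → V → Prop) (u v : V) (p : List V) : Prop :=
  p.Chain' A ∧ p.head? = some u ∧ p.getLast? = some v ∧
    (u = v → p.dropLast.Nodup) ∧ (u ≠ v → p.Nodup)

/-- The internal vertices of a path recorded as a list of vertices. -/
def listInterior {V : Type*} (p : List V) : List V := p.tail.dropLast

/-- Hamiltonian `(N H)`-subdivision for arcs `a` already mapped into `V`. -/
def IsHamSubdivision {V : Type*} (A : V → V → Prop) {k : ℕ}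
    (a : Fin k → V × V) (N : Fin k → ℕ) (g : Fin k → List V) : Prop :=
  (∀ i, IsDipathFrom A (a i).1 (a i).2 (g i) ∧ (g i).length = N i + 1) ∧
  (∀ i j, i ≠ j → ∀ x ∈ listInterior (g i), x ∉ g j) ∧
  (∀ x : V, ∃ i, x ∈ g i)

/-- Arbitrary Hamiltonian `H`-linkedness with parameters `α, β`. -/
def ArbHamHLinked {V W : Type*} [Fintype V] [Fintype W] (A : V → V → Prop)
    {k : ℕ} (a : Fin k → W × W) (α β : ℝ) : Prop :=
  ∀ f : W → V, Function.Injective f →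
    ∀ N : Fin k → ℕ,
      (∀ i, 4 ≤ N i) →
      (∑ i, if (N i : ℝ) < β * Fintype.card V then (N i : ℝ) else 0) ≤ α * Fintype.card V →
      (∑ i, (N i - 1)) + Fintype.card W = Fintype.card V →
      ∃ g : Fin k → List V, IsHamSubdivision A (fun i => (f (a i).1, f (a i).2)) N g


section TT
variable {V : Type}

/-- missing out-arcs of `p` towards the members of `F` of in-class `b` -/
noncomputable def missO (A : V → V → Prop) (F : Finset V) (ci : V → Bool) (p : V) (b : Bool) : ℕ :=
  (F.filter (fun q => ci q = b ∧ ¬ A p q)).card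

/-- missing in-arcs of `p` from the members of `F` of out-class `b` -/
noncomputable def missI (A : V → V → Prop) (F : Finset V) (co : V → Bool) (p : V) (b : Bool) : ℕ :=
  (F.filter (fun q => co q = b ∧ ¬ A q p)).card

/-- the admissibility relation on tokens -/
def RT (A : V → V → Prop) (F : Finset V) (ci co : V → Bool) (η : ℕ) :
    V ⊕ (Bool × Bool) → V ⊕ (Bool × Bool) → Prop
  | .inl p, .inl q => A p q
  | .inl p, .inr c => missO A F ci p c.1 ≤ η
  | .inr c, .inl q => missI A F co q c.2 ≤ η
  | .inr c, .inr d => c.2 = d.1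

/-- the token of a vertex -/
noncomputable def tokF (F : Finset V) (ci co : V → Bool) (v : V) : V ⊕ (Bool × Bool) :=
  if v ∈ F then .inr (ci v, co v) else .inl v

/-- one improvement step -/
lemma tt_step (A : V → V → Prop) (F : Finset V) (ci co : V → Bool) (η K : ℕ)
    (hO : ∀ v ∈ F, missO A F ci v (co v) ≤ η) (hI : ∀ v ∈ F, missI A F co v (ci v) ≤ η)
    (hbig : ∀ v ∈ F, 3 + 4 * η + 2 * K < (F.filter (fun q => ci q = ci v ∧ co q = co v)).card)
    (E : Finset (V × V))
    (hRT : ∀ e ∈ E, RT A F ci co η (tokF F ci co e.1) (tokF F ci co e.2))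
    (hne : ∀ e ∈ E, e.1 ∈ F → e.1 ≠ e.2)
    (hs : ∀ e ∈ E, ∀ e' ∈ E, e.1 = e'.1 → e.1 ∈ F → e = e')
    (ht : ∀ e ∈ E, ∀ e' ∈ E, e.2 = e'.2 → e.2 ∈ F → e = e')
    (hK1 : (E.filter (fun e => e.1 ∉ F)).card ≤ K)
    (hK2 : (E.filter (fun e => e.2 ∉ F)).card ≤ K)
    (e0 : V × V) (he0 : e0 ∈ E) (hbad : ¬ A e0.1 e0.2) :
    ∃ π : Equiv.Perm V, (∀ v, tokF F ci co (π v) = tokF F ci co v) ∧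
      (E.filter (fun e => ¬ A (π e.1) (π e.2))).card < (E.filter (fun e => ¬ A e.1 e.2)).card := by
  -- choose the free vertex x of the bad pair
  obtain ⟨x, hxF, hx0⟩ : ∃ x ∈ F, e0.1 = x ∨ e0.2 = x := by
    by_contra hcon
    push Not at hcon
    have h1 : e0.1 ∉ F := fun h => (hcon _ h).1 rfl
    have h2 : e0.2 ∉ F := fun h => (hcon _ h).2 rfl
    have := hRT e0 he0
    simp only [tokF, h1, h2, if_false, RT] at this
    exact hbad this
  set L := F.filter (fun q => ci q = ci x ∧ co q = co x) with hL
  -- key class facts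
  have hpx : ∀ e ∈ E, e.2 ∈ F → missO A F ci e.1 (ci e.2) ≤ η := by
    intro e he h2
    have := hRT e he
    by_cases h1 : e.1 ∈ F
    · simp only [tokF, h1, h2, if_true, RT] at this
      rw [← this]; exact hO _ h1
    · simpa only [tokF, h1, h2, if_true, if_false, RT] using this
  have hxq : ∀ e ∈ E, e.1 ∈ F → missI A F co e.2 (co e.1) ≤ η := by
    intro e he h1
    have := hRT e he
    by_cases h2 : e.2 ∈ F
    · simp only [tokF, h1, h2, if_true, RT] at this
      rw [this]; exact hI _ h2
    · simpa only [tokF, h1, h2, if_true, if_false, RT] using this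
  -- excluded sets
  set X1 : Finset V := {x}
  set X2 : Finset V := (E.filter (fun e => e.1 = x)).image Prod.snd
  set X3 : Finset V := (E.filter (fun e => e.2 = x)).image Prod.fst
  set X4 : Finset V := L.filter (fun r => ∃ e ∈ E, e.2 = x ∧ ¬ A e.1 r)
  set X5 : Finset V := L.filter (fun r => ∃ e ∈ E, e.1 = x ∧ ¬ A r e.2)
  set X6 : Finset V := L.filter (fun r => ∃ e ∈ E, e.2 = r ∧ ¬ A e.1 x)
  set X7 : Finset V := L.filter (fun r => ∃ e ∈ E, e.1 = r ∧ ¬ A x e.2)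
  have c2 : X2.card ≤ 1 := by
    refine Finset.card_image_le.trans (Finset.card_le_one.mpr ?_)
    intro e he e' he'
    simp only [Finset.mem_filter] at he he'
    exact hs e he.1 e' he'.1 (he.2.trans he'.2.symm) (he.2 ▸ hxF)
  have c3 : X3.card ≤ 1 := by
    refine Finset.card_image_le.trans (Finset.card_le_one.mpr ?_)
    intro e he e' he'
    simp only [Finset.mem_filter] at he he'
    exact ht e he.1 e' he'.1 (he.2.trans he'.2.symm) (he.2 ▸ hxF)
  have c4 : X4.card ≤ η := by
    by_cases h : ∃ e ∈ E, e.2 = x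
    · obtain ⟨e, he, hex⟩ := h
      refine le_trans (Finset.card_le_card ?_) (hpx e he (hex ▸ hxF))
      intro r hr
      simp only [X4, hL, Finset.mem_filter] at hr ⊢
      obtain ⟨⟨hrF, hr1, hr2⟩, e', he', hx', hA⟩ := hr
      have : e' = e := ht e' he' e he (hx'.trans hex.symm) (hx' ▸ hxF)
      subst this
      exact ⟨hrF, by rw [hr1, hx'], hA⟩
    · have : X4 = ∅ := by
        apply Finset.eq_empty_of_forall_notMem
        intro r hr
        simp only [X4, Finset.mem_filter] at hr
        obtain ⟨_, e, he, hx', _⟩ := hr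
        exact h ⟨e, he, hx'⟩
      simp [this]
  have c5 : X5.card ≤ η := by
    by_cases h : ∃ e ∈ E, e.1 = x
    · obtain ⟨e, he, hex⟩ := h
      refine le_trans (Finset.card_le_card ?_) (hxq e he (hex ▸ hxF))
      intro r hr
      simp only [X5, hL, Finset.mem_filter] at hr ⊢
      obtain ⟨⟨hrF, hr1, hr2⟩, e', he', hx', hA⟩ := hr
      have : e' = e := hs e' he' e he (hx'.trans hex.symm) (hx' ▸ hxF)
      subst this
      exact ⟨hrF, by rw [hr2, hx'], hA⟩
    · have : X5 = ∅ := by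
        apply Finset.eq_empty_of_forall_notMem
        intro r hr
        simp only [X5, Finset.mem_filter] at hr
        obtain ⟨_, e, he, hx', _⟩ := hr
        exact h ⟨e, he, hx'⟩
      simp [this]
  have c6 : X6.card ≤ η + K := by
    have hsub : X6 ⊆ (E.filter (fun e => e.1 ∈ F ∧ e.2 ∈ L ∧ ¬ A e.1 x)).image Prod.snd ∪
        (E.filter (fun e => e.1 ∉ F)).image Prod.snd := by
      intro r hr
      simp only [X6, Finset.mem_filter] at hr
      obtain ⟨hrL, e, he, her, hA⟩ := hr
      simp only [Finset.mem_union, Finset.mem_image, Finset.mem_filter]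
      by_cases h1 : e.1 ∈ F
      · exact Or.inl ⟨e, ⟨he, h1, her ▸ hrL, hA⟩, her⟩
      · exact Or.inr ⟨e, ⟨he, h1⟩, her⟩
    refine (Finset.card_le_card hsub).trans ((Finset.card_union_le _ _).trans (add_le_add ?_
      (Finset.card_image_le.trans hK1)))
    refine Finset.card_image_le.trans (le_trans ?_ (hI x hxF))
    refine Finset.card_le_card_of_injOn Prod.fst ?_ ?_
    · intro e he
      simp only [Finset.coe_filter, Set.mem_ofPred_eq, hL, Finset.mem_filter] at he ⊢
      obtain ⟨heE, h1, ⟨h2, h3, h4⟩, hA⟩ := he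
      refine ⟨h1, ?_, hA⟩
      have := hRT e heE
      simp only [tokF, h1, h2, if_true, RT] at this
      rw [this, h3]
    · intro e he e' he' h
      simp only [Finset.coe_filter, Set.mem_ofPred_eq] at he he'
      exact hs e he.1 e' he'.1 h he.2.1
  have c7 : X7.card ≤ η + K := by
    have hsub : X7 ⊆ (E.filter (fun e => e.2 ∈ F ∧ e.1 ∈ L ∧ ¬ A x e.2)).image Prod.fst ∪
        (E.filter (fun e => e.2 ∉ F)).image Prod.fst := by
      intro r hr
      simp only [X7, Finset.mem_filter] at hr
      obtain ⟨hrL, e, he, her, hA⟩ := hr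
      simp only [Finset.mem_union, Finset.mem_image, Finset.mem_filter]
      by_cases h1 : e.2 ∈ F
      · exact Or.inl ⟨e, ⟨he, h1, her ▸ hrL, hA⟩, her⟩
      · exact Or.inr ⟨e, ⟨he, h1⟩, her⟩
    refine (Finset.card_le_card hsub).trans ((Finset.card_union_le _ _).trans (add_le_add ?_
      (Finset.card_image_le.trans hK2)))
    refine Finset.card_image_le.trans (le_trans ?_ (hO x hxF))
    refine Finset.card_le_card_of_injOn Prod.snd ?_ ?_
    · intro e he
      simp only [Finset.coe_filter, Set.mem_ofPred_eq, hL, Finset.mem_filter] at he ⊢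
      obtain ⟨heE, h1, ⟨h2, h3, h4⟩, hA⟩ := he
      refine ⟨h1, ?_, hA⟩
      have := hRT e heE
      simp only [tokF, h1, h2, if_true, RT] at this
      rw [← this, h4]
    · intro e he e' he' h
      simp only [Finset.coe_filter, Set.mem_ofPred_eq] at he he'
      exact ht e he.1 e' he'.1 h he.2.1
  obtain ⟨r, hrL, hrX⟩ : ∃ r ∈ L, r ∉ X1 ∪ X2 ∪ X3 ∪ X4 ∪ X5 ∪ X6 ∪ X7 := by
    by_contra hcon
    push Not at hcon
    have h1 := Finset.card_le_card (show L ⊆ X1 ∪ X2 ∪ X3 ∪ X4 ∪ X5 ∪ X6 ∪ X7 from hcon)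
    have h2 := hbig x hxF
    rw [← hL] at h2
    have e1 := Finset.card_union_le (X1 ∪ X2 ∪ X3 ∪ X4 ∪ X5 ∪ X6) X7
    have e2 := Finset.card_union_le (X1 ∪ X2 ∪ X3 ∪ X4 ∪ X5) X6
    have e3 := Finset.card_union_le (X1 ∪ X2 ∪ X3 ∪ X4) X5
    have e4 := Finset.card_union_le (X1 ∪ X2 ∪ X3) X4
    have e5 := Finset.card_union_le (X1 ∪ X2) X3
    have e6 := Finset.card_union_le X1 X2
    have e7 : X1.card = 1 := Finset.card_singleton x
    omega
  have hrF : r ∈ F ∧ ci r = ci x ∧ co r = co x := by simpa [hL] using hrL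
  simp only [Finset.mem_union, not_or] at hrX
  obtain ⟨⟨⟨⟨⟨⟨n1, n2⟩, n3⟩, n4⟩, n5⟩, n6⟩, n7⟩ := hrX
  have m1 : r ≠ x := by simpa [X1] using n1
  have m2 : ∀ e ∈ E, e.1 = x → e.2 ≠ r := fun e he h1 h2 => n2 (by
    simp only [X2, Finset.mem_image, Finset.mem_filter]; exact ⟨e, ⟨he, h1⟩, h2⟩)
  have m3 : ∀ e ∈ E, e.2 = x → e.1 ≠ r := fun e he h1 h2 => n3 (by
    simp only [X3, Finset.mem_image, Finset.mem_filter]; exact ⟨e, ⟨he, h1⟩, h2⟩)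
  have m4 : ∀ e ∈ E, e.2 = x → A e.1 r := fun e he h1 => by
    by_contra h2
    exact n4 (by simp only [X4, Finset.mem_filter]; exact ⟨hrL, e, he, h1, h2⟩)
  have m5 : ∀ e ∈ E, e.1 = x → A r e.2 := fun e he h1 => by
    by_contra h2
    exact n5 (by simp only [X5, Finset.mem_filter]; exact ⟨hrL, e, he, h1, h2⟩)
  have m6 : ∀ e ∈ E, e.2 = r → A e.1 x := fun e he h1 => by
    by_contra h2
    exact n6 (by simp only [X6, Finset.mem_filter]; exact ⟨hrL, e, he, h1, h2⟩)
  have m7 : ∀ e ∈ E, e.1 = r → A x e.2 := fun e he h1 => by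
    by_contra h2
    exact n7 (by simp only [X7, Finset.mem_filter]; exact ⟨hrL, e, he, h1, h2⟩)
  -- pairs touching x or r become good, the others do not change
  have hfix : ∀ v, v ≠ x → v ≠ r → Equiv.swap x r v = v := fun v h1 h2 =>
    Equiv.swap_apply_of_ne_of_ne h1 h2
  have key : ∀ e ∈ E, (e.1 = x ∨ e.2 = x ∨ e.1 = r ∨ e.2 = r) →
      A (Equiv.swap x r e.1) (Equiv.swap x r e.2) := by
    intro e he h
    rcases h with h | h | h | h
    · have h2 : e.2 ≠ x := fun h' => hne e he (h ▸ hxF) (h.trans h'.symm)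
      rw [h, Equiv.swap_apply_left, hfix _ h2 (m2 e he h)]; exact m5 e he h
    · have h2 : e.1 ≠ x := fun h' => hne e he (h' ▸ hxF) (h'.trans h.symm)
      rw [h, Equiv.swap_apply_left, hfix _ h2 (m3 e he h)]; exact m4 e he h
    · have h2 : e.2 ≠ r := fun h' => hne e he (h ▸ hrF.1) (h.trans h'.symm)
      have h3 : e.2 ≠ x := fun h' => m3 e he h' h
      rw [h, Equiv.swap_apply_right, hfix _ h3 h2]; exact m7 e he h
    · have h2 : e.1 ≠ r := fun h' => hne e he (h' ▸ hrF.1) (h'.trans h.symm)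
      have h3 : e.1 ≠ x := fun h' => m2 e he h' h
      rw [h, Equiv.swap_apply_right, hfix _ h3 h2]; exact m6 e he h
  refine ⟨Equiv.swap x r, ?_, ?_⟩
  · intro v
    by_cases h1 : v = x
    · subst h1; simp [tokF, hxF, hrF]
    by_cases h2 : v = r
    · subst h2; simp [tokF, hxF, hrF]
    rw [hfix v h1 h2]
  · apply Finset.card_lt_card
    refine ⟨?_, ?_⟩
    · intro e he
      simp only [Finset.mem_filter] at he ⊢
      refine ⟨he.1, ?_⟩
      by_cases h : e.1 = x ∨ e.2 = x ∨ e.1 = r ∨ e.2 = r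
      · exact absurd (key e he.1 h) he.2
      · push Not at h
        have h2 := he.2
        rwa [hfix _ h.1 h.2.2.1, hfix _ h.2.1 h.2.2.2] at h2
    · intro hsub
      have : e0 ∈ E.filter (fun e => ¬ A e.1 e.2) := by simp [he0, hbad]
      have := hsub this
      simp only [Finset.mem_filter] at this
      exact this.2 (key e0 he0 (hx0.elim Or.inl (fun h => Or.inr (Or.inl h))))

lemma tokF_eq_mem {F : Finset V} {ci co : V → Bool} {v w : V}
    (h : tokF F ci co v = tokF F ci co w) : v ∈ F ↔ w ∈ F := by
  unfold tokF at h
  by_cases h1 : v ∈ F <;> by_cases h2 : w ∈ F <;> simp_all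

lemma tt_perm (A : V → V → Prop) (F : Finset V) (ci co : V → Bool) (η K : ℕ)
    (hO : ∀ v ∈ F, missO A F ci v (co v) ≤ η) (hI : ∀ v ∈ F, missI A F co v (ci v) ≤ η)
    (hbig : ∀ v ∈ F, 3 + 4 * η + 2 * K < (F.filter (fun q => ci q = ci v ∧ co q = co v)).card) :
    ∀ (m : ℕ) (E : Finset (V × V))
    (_ : ∀ e ∈ E, RT A F ci co η (tokF F ci co e.1) (tokF F ci co e.2))
    (_ : ∀ e ∈ E, e.1 ∈ F → e.1 ≠ e.2)
    (_ : ∀ e ∈ E, ∀ e' ∈ E, e.1 = e'.1 → e.1 ∈ F → e = e')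
    (_ : ∀ e ∈ E, ∀ e' ∈ E, e.2 = e'.2 → e.2 ∈ F → e = e')
    (_ : (E.filter (fun e => e.1 ∉ F)).card ≤ K)
    (_ : (E.filter (fun e => e.2 ∉ F)).card ≤ K)
    (_ : (E.filter (fun e => ¬ A e.1 e.2)).card ≤ m),
    ∃ π : Equiv.Perm V, (∀ v, tokF F ci co (π v) = tokF F ci co v) ∧
      ∀ e ∈ E, A (π e.1) (π e.2) := by
  intro m
  induction m with
  | zero =>
    intro E _ _ _ _ _ _ h
    refine ⟨1, fun v => rfl, fun e he => ?_⟩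
    by_contra hb
    have : e ∈ E.filter (fun e => ¬ A e.1 e.2) := by
      simp only [Finset.mem_filter]; exact ⟨he, hb⟩
    have := Finset.card_pos.mpr ⟨e, this⟩
    omega
  | succ m ih =>
    intro E hRT hne hs ht hK1 hK2 h
    by_cases hgood : ∀ e ∈ E, A e.1 e.2
    · exact ⟨1, fun v => rfl, hgood⟩
    push Not at hgood
    obtain ⟨e0, he0, hbad⟩ := hgood
    obtain ⟨π, hπ, hlt⟩ := tt_step A F ci co η K hO hI hbig E hRT hne hs ht hK1 hK2 e0 he0 hbad
    have hmem : ∀ v, π v ∈ F ↔ v ∈ F := fun v => tokF_eq_mem (hπ v)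
    set P : V × V ↪ V × V := ⟨Prod.map π π, π.injective.prodMap π.injective⟩ with hP
    have hcard : ∀ (p q : V × V → Prop) [DecidablePred p] [DecidablePred q], (∀ e, p (P e) ↔ q e) →
        ((E.map P).filter p).card = (E.filter q).card := by
      intro p q _ _ hpq
      rw [Finset.filter_map, Finset.card_map]
      congr 1
      ext e
      simp [hpq e]
    have hPe : ∀ e, P e = (π e.1, π e.2) := fun e => rfl
    have hih := ih (E.map P) ?_ ?_ ?_ ?_ ?_ ?_ ?_
    · obtain ⟨ρ, hρ, hρA⟩ := hih
      refine ⟨π.trans ρ, fun v => ?_, fun e he => ?_⟩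
      · simp only [Equiv.trans_apply]; rw [hρ, hπ]
      · exact hρA (P e) (Finset.mem_map_of_mem P he)
    · intro e he
      obtain ⟨e', he', rfl⟩ := Finset.mem_map.mp he
      rw [hPe]; simp only [hπ]; exact hRT e' he'
    · intro e he
      obtain ⟨e', he', rfl⟩ := Finset.mem_map.mp he
      rw [hPe]; simp only [hmem]; intro h1 h2
      exact hne e' he' h1 (π.injective h2)
    · intro e he e2 he2
      obtain ⟨e', he', rfl⟩ := Finset.mem_map.mp he
      obtain ⟨e2', he2', rfl⟩ := Finset.mem_map.mp he2
      rw [hPe, hPe]; simp only [hmem]; intro h1 h2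
      rw [hs e' he' e2' he2' (π.injective h1) h2]
    · intro e he e2 he2
      obtain ⟨e', he', rfl⟩ := Finset.mem_map.mp he
      obtain ⟨e2', he2', rfl⟩ := Finset.mem_map.mp he2
      rw [hPe, hPe]; simp only [hmem]; intro h1 h2
      rw [ht e' he' e2' he2' (π.injective h1) h2]
    · rw [hcard (fun e => e.1 ∉ F) (fun e => e.1 ∉ F) (fun e => by rw [hPe]; simp only [hmem])]; exact hK1
    · rw [hcard (fun e => e.2 ∉ F) (fun e => e.2 ∉ F) (fun e => by rw [hPe]; simp only [hmem])]; exact hK2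
    · rw [hcard (fun e => ¬ A e.1 e.2) (fun e => ¬ A (π e.1) (π e.2)) (fun e => by rw [hPe])]; omega

end TT


section TT2
variable {V : Type}

lemma realize_step {α β : Type*} (f : α → β) (w : List β) :
    ∀ (T : Multiset β) (S : Multiset α), (w : Multiset β) + T = S.map f →
    ∃ (l : List α) (S' : Multiset α), S = (l : Multiset α) + S' ∧ l.map f = w ∧ S'.map f = T := by
  induction w with
  | nil => intro T S h; exact ⟨[], S, by simp, rfl, by simpa using h.symm⟩
  | cons b w ih =>
    intro T S h
    have h' : S.map f = b ::ₘ ((w : Multiset β) + T) := by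
      rw [← h, ← Multiset.cons_coe, Multiset.cons_add]
    obtain ⟨a, ha, hfa, hr⟩ := (Multiset.map_eq_cons f S _ b).mpr h'
    obtain ⟨l, S', h1, h2, h3⟩ := ih T (S.erase a) hr.symm
    refine ⟨a :: l, S', ?_, by simp [hfa, h2], h3⟩
    rw [← Multiset.cons_coe, Multiset.cons_add, ← h1, Multiset.cons_erase ha]

lemma realize {ι α β : Type*} (f : α → β) (w : ι → List β) (s : Finset ι) :
    ∀ (S : Multiset α), ∑ i ∈ s, (w i : Multiset β) = S.map f →
    ∃ J : ι → List α, ∑ i ∈ s, (J i : Multiset α) = S ∧ ∀ i ∈ s, (J i).map f = w i := by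
  induction s using Finset.induction_on with
  | empty =>
    intro S h
    have h2 : S = 0 := by simpa using h.symm
    exact ⟨fun _ => [], by simp [h2], by simp⟩
  | insert i s hi ih =>
    intro S h
    rw [Finset.sum_insert hi] at h
    obtain ⟨l, S', h1, h2, h3⟩ := realize_step f (w i) _ S h
    obtain ⟨J, h4, h5⟩ := ih S' h3.symm
    refine ⟨Function.update J i l, ?_, ?_⟩
    · rw [Finset.sum_insert hi, h1, Function.update_self]
      congr 1
      rw [← h4]
      refine Finset.sum_congr rfl fun j hj => ?_
      rw [Function.update_of_ne]; rintro rfl; exact hi hj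
    · intro j hj
      by_cases hji : j = i
      · subst hji; simpa using h2
      · rw [Function.update_of_ne hji]
        exact h5 j ((Finset.mem_insert.mp hj).resolve_left hji)

/-- consecutive pairs -/
def prs {α : Type*} : List α → List (α × α)
  | [] => []
  | [_] => []
  | a :: b :: l => (a, b) :: prs (b :: l)

lemma isChain_iff_prs {α : Type*} (R : α → α → Prop) : ∀ l : List α,
    l.IsChain R ↔ ∀ e ∈ prs l, R e.1 e.2
  | [] => by simp [prs]
  | [_] => by simp [prs]
  | a :: b :: l => by
    rw [List.isChain_cons_cons, isChain_iff_prs R (b :: l)]; simp [prs]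

lemma prs_fst {α : Type*} (t : α) : ∀ (l : List α) (s : α),
    (prs (s :: (l ++ [t]))).map Prod.fst = s :: l
  | [], s => by simp [prs]
  | a :: l, s => by
    have := prs_fst t l a
    simp only [List.cons_append, prs, List.map_cons] at this ⊢
    rw [this]

lemma prs_snd {α : Type*} (t : α) : ∀ (l : List α) (s : α),
    (prs (s :: (l ++ [t]))).map Prod.snd = l ++ [t]
  | [], s => by simp [prs]
  | a :: l, s => by
    have := prs_snd t l a
    simp only [List.cons_append, prs, List.map_cons] at this ⊢
    rw [this]

lemma prs_diag {α : Type*} (x : α) : ∀ l : List α, (x, x) ∈ prs l → 2 ≤ l.count x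
  | [], h => by simp [prs] at h
  | [_], h => by simp [prs] at h
  | a :: b :: l, h => by
    simp only [prs, List.mem_cons, Prod.mk.injEq] at h
    rcases h with ⟨h1, h2⟩ | h
    · subst h1; subst h2; simp
    · have := prs_diag x (b :: l) h
      exact this.trans (by rw [List.count_cons (l := b :: l)]; omega)

lemma prs_map {α β : Type*} (f : α → β) : ∀ l : List α,
    prs (l.map f) = (prs l).map (Prod.map f f)
  | [] => rfl
  | [_] => rfl
  | a :: b :: l => by
    have := prs_map f (b :: l)
    simp only [List.map_cons, prs] at this ⊢
    rw [this]; rfl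

lemma uniq_of_count {α β : Type*} (g : α → β) : ∀ (L : List α) (e e' : α),
    (L.map g).count (g e) ≤ 1 → e ∈ L → e' ∈ L → g e = g e' → e = e'
  | [], e, e', _, h, _, _ => by simp at h
  | a :: L, e, e', hc, h, h', hg => by
    rw [List.map_cons, List.count_cons] at hc
    rcases List.mem_cons.mp h with rfl | hL
    · rcases List.mem_cons.mp h' with rfl | h'
      · rfl
      · have : 0 < (L.map g).count (g e) :=
          List.count_pos_iff.mpr (hg ▸ List.mem_map_of_mem h')
        simp at hc; omega
    · rcases List.mem_cons.mp h' with rfl | h'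
      · have : 0 < (L.map g).count (g e) :=
          List.count_pos_iff.mpr (List.mem_map_of_mem hL)
        simp [hg] at hc; rw [← hg] at hc; omega
      · exact uniq_of_count g L e e' (by omega) hL h' hg

theorem tt_main {ι : Type} [Fintype ι] (A : V → V → Prop) (F Fix : Finset V) (ci co : V → Bool)
    (η : ℕ) (hdisj : Disjoint F Fix)
    (hO : ∀ v ∈ F, missO A F ci v (co v) ≤ η) (hI : ∀ v ∈ F, missI A F co v (ci v) ≤ η)
    (hbig : ∀ v ∈ F, 3 + 4 * η + 2 * (Fix.card + Fintype.card ι) <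
      (F.filter (fun q => ci q = ci v ∧ co q = co v)).card)
    (s t : ι → V) (hs : ∀ i, s i ∉ F) (ht : ∀ i, t i ∉ F)
    (w : ι → List (V ⊕ (Bool × Bool)))
    (hsum : ∑ i, (w i : Multiset (V ⊕ (Bool × Bool))) =
      Fix.val.map .inl + F.val.map (fun v => .inr (ci v, co v)))
    (hch : ∀ i, (.inl (s i) :: (w i ++ [.inl (t i)])).IsChain (RT A F ci co η)) :
    ∃ I : ι → List V, ∑ i, (I i : Multiset V) = Fix.val + F.val ∧
      ∀ i, (I i).length = (w i).length ∧ (s i :: (I i ++ [t i])).IsChain A := by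
  have hsum' : ∑ i, (w i : Multiset (V ⊕ (Bool × Bool))) =
      (Fix.val + F.val).map (tokF F ci co) := by
    rw [hsum, Multiset.map_add]
    congr 1
    · refine Multiset.map_congr rfl fun v hv => ?_
      have : v ∉ F := fun h => Finset.disjoint_left.mp hdisj h hv
      simp [tokF, this]
    · refine Multiset.map_congr rfl fun v hv => ?_
      have : v ∈ F := hv
      simp [tokF, this]
  obtain ⟨J, hJ, hJw⟩ := realize (tokF F ci co) w Finset.univ _ hsum'
  set PL : ι → List (V × V) := fun i => prs (s i :: (J i ++ [t i])) with hPL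
  set E : Finset (V × V) := Finset.univ.biUnion (fun i => (PL i).toFinset) with hE
  have hmemE : ∀ e, e ∈ E ↔ ∃ i, e ∈ PL i := by intro e; simp [hE]
  set PM : Multiset (V × V) := ∑ i, (PL i : Multiset (V × V)) with hPM
  have hmemPM : ∀ e, e ∈ PM ↔ ∃ i, e ∈ PL i := by
    intro e; simp [hPM, Multiset.mem_sum]
  have hfst : PM.map Prod.fst = (∑ i, ({s i} : Multiset V)) + (Fix.val + F.val) := by
    rw [hPM, ← Multiset.coe_mapAddMonoidHom, map_sum, ← hJ, ← Finset.sum_add_distrib]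
    refine Finset.sum_congr rfl fun i _ => ?_
    simp only [Multiset.coe_mapAddMonoidHom, Multiset.map_coe, hPL, prs_fst]
    rfl
  have hsnd : PM.map Prod.snd = (∑ i, ({t i} : Multiset V)) + (Fix.val + F.val) := by
    rw [hPM, ← Multiset.coe_mapAddMonoidHom, map_sum, ← hJ, ← Finset.sum_add_distrib]
    refine Finset.sum_congr rfl fun i _ => ?_
    simp only [Multiset.coe_mapAddMonoidHom, Multiset.map_coe, hPL, prs_snd]
    rw [← Multiset.coe_add, add_comm]; rfl
  have hcs : ∀ (g : ι → V), (∀ i, g i ∉ F) → ∀ x ∈ F,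
      ((∑ i, ({g i} : Multiset V)) + (Fix.val + F.val)).count x = 1 := by
    intro g hg x hx
    rw [Multiset.count_add, Multiset.count_add, Multiset.count_sum']
    have h1 : ∑ i, ({g i} : Multiset V).count x = 0 := by
      refine Finset.sum_eq_zero fun i _ => ?_
      rw [Multiset.count_singleton, if_neg]; rintro rfl; exact hg i hx
    have h2 : Fix.val.count x = 0 :=
      Multiset.count_eq_zero.mpr (fun h => Finset.disjoint_left.mp hdisj hx h)
    have h3 : F.val.count x = 1 := Multiset.count_eq_one_of_mem F.nodup hx
    rw [h1, h2, h3]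
  have huniq : ∀ (g : V × V → V), (∀ x ∈ F, (PM.map g).count x = 1) →
      ∀ e ∈ E, ∀ e' ∈ E, g e = g e' → g e ∈ F → e = e' := by
    intro g hg e he e' he' h hF
    have h1 := (hmemPM e).mpr ((hmemE e).mp he)
    have h2 := (hmemPM e').mpr ((hmemE e').mp he')
    obtain ⟨L, hL⟩ := Quot.exists_rep PM
    have hL' : PM = (L : Multiset _) := hL.symm
    have h3 := hg _ hF
    rw [hL'] at h1 h2 h3
    exact uniq_of_count g L e e' (by rw [Multiset.map_coe, Multiset.coe_count] at h3; omega)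
      (by simpa using h1) (by simpa using h2) h
  have hEcard : ∀ (g : V × V → V) (h : ι → V),
      PM.map g = (∑ i, ({h i} : Multiset V)) + (Fix.val + F.val) →
      (E.filter (fun e => g e ∉ F)).card ≤ Fix.card + Fintype.card ι := by
    intro g h hg
    have h1 : (E.filter (fun e => g e ∉ F)).val ≤ PM.filter (fun e => g e ∉ F) := by
      rw [Multiset.le_iff_subset (Finset.nodup _)]
      intro e he
      have he' : e ∈ E.filter (fun e => g e ∉ F) := he
      rw [Finset.mem_filter] at he'
      rw [Multiset.mem_filter, hmemPM]
      exact ⟨(hmemE e).mp he'.1, he'.2⟩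
    have h2 := Multiset.card_le_card h1
    have h3 : Multiset.card (PM.filter (fun e => g e ∉ F)) =
        Multiset.card ((PM.map g).filter (fun v => v ∉ F)) := by
      rw [Multiset.filter_map, Multiset.card_map]; rfl
    rw [h3, hg, Multiset.filter_add, Multiset.filter_add, Multiset.card_add, Multiset.card_add] at h2
    have h4 : Multiset.card (F.val.filter (fun v => v ∉ F)) = 0 := by
      rw [Multiset.card_eq_zero, Multiset.filter_eq_nil]; intro a ha; simpa using ha
    have h5 : Multiset.card (Fix.val.filter (fun v => v ∉ F)) ≤ Fix.card :=
      Multiset.card_le_card (Multiset.filter_le _ _)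
    have h6 : Multiset.card ((∑ i, ({h i} : Multiset V)).filter (fun v => v ∉ F)) ≤
        Fintype.card ι := by
      refine (Multiset.card_le_card (Multiset.filter_le _ _)).trans ?_
      simp
    have : (E.filter (fun e => g e ∉ F)).card = Multiset.card (E.filter (fun e => g e ∉ F)).val := rfl
    omega
  have hinl : ∀ v, v ∉ F → tokF F ci co v = .inl v := fun v hv => by simp [tokF, hv]
  obtain ⟨π, hπ, hπA⟩ := tt_perm A F ci co η (Fix.card + Fintype.card ι) hO hI hbig _ E
    (by
      intro e he
      obtain ⟨i, hi⟩ := (hmemE e).mp he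
      have h := hch i
      have heq : (Sum.inl (s i) :: (w i ++ [Sum.inl (t i)])) =
          (s i :: (J i ++ [t i])).map (tokF F ci co) := by
        simp [hinl _ (hs i), hinl _ (ht i), hJw i (Finset.mem_univ i)]
      rw [heq, isChain_iff_prs, prs_map] at h
      exact h _ (List.mem_map_of_mem hi))
    (by
      intro e he h1 h2
      obtain ⟨i, hi⟩ := (hmemE e).mp he
      have hee : e = (e.1, e.1) := Prod.ext rfl h2.symm
      rw [hee] at hi
      have h3 := prs_diag _ _ hi
      have h4 : (J i).count e.1 ≤ 1 := by
        have h5 : (J i : Multiset V) ≤ Fix.val + F.val := by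
          rw [← hJ]; exact Finset.single_le_sum (f := fun i => (J i : Multiset V))
            (fun _ _ => Multiset.zero_le _) (Finset.mem_univ i)
        have h6 := Multiset.count_le_of_le e.1 h5
        have h7 := hcs s hs e.1 h1
        rw [Multiset.count_add] at h7
        rw [Multiset.coe_count] at h6
        omega
      have n1 : s i ≠ e.1 := fun h => hs i (h ▸ h1)
      have n2 : t i ≠ e.1 := fun h => ht i (h ▸ h1)
      rw [List.count_cons_of_ne n1, List.count_append] at h3
      have : List.count e.1 [t i] = 0 := by
        rw [List.count_eq_zero]; simpa using n2.symm
      omega)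
    (huniq Prod.fst (fun x hx => by rw [hfst]; exact hcs s hs x hx))
    (huniq Prod.snd (fun x hx => by rw [hsnd]; exact hcs t ht x hx))
    (hEcard Prod.fst s hfst) (hEcard Prod.snd t hsnd) le_rfl
  have hπF : ∀ v, v ∉ F → π v = v := by
    intro v hv
    have h1 := hπ v
    have h2 : π v ∉ F := fun h => hv ((tokF_eq_mem h1).mp h)
    rw [hinl _ hv, hinl _ h2] at h1
    exact Sum.inl_injective h1
  refine ⟨fun i => (J i).map π, ?_, fun i => ⟨?_, ?_⟩⟩
  · have h1 : ∑ i, (((J i).map π : List V) : Multiset V) = (Fix.val + F.val).map π := by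
      rw [← hJ, ← Multiset.coe_mapAddMonoidHom, map_sum]
      rfl
    rw [h1, Multiset.map_add]
    congr 1
    · conv_rhs => rw [← Multiset.map_id Fix.val]
      refine Multiset.map_congr rfl fun v hv => hπF v ?_
      exact fun h => Finset.disjoint_left.mp hdisj h hv
    · have h2 : F.map π.toEmbedding = F := by
        ext v
        simp only [Finset.mem_map_equiv]
        have := tokF_eq_mem (hπ (π.symm v))
        rw [Equiv.apply_symm_apply] at this
        exact this.symm
      conv_rhs => rw [← h2]
      rfl
  · rw [List.length_map, ← hJw i (Finset.mem_univ i), List.length_map]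
  · have heq : (s i :: ((J i).map π ++ [t i])) = (s i :: (J i ++ [t i])).map π := by
      simp [hπF _ (hs i), hπF _ (ht i)]
    rw [heq, isChain_iff_prs, prs_map]
    intro e he
    obtain ⟨e', he', rfl⟩ := List.mem_map.mp he
    exact hπA e' ((hmemE e').mpr ⟨i, he'⟩)

end TT2


section M1
variable {V : Type}

lemma ham_of_interiors [Fintype V] (A : V → V → Prop) {k : ℕ} (s t : Fin k → V) (N : Fin k → ℕ)
    (Br nb : Finset V) (hBr : ∀ x, x ∈ Br ↔ ∃ i, x = s i ∨ x = t i)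
    (hnb : ∀ x, x ∈ nb ↔ x ∉ Br)
    (I : Fin k → List V) (hI : ∑ i, (I i : Multiset V) = nb.val)
    (hN : ∀ i, 1 ≤ N i)
    (hlen : ∀ i, (I i).length = N i - 1)
    (hch : ∀ i, (s i :: (I i ++ [t i])).IsChain A) :
    ∃ g, IsHamSubdivision A (fun i => (s i, t i)) N g := by
  have hmem : ∀ i x, x ∈ I i → x ∈ nb := by
    intro i x hx
    have : x ∈ ∑ i, (I i : Multiset V) := by
      rw [Multiset.mem_sum]; exact ⟨i, Finset.mem_univ i, by simpa using hx⟩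
    rw [hI] at this; exact this
  have hnBr : ∀ i x, x ∈ I i → x ∉ Br := fun i x hx => (hnb x).mp (hmem i x hx)
  have hs : ∀ i, s i ∈ Br := fun i => (hBr _).mpr ⟨i, Or.inl rfl⟩
  have ht : ∀ i, t i ∈ Br := fun i => (hBr _).mpr ⟨i, Or.inr rfl⟩
  have hnd : ∀ i, (I i).Nodup := by
    intro i
    have h1 : (I i : Multiset V) ≤ nb.val := by
      rw [← hI]; exact Finset.single_le_sum (f := fun i => (I i : Multiset V))
            (fun _ _ => Multiset.zero_le _) (Finset.mem_univ i)
    exact Multiset.coe_nodup.mp (Multiset.nodup_of_le h1 nb.nodup)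
  have hinter : ∀ i, listInterior (s i :: (I i ++ [t i])) = I i := by
    intro i; simp [listInterior]
  refine ⟨fun i => s i :: (I i ++ [t i]), fun i => ⟨⟨hch i, by simp, ?_, ?_, ?_⟩, ?_⟩, ?_, ?_⟩
  · show (s i :: (I i ++ [t i])).getLast? = some (t i)
    rw [← List.cons_append, List.getLast?_append]; simp
  · intro _
    show ((s i :: (I i ++ [t i])).dropLast).Nodup
    rw [← List.cons_append, List.dropLast_concat, List.nodup_cons]
    exact ⟨fun h => hnBr i _ h (hs i), hnd i⟩
  · intro hne
    show (s i :: (I i ++ [t i])).Nodup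
    rw [List.nodup_cons, List.nodup_append]
    refine ⟨?_, hnd i, by simp, ?_⟩
    · simp only [List.mem_append, List.mem_singleton, not_or]
      exact ⟨fun h => hnBr i _ h (hs i), hne⟩
    · intro x hx y hy
      rw [List.mem_singleton] at hy
      rintro rfl
      exact hnBr i _ hx (hy ▸ ht i)
  · have := hlen i; have := hN i
    simp; omega
  · intro i j hij x hx
    rw [hinter i] at hx
    have h1 := hnBr i x hx
    simp only [List.mem_cons, List.mem_append, List.not_mem_nil, or_false, not_or]
    refine ⟨fun h => h1 (h ▸ hs j), fun hxj => ?_, fun h => h1 (h ▸ ht j)⟩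
    have h2 : (I i : Multiset V) + (I j : Multiset V) ≤ nb.val := by
      rw [← hI]
      rw [← Finset.sum_pair hij (f := fun i => (I i : Multiset V))]
      exact Finset.sum_le_sum_of_subset (Finset.subset_univ _)
    have h3 := Multiset.nodup_of_le h2 nb.nodup
    rw [Multiset.coe_add, Multiset.coe_nodup, List.nodup_append] at h3
    exact h3.2.2 x hx x hxj rfl
  · intro x
    by_cases hx : x ∈ Br
    · obtain ⟨i, h | h⟩ := (hBr x).mp hx
      · exact ⟨i, by simp [h]⟩
      · exact ⟨i, by simp [h]⟩
    · have : x ∈ ∑ i, (I i : Multiset V) := by rw [hI]; exact (hnb x).mpr hx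
      rw [Multiset.mem_sum] at this
      obtain ⟨i, _, hi⟩ := this
      refine ⟨i, ?_⟩
      have : x ∈ I i := by simpa using hi
      simp [this]
end M1

section Arr

/-- characteristic function of the class `X = true` -/
def chi (b : Bool) : ℤ := if b then 1 else 0

/-- balance of a letter -/
def lb (c : Bool × Bool) : ℤ := chi c.1 - chi c.2

/-- a list of letters forming a walk from `a` to `b` -/
def IsCls {β : Type*} (cls : β → Bool × Bool) (a b : Bool) : List β → Prop
  | [] => a = b
  | x :: L => (cls x).1 = a ∧ IsCls cls (cls x).2 b L

lemma arrange {β : Type*} (cls : β → Bool × Bool) : ∀ (m : ℕ) (L : List β) (_ : L.length = m)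
    (a b : Bool),
    (L.map (fun x => lb (cls x))).sum = chi a - chi b →
    ((∃ x ∈ L, (cls x).1 ≠ (cls x).2) ∨ ∀ x ∈ L, cls x = (a, a)) →
    ∃ L', L'.Perm L ∧ IsCls cls a b L' := by
  intro m
  induction m with
  | zero =>
    intro L hL a b h _
    have : L = [] := List.length_eq_zero_iff.mp hL
    subst this
    refine ⟨[], List.Perm.refl _, ?_⟩
    cases a <;> cases b <;> simp [chi, IsCls] at h ⊢
  | succ m ih =>
    intro L hL a b h hc
    have step : ∀ x ∈ L, (cls x).1 = a →
        ((∃ y ∈ L.erase x, (cls y).1 ≠ (cls y).2) ∨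
          ∀ y ∈ L.erase x, cls y = ((cls x).2, (cls x).2)) →
        ∃ L', L'.Perm L ∧ IsCls cls a b L' := by
      intro x hx hxa hcond
      have hp := List.perm_cons_erase hx
      have h1 : (L.map (fun x => lb (cls x))).sum =
          lb (cls x) + ((L.erase x).map (fun x => lb (cls x))).sum := by
        rw [(hp.map _).sum_eq]; simp
      obtain ⟨L', hL', hcls⟩ := ih (L.erase x) (by rw [List.length_erase_of_mem hx]; omega)
        (cls x).2 b (by rw [h1] at h; simp only [lb, hxa] at h ⊢; linarith) hcond
      exact ⟨x :: L', (hL'.cons x).trans hp.symm, hxa, hcls⟩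
    by_cases hloop : ∃ x ∈ L, cls x = (a, a)
    · obtain ⟨x, hx, hxa⟩ := hloop
      refine step x hx (by rw [hxa]) ?_
      rcases hc with ⟨y, hy, hyne⟩ | hc
      · left
        refine ⟨y, (List.mem_erase_of_ne ?_).mpr hy, hyne⟩
        rintro rfl; simp [hxa] at hyne
      · right; intro y hy; rw [hxa]; exact hc y (List.mem_of_mem_erase hy)
    · push Not at hloop
      have hne : L ≠ [] := by rintro rfl; simp at hL
      have htr : ∃ x ∈ L, (cls x).1 ≠ (cls x).2 := by
        rcases hc with h' | h'
        · exact h'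
        · obtain ⟨x, hx⟩ := List.exists_mem_of_ne_nil L hne
          exact absurd (h' x hx) (hloop x hx)
      have hout : ∃ x ∈ L, (cls x).1 = a ∧ (cls x).2 = !a := by
        by_contra hcon
        push Not at hcon
        -- all have lb ≤ 0 (a = true) resp ≥ 0
        obtain ⟨y, hy, hyne⟩ := htr
        have hp := List.perm_cons_erase hy
        have h1 : (L.map (fun x => lb (cls x))).sum =
            lb (cls y) + ((L.erase y).map (fun x => lb (cls x))).sum := by
          rw [(hp.map _).sum_eq]; simp
        have hy2 := hcon y hy
        cases a
        · have h2 : 0 ≤ ((L.erase y).map (fun x => lb (cls x))).sum := by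
            apply List.sum_nonneg
            intro z hz
            obtain ⟨w, hw, rfl⟩ := List.mem_map.mp hz
            have := hcon w (List.mem_of_mem_erase hw)
            rcases hw' : cls w with ⟨c1, c2⟩
            rw [hw'] at this
            cases c1 <;> cases c2 <;> simp [lb, chi] at this ⊢
          rcases hw' : cls y with ⟨c1, c2⟩
          rw [hw'] at hy2 hyne h1
          rw [h] at h1
          generalize ((L.erase y).map (fun x => lb (cls x))).sum = T at *
          cases c1 <;> cases c2 <;> cases b <;> simp [lb, chi] at hy2 hyne h1 <;> omega
        · have h2 : 0 ≤ ((L.erase y).map (fun x => - lb (cls x))).sum := by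
            apply List.sum_nonneg
            intro z hz
            obtain ⟨w, hw, rfl⟩ := List.mem_map.mp hz
            have := hcon w (List.mem_of_mem_erase hw)
            rcases hw' : cls w with ⟨c1, c2⟩
            rw [hw'] at this
            cases c1 <;> cases c2 <;> simp [lb, chi] at this ⊢
          have h3 : ((L.erase y).map (fun x => - lb (cls x))).sum =
              - ((L.erase y).map (fun x => lb (cls x))).sum := by
            clear h2 h1
            induction (L.erase y) with
            | nil => simp
            | cons z l ih => simp [ih]; ring
          rcases hw' : cls y with ⟨c1, c2⟩
          rw [hw'] at hy2 hyne h1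
          rw [h] at h1
          generalize ((L.erase y).map (fun x => lb (cls x))).sum = T at *
          cases c1 <;> cases c2 <;> cases b <;> simp [lb, chi] at hy2 hyne h1 <;> omega
      obtain ⟨x, hx, hx1, hx2⟩ := hout
      refine step x hx hx1 ?_
      by_cases h2 : ∃ y ∈ L.erase x, (cls y).1 ≠ (cls y).2
      · exact Or.inl h2
      · right
        push Not at h2
        intro y hy
        have h3 := h2 y hy
        have h4 := hloop y (List.mem_of_mem_erase hy)
        rw [hx2]
        rcases hw' : cls y with ⟨c1, c2⟩
        rw [hw'] at h3 h4
        cases a <;> cases c1 <;> cases c2 <;> simp at h3 h4 ⊢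

/-- a token list that is a walk of free-ended blocks -/
def Seg {V : Type} (R : V ⊕ (Bool × Bool) → V ⊕ (Bool × Bool) → Prop) (a b : Bool)
    (l : List (V ⊕ (Bool × Bool))) : Prop :=
  l.IsChain R ∧ (∃ h, l.head? = some (.inr h) ∧ h.1 = a) ∧ ∃ h, l.getLast? = some (.inr h) ∧ h.2 = b

lemma seg_flatten {V : Type} (A : V → V → Prop) (F : Finset V) (ci co : V → Bool) (η : ℕ)
    {β : Type*} (cls : β → Bool × Bool)
    (bl : β → List (V ⊕ (Bool × Bool))) :
    ∀ (L : List β) (_ : ∀ x ∈ L, Seg (RT A F ci co η) (cls x).1 (cls x).2 (bl x)) (a b : Bool),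
    IsCls cls a b L →
    ((L.flatMap bl = [] ∧ a = b ∧ L = []) ∨ Seg (RT A F ci co η) a b (L.flatMap bl))
  | [], _, a, b, h => Or.inl ⟨rfl, h, rfl⟩
  | x :: L, hL, a, b, h => by
    right
    obtain ⟨h1, h2⟩ := h
    have hx := hL x (List.mem_cons_self)
    rw [h1] at hx
    obtain ⟨c1, ⟨p, hp, hpa⟩, ⟨r, hr, hrb⟩⟩ := hx
    rcases seg_flatten A F ci co η cls bl L (fun y hy => hL y (List.mem_cons_of_mem _ hy)) _ b h2 with
      ⟨h3, h4, _⟩ | ⟨c2, ⟨p', hp', hpa'⟩, ⟨r', hr', hrb'⟩⟩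
    · rw [List.flatMap_cons, h3, List.append_nil]
      exact ⟨c1, ⟨p, hp, hpa⟩, ⟨r, hr, by rw [hrb, h4]⟩⟩
    · rw [List.flatMap_cons]
      refine ⟨List.isChain_append.mpr ⟨c1, c2, ?_⟩, ⟨p, ?_, hpa⟩, ⟨r', ?_, hrb'⟩⟩
      · intro z hz y hy
        rw [hr] at hz; rw [hp'] at hy
        simp only [Option.mem_def, Option.some.injEq] at hz hy
        subst hz; subst hy
        show r.2 = p'.1
        rw [hrb, hpa']
      · rw [List.head?_append, hp]; rfl
      · rw [List.getLast?_append, hr']; rfl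
end Arr

set_option linter.unusedSectionVars false

/-- requests for reserved vertices -/
inductive Req (V : Type) (k : ℕ) where
  | o (v : V) (b : Bool) : Req V k
  | i (v : V) (b : Bool) : Req V k
  | t (j : Fin k) (b : Bool) : Req V k
  | h (j : Fin k) (b : Bool) : Req V k

/-- valid requests -/
def ReqOK {V : Type} {k : ℕ} (Sp : Finset V) (In Out : V → Bool → Prop) (s t : Fin k → V) :
    Req V k → Prop
  | .o v b => v ∈ Sp ∧ Out v b
  | .i v b => v ∈ Sp ∧ In v b
  | .t j b => Out (s j) b
  | .h j b => In (t j) b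

/-- The structure obtained from the extremal partition after cleaning. -/
structure Setup {V : Type} [Fintype V] (A : V → V → Prop) {k : ℕ} (s t : Fin k → V) where
  ci : V → Bool
  co : V → Bool
  In : V → Bool → Prop
  Out : V → Bool → Prop
  F : Finset V
  Sp : Finset V
  Br : Finset V
  η : ℕ
  ω : ℕ
  res : Req V k → V
  hBr : ∀ x, x ∈ Br ↔ ∃ i, x = s i ∨ x = t i
  hFBr : ∀ x ∈ F, x ∉ Br
  hSp : ∀ x, x ∈ Sp ↔ x ∉ F ∧ x ∉ Br
  hIne : ∀ v, ∃ b, In v b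
  hOne : ∀ v, ∃ b, Out v b
  hIF : ∀ v ∈ F, ∀ b, In v b ↔ b = ci v
  hOF : ∀ v ∈ F, ∀ b, Out v b ↔ b = co v
  hmO : ∀ v ∈ F, missO A F ci v (co v) ≤ η
  hmI : ∀ v ∈ F, missI A F co v (ci v) ≤ η
  ro : ∀ v ∈ Sp, ∀ b, Out v b → res (.o v b) ∈ F ∧ ci (res (.o v b)) = b ∧ A v (res (.o v b))
  ri : ∀ v ∈ Sp, ∀ b, In v b → res (.i v b) ∈ F ∧ co (res (.i v b)) = b ∧ A (res (.i v b)) v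
  rt : ∀ j b, Out (s j) b → res (.t j b) ∈ F ∧ ci (res (.t j b)) = b ∧ A (s j) (res (.t j b))
  rh : ∀ j b, In (t j) b → res (.h j b) ∈ F ∧ co (res (.h j b)) = b ∧ A (res (.h j b)) (t j)
  rinj : ∀ r r' : Req V k,
ReqOK Sp In Out s t r → ReqOK Sp In Out s t r' → res r = res r' → r = r'
  nfO : ∀ v ∈ Sp, ∀ b, In v b → ∀ j, ¬ Out (s j) (!(ci (res (.i v b)))) → A (s j) (res (.i v b))
  nfI : ∀ v ∈ Sp, ∀ b, Out v b → ∀ j, ¬ In (t j) (!(co (res (.o v b)))) → A (res (.o v b)) (t j)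
  nfm : ∀ j b, ¬ In (t j) (!b) → missI A F co (t j) b ≤ η
  hineqO : ∀ b, 2 * (Finset.univ.filter (fun v => ¬ Out v (!b))).card + 2 * k + 2 * ω ≤ Fintype.card V
  hineqI : ∀ b, 2 * (Finset.univ.filter (fun v => ¬ In v (!b))).card + 2 * k + 2 * ω ≤ Fintype.card V

section Asm
variable {V : Type} [Fintype V] {A : V → V → Prop} {k : ℕ} {s t : Fin k → V}

/-- token balance -/
def tb (cs ds : V → Bool) : V ⊕ (Bool × Bool) → ℤ
  | .inl v => lb (cs v, ds v)
  | .inr c => lb c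

/-- the word of a special vertex placed as a block -/
def itemW (x y : V → V) (pre post : V → List (Bool × Bool)) (v : V) : List (V ⊕ (Bool × Bool)) :=
  (pre v).map .inr ++ [.inl (x v), .inl v, .inl (y v)] ++ (post v).map .inr

/-- number of free vertices of a given letter -/
noncomputable def Setup.fc (S : Setup A s t) (c : Bool × Bool) : ℕ :=
  (S.F.filter (fun v => S.ci v = c.1 ∧ S.co v = c.2)).card

/-- combinatorial plan at the level of counts -/
structure Plan (S : Setup A s t) (N : Fin k → ℕ) (i0 : Fin k) where
  a : Fin k → Bool
  b : Fin k → Bool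
  cs : V → Bool
  ds : V → Bool
  pre : V → List (Bool × Bool)
  post : V → List (Bool × Bool)
  icls : V → Bool × Bool
  q : Fin k → Option V
  own : V → Fin k
  fl : Fin k → Multiset (Bool × Bool)
  ha : ∀ j, S.Out (s j) (a j)
  hb : ∀ j, S.In (t j) (b j)
  hcF : ∀ v ∈ S.F, cs v = S.ci v ∧ ds v = S.co v
  hcS : ∀ v ∈ S.Sp, S.In v (cs v) ∧ S.Out v (ds v)
  hit : ∀ v ∈ S.Sp, Seg (RT A S.F S.ci S.co S.η) (icls v).1 (icls v).2
    (itemW (fun v => S.res (.i v (cs v))) (fun v => S.res (.o v (ds v))) pre post v)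
  hitb : ∀ v ∈ S.Sp, ((itemW (fun v => S.res (.i v (cs v))) (fun v => S.res (.o v (ds v)))
    pre post v).map (tb cs ds)).sum = lb (icls v)
  hq0 : q i0 = none
  hq : ∀ j v, q j = some v → v ∈ S.Sp ∧ own v = j
  hsel : ∑ v ∈ S.F, lb (cs v, ds v) + ∑ v ∈ S.Sp, lb (cs v, ds v) = ∑ j, (chi (a j) - chi (b j))
  hP : ∀ j, j ≠ i0 → q j = none →
    2 + ∑ v ∈ S.Sp.filter (fun v => own v = j), (3 + (pre v).length + (post v).length) +
      Multiset.card (fl j) = N j - 1 ∧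
    ∑ v ∈ S.Sp.filter (fun v => own v = j), lb (icls v) + ((fl j).map lb).sum =
      chi (S.co (S.res (.t j (a j)))) - chi (S.ci (S.res (.h j (b j)))) ∧
    ((∃ v ∈ S.Sp, own v = j ∧ (icls v).1 ≠ (icls v).2) ∨ (∃ c ∈ fl j, c.1 ≠ c.2) ∨
      (fl j ≠ 0 ∧ (∀ v ∈ S.Sp, own v = j →
          icls v = (S.co (S.res (.t j (a j))), S.co (S.res (.t j (a j))))) ∧
        ∀ c ∈ fl j, c = (S.co (S.res (.t j (a j))), S.co (S.res (.t j (a j))))))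
  hQ : ∀ j v, q j = some v →
    (∀ w ∈ S.Sp, own w = j → w = v) ∧
    3 + Multiset.card (fl j) = N j - 1 ∧
    ((fl j).map lb).sum = chi (S.co (S.res (.o v (ds v)))) - chi (b j) ∧
    ((∃ c ∈ fl j, c.1 ≠ c.2) ∨
      ∀ c ∈ fl j, c = (S.co (S.res (.o v (ds v))), S.co (S.res (.o v (ds v))))) ∧
    a j = S.ci (S.res (.i v (cs v))) ∧ ¬ S.Out (s j) (!(a j)) ∧ ¬ S.In (t j) (!(b j))
  hsz : ∀ c, (S.fc c = 0 ∧ (∀ j, j ≠ i0 → (fl j).count c = 0) ∧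
      ∀ v ∈ S.Sp, ((pre v ++ post v : List (Bool × Bool)) : Multiset (Bool × Bool)).count c = 0) ∨
    ∑ j ∈ Finset.univ.erase i0, (fl j).count c + ∑ v ∈ S.Sp, ((pre v ++ post v : List (Bool × Bool)) : Multiset (Bool × Bool)).count c +
      (3 + 4 * S.η + 8 * S.Sp.card + 8 * k) < S.fc c
  hmain : (∃ v ∈ S.Sp, own v = i0 ∧ (icls v).1 ≠ (icls v).2) ∨ (∃ c : Bool × Bool, c.1 ≠ c.2 ∧ S.fc c ≠ 0)

lemma RT_mono (A : V → V → Prop) {F F' : Finset V} (h : F' ⊆ F) (ci co : V → Bool) (η : ℕ)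
    (x y : V ⊕ (Bool × Bool)) (hxy : RT A F ci co η x y) : RT A F' ci co η x y := by
  rcases x with x | x <;> rcases y with y | y
  · exact hxy
  · exact (Finset.card_le_card (Finset.filter_subset_filter _ h)).trans hxy
  · exact (Finset.card_le_card (Finset.filter_subset_filter _ h)).trans hxy
  · exact hxy

lemma Seg.mono {R R' : V ⊕ (Bool × Bool) → V ⊕ (Bool × Bool) → Prop} (h : ∀ x y, R x y → R' x y)
    {a b : Bool} {l : List (V ⊕ (Bool × Bool))} (hl : Seg R a b l) : Seg R' a b l :=
  ⟨hl.1.imp (fun x y => h x y), hl.2⟩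

/-- chain of a full word -/
lemma word_chain {R : V ⊕ (Bool × Bool) → V ⊕ (Bool × Bool) → Prop} (S0 l E0 : List (V ⊕ (Bool × Bool)))
    (x y : V ⊕ (Bool × Bool)) (d e : Bool)
    (h1 : S0.IsChain R) (h2 : E0.IsChain R) (hx : S0.getLast? = some x) (hy : E0.head? = some y)
    (hxd : ∀ c : Bool × Bool, c.1 = d → R x (.inr c)) (hye : ∀ c : Bool × Bool, c.2 = e → R (.inr c) y)
    (hl : (l = [] ∧ R x y) ∨ Seg R d e l) : (S0 ++ (l ++ E0)).IsChain R := by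
  rcases hl with ⟨rfl, hxy⟩ | ⟨hc, ⟨p, hp, hpd⟩, ⟨r, hr, hre⟩⟩
  · rw [List.nil_append, List.isChain_append]
    refine ⟨h1, h2, ?_⟩
    intro z hz w hw
    rw [hx] at hz; rw [hy] at hw
    simp only [Option.mem_def, Option.some.injEq] at hz hw
    subst hz; subst hw; exact hxy
  · rw [List.isChain_append, List.isChain_append]
    refine ⟨h1, ⟨hc, h2, ?_⟩, ?_⟩
    · intro z hz w hw
      rw [hr] at hz; rw [hy] at hw
      simp only [Option.mem_def, Option.some.injEq] at hz hw
      subst hz; subst hw; exact hye _ hre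
    · intro z hz w hw
      rw [List.head?_append, hp] at hw
      rw [hx] at hz
      simp only [Option.mem_def, Option.some.injEq, Option.some_or] at hz hw
      subst hz; subst hw; exact hxd _ hpd

end Asm

set_option linter.unusedSectionVars false
section Asm2
variable {V : Type} [Fintype V] {A : V → V → Prop} {k : ℕ} {s t : Fin k → V}

lemma sum_flatMap_coe {α β : Type*} (L : List α) (f : α → List β) :
    ((L.flatMap f : List β) : Multiset β) = (L.map (fun x => (f x : Multiset β))).sum := by
  induction L with
  | nil => rfl
  | cons x L ih => simp only [List.flatMap_cons, List.map_cons, List.sum_cons, ← Multiset.coe_add, ih]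

lemma sum_singleton_map {α β : Type*} (T : Finset α) (f : α → β) :
    ∑ v ∈ T, ({f v} : Multiset β) = T.val.map f := by
  rw [← Multiset.sum_map_singleton (T.val.map f), Multiset.map_map]
  rfl

theorem assembly (S : Setup A s t) (N : Fin k → ℕ) (i0 : Fin k) (P : Plan S N i0)
    (hN : ∀ j, 1 ≤ N j) (hNsum : ∑ j, (N j - 1) + S.Br.card = Fintype.card V) :
    ∃ g, IsHamSubdivision A (fun i => (s i, t i)) N g := by
  -- abbreviations
  set nI : V → V := fun v => S.res (.i v (P.cs v)) with hnI
  set nO : V → V := fun v => S.res (.o v (P.ds v)) with hnO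
  set tl : Fin k → V := fun j => S.res (.t j (P.a j)) with htl
  set hd : Fin k → V := fun j => S.res (.h j (P.b j)) with hhd
  have fI : ∀ v ∈ S.Sp, nI v ∈ S.F ∧ S.co (nI v) = P.cs v ∧ A (nI v) v := fun v hv =>
    S.ri v hv _ (P.hcS v hv).1
  have fO : ∀ v ∈ S.Sp, nO v ∈ S.F ∧ S.ci (nO v) = P.ds v ∧ A v (nO v) := fun v hv =>
    S.ro v hv _ (P.hcS v hv).2
  have fT : ∀ j, tl j ∈ S.F ∧ S.ci (tl j) = P.a j ∧ A (s j) (tl j) := fun j => S.rt j _ (P.ha j)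
  have fH : ∀ j, hd j ∈ S.F ∧ S.co (hd j) = P.b j ∧ A (hd j) (t j) := fun j => S.rh j _ (P.hb j)
  set Pf : Finset (Fin k) := Finset.univ.filter (fun j => P.q j = none) with hPf
  -- used requests
  set MU : Multiset (Req V k) := S.Sp.val.map (fun v => Req.i v (P.cs v)) +
    S.Sp.val.map (fun v => Req.o v (P.ds v)) + Pf.val.map (fun j => Req.t j (P.a j)) +
    Pf.val.map (fun j => Req.h j (P.b j)) with hMU
  have hMUok : ∀ r ∈ MU, ReqOK S.Sp S.In S.Out s t r := by
    intro r hr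
    simp only [hMU, Multiset.mem_add, Multiset.mem_map] at hr
    rcases hr with ((⟨v, hv, rfl⟩ | ⟨v, hv, rfl⟩) | ⟨v, hv, rfl⟩) | ⟨v, hv, rfl⟩
    · exact ⟨hv, (P.hcS v hv).1⟩
    · exact ⟨hv, (P.hcS v hv).2⟩
    · exact P.ha v
    · exact P.hb v
  have hMUnd : MU.Nodup := by
    have e1 : (S.Sp.val.map (fun v => (Req.i v (P.cs v) : Req V k))).Nodup :=
      S.Sp.nodup.map (fun x y h => by injection h)
    have e2 : (S.Sp.val.map (fun v => (Req.o v (P.ds v) : Req V k))).Nodup :=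
      S.Sp.nodup.map (fun x y h => by injection h)
    have e3 : (Pf.val.map (fun j => (Req.t j (P.a j) : Req V k))).Nodup :=
      Pf.nodup.map (fun x y h => by injection h)
    have e4 : (Pf.val.map (fun j => (Req.h j (P.b j) : Req V k))).Nodup :=
      Pf.nodup.map (fun x y h => by injection h)
    rw [hMU]
    refine (Multiset.Nodup.add_iff ((Multiset.Nodup.add_iff ((Multiset.Nodup.add_iff e1 e2).mpr ?_) e3).mpr ?_) e4).mpr ?_
    all_goals
      rw [Multiset.disjoint_left]
      intro r h1 h2
      simp only [Multiset.mem_add, Multiset.mem_map] at h1 h2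
    · obtain ⟨v, _, rfl⟩ := h1
      obtain ⟨w, _, h⟩ := h2
      cases h
    · obtain ⟨w, _, rfl⟩ := h2
      rcases h1 with ⟨v, _, h⟩ | ⟨v, _, h⟩ <;> cases h
    · obtain ⟨w, _, rfl⟩ := h2
      rcases h1 with (⟨v, _, h⟩ | ⟨v, _, h⟩) | ⟨v, _, h⟩ <;> cases h
  set U : Finset V := ⟨MU.map S.res, hMUnd.map_on
    (fun x hx y hy h => S.rinj x y (hMUok x hx) (hMUok y hy) h)⟩ with hU
  have hUval : U.val = S.Sp.val.map nI + S.Sp.val.map nO + Pf.val.map tl + Pf.val.map hd := by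
    simp only [hU, hMU, Multiset.map_add, Multiset.map_map]
    rfl
  have hUF : U ⊆ S.F := by
    intro x hx
    have hx' : x ∈ U.val := hx
    rw [hUval] at hx'
    simp only [Multiset.mem_add, Multiset.mem_map] at hx'
    rcases hx' with ((⟨v, hv, rfl⟩ | ⟨v, hv, rfl⟩) | ⟨v, hv, rfl⟩) | ⟨v, hv, rfl⟩
    · exact (fI v hv).1
    · exact (fO v hv).1
    · exact (fT v).1
    · exact (fH v).1
  have hUcard : U.card ≤ 2 * S.Sp.card + 2 * k := by
    have h1 : U.card = Multiset.card U.val := rfl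
    rw [h1, hUval]
    have h2 : Pf.card ≤ k := by simpa using Finset.card_le_univ Pf
    simp only [Multiset.card_add, Multiset.card_map, Finset.card_val]
    omega
  have hSpF : ∀ v ∈ S.Sp, v ∉ S.F := fun v hv => ((S.hSp v).mp hv).1
  have hdSU : Disjoint S.Sp U := by
    rw [Finset.disjoint_left]; intro v hv hU; exact hSpF v hv (hUF hU)
  set Fix : Finset V := S.Sp.disjUnion U hdSU with hFix
  have hFixval : Fix.val = S.Sp.val + U.val := rfl
  have hFixcard : Fix.card ≤ 3 * S.Sp.card + 2 * k := by
    rw [hFix, Finset.card_disjUnion]; omega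
  set F' : Finset V := S.F \ U with hF'
  have hF'F : F' ⊆ S.F := Finset.sdiff_subset
  have hFval : F'.val + U.val = S.F.val := by
    rw [hF', Finset.sdiff_val]; exact tsub_add_cancel_of_le (Finset.val_le_iff.mpr hUF)
  set lt : V → Bool × Bool := fun v => (S.ci v, S.co v) with hlt
  have hfcF : ∀ c, (S.F.val.map lt).count c = S.fc c := by
    intro c
    rw [Multiset.count_map, Setup.fc, Finset.card_def, Finset.filter_val]
    congr 1
    refine Multiset.filter_congr fun v _ => ?_
    simp only [hlt, Prod.ext_iff]
    exact and_congr eq_comm eq_comm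
  have hF'c : ∀ c, S.fc c ≤ (F'.val.map lt).count c + U.card := by
    intro c
    rw [← hfcF c, ← hFval, Multiset.map_add, Multiset.count_add]
    have : (U.val.map lt).count c ≤ U.card := by
      refine (Multiset.count_le_card _ _).trans ?_; simp
    omega
  have hF'le : ∀ c, (F'.val.map lt).count c ≤ S.fc c := by
    intro c
    rw [← hfcF c, ← hFval, Multiset.map_add, Multiset.count_add]; omega
  -- items sets
  set Qs : V → Prop := fun v => ∃ j, P.q j = some v with hQs
  set sp : Fin k → Finset V := fun j => S.Sp.filter (fun v => P.own v = j ∧ P.q j ≠ some v) with hsp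
  set pad : V → Multiset (Bool × Bool) := fun v => ((P.pre v ++ P.post v : List _) : Multiset _) with hpad
  -- free letters
  set used : Multiset (Bool × Bool) := ∑ j ∈ Finset.univ.erase i0, P.fl j + ∑ j, ∑ v ∈ sp j, pad v
    with hused
  have hspsum : ∀ c, (∑ j, ∑ v ∈ sp j, pad v).count c ≤ ∑ v ∈ S.Sp, (pad v).count c := by
    intro c
    have h1 : (∑ j, ∑ v ∈ sp j, pad v).count c = ∑ j, ∑ v ∈ sp j, (pad v).count c := by
      rw [Multiset.count_sum']
      refine Finset.sum_congr rfl fun j _ => ?_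
      rw [Multiset.count_sum']
    rw [h1, ← Finset.sum_fiberwise S.Sp P.own]
    refine Finset.sum_le_sum fun j _ => Finset.sum_le_sum_of_subset ?_
    intro v hv
    simp only [hsp, Finset.mem_filter] at hv ⊢
    exact ⟨hv.1, hv.2.1⟩
  have husedle : used ≤ F'.val.map lt := by
    rw [Multiset.le_iff_count]
    intro c
    have h1 := hspsum c
    have h2 : used.count c = ∑ j ∈ Finset.univ.erase i0, (P.fl j).count c +
        (∑ j, ∑ v ∈ sp j, pad v).count c := by
      rw [hused, Multiset.count_add, Multiset.count_sum']
    rw [h2]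
    rcases P.hsz c with ⟨h3, h4, h5⟩ | h3
    · have h6 : ∑ j ∈ Finset.univ.erase i0, (P.fl j).count c = 0 :=
        Finset.sum_eq_zero fun j hj => h4 j (Finset.ne_of_mem_erase hj)
      have h7 : ∑ v ∈ S.Sp, (pad v).count c = 0 :=
        Finset.sum_eq_zero fun v hv => h5 v hv
      omega
    · have h8 := hF'c c
      have h9 : ∑ j ∈ Finset.univ.erase i0, (P.fl j).count c + ∑ v ∈ S.Sp, (pad v).count c +
        (3 + 4 * S.η + 8 * S.Sp.card + 8 * k) < S.fc c := h3
      omega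
  set flM : Fin k → Multiset (Bool × Bool) := Function.update P.fl i0 (F'.val.map lt - used) with hflM
  have hflne : ∀ j, j ≠ i0 → flM j = P.fl j := fun j hj => Function.update_of_ne hj _ _
  have hfl0 : flM i0 = F'.val.map lt - used := Function.update_self _ _ _
  have hflsum : ∑ j, flM j + ∑ j, ∑ v ∈ sp j, pad v = F'.val.map lt := by
    rw [← Finset.add_sum_erase _ _ (Finset.mem_univ i0), hfl0]
    rw [Finset.sum_congr rfl (fun j hj => hflne j (Finset.ne_of_mem_erase hj)), add_assoc, ← hused]
    exact tsub_add_cancel_of_le husedle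
  -- blocks
  set item : V → List (V ⊕ (Bool × Bool)) := itemW nI nO P.pre P.post with hitem
  set bl : V ⊕ (Bool × Bool) → List (V ⊕ (Bool × Bool)) :=
    Sum.elim item (fun c => [.inr c]) with hbl
  set cls : V ⊕ (Bool × Bool) → Bool × Bool := Sum.elim P.icls id with hcls
  set Bl : Fin k → List (V ⊕ (Bool × Bool)) := fun j =>
    (sp j).toList.map .inl ++ (flM j).toList.map .inr with hBl
  set stL : Fin k → List V := fun j => match P.q j with
    | none => [tl j] | some v => [nI v, v, nO v] with hstL
  set enL : Fin k → List V := fun j => match P.q j with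
    | none => [hd j] | some _ => [] with henL
  set dcl : Fin k → Bool := fun j => match P.q j with
    | none => S.co (tl j) | some v => S.co (nO v) with hdcl
  set ecl : Fin k → Bool := fun j => match P.q j with
    | none => S.ci (hd j) | some _ => P.b j with hecl
  set pw : Fin k → Multiset (V ⊕ (Bool × Bool)) := fun j =>
    ((stL j : Multiset V)).map .inl + ((Bl j).flatMap bl : Multiset _) +
      ((enL j : Multiset V)).map .inl with hpw
  set core : V → Multiset V := fun v => {nI v} + {v} + {nO v} with hcore
  have hitemM : ∀ v, (item v : Multiset (V ⊕ (Bool × Bool))) = (core v).map .inl + (pad v).map .inr := by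
    intro v
    have h3 : ∀ a b c : V ⊕ (Bool × Bool), (([a, b, c] : List _) : Multiset (V ⊕ (Bool × Bool))) =
      {a} + {b} + {c} := fun a b c => rfl
    simp only [hitem, itemW, hcore, hpad, ← Multiset.coe_add, ← Multiset.map_coe, Multiset.map_add,
      Multiset.map_singleton, h3]
    abel
  have hBlM : ∀ j, ((Bl j).flatMap bl : Multiset (V ⊕ (Bool × Bool))) =
      ∑ v ∈ sp j, ((core v).map .inl + (pad v).map .inr) + (flM j).map .inr := by
    intro j
    rw [sum_flatMap_coe]
    simp only [hBl, List.map_append, List.sum_append, List.map_map]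
    congr 1
    · rw [← Finset.sum_map_toList]
      refine congrArg _ (List.map_congr_left fun v _ => ?_)
      exact hitemM v
    · have : ∀ L : List (Bool × Bool), (List.map ((fun x => ((bl x : List _) :
          Multiset (V ⊕ (Bool × Bool)))) ∘ Sum.inr) L).sum = ((L : Multiset (Bool × Bool))).map .inr := by
        intro L
        induction L with
        | nil => rfl
        | cons c L ih =>
          rw [List.map_cons, List.sum_cons, ih, ← Multiset.cons_coe, Multiset.map_cons]
          rfl
      rw [this, Multiset.coe_toList]
  have hstM : ∀ j, ((stL j : Multiset V)) + (enL j : Multiset V) + ∑ v ∈ sp j, core v =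
      (if P.q j = none then {tl j} + {hd j} else 0) +
        ∑ v ∈ S.Sp.filter (fun v => P.own v = j), core v := by
    intro j
    rcases hqj : P.q j with _ | v
    · simp only [hstL, henL, hqj, hsp, if_true]
      congr 1
      · exact Finset.sum_congr (by ext; simp) fun _ _ => rfl
    · simp only [hstL, henL, hqj, hsp, reduceCtorEq, if_false]
      obtain ⟨hv, hvo⟩ := P.hq j v hqj
      have h1 : v ∈ S.Sp.filter (fun v => P.own v = j) := by simp [hv, hvo]
      rw [← Finset.add_sum_erase _ _ h1]
      have h2 : (S.Sp.filter (fun v => P.own v = j)).erase v =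
          S.Sp.filter (fun w => P.own w = j ∧ some v ≠ some w) := by
        ext w; simp only [Finset.mem_erase, Finset.mem_filter, ne_eq, Option.some.injEq]
        constructor
        · rintro ⟨h, h', h''⟩; exact ⟨h', h'', fun e => h e.symm⟩
        · rintro ⟨h', h'', h⟩; exact ⟨fun e => h e.symm, h', h''⟩
      rw [h2]
      have h3 : (([nI v, v, nO v] : List V) : Multiset V) = core v := rfl
      rw [h3]
      simp
  have hcoreSum : ∀ (T : Finset V), ∑ v ∈ T, core v = T.val.map nI + T.val + T.val.map nO := by
    intro T
    simp only [hcore, Finset.sum_add_distrib]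
    have : ∀ f : V → V, ∑ v ∈ T, ({f v} : Multiset V) = T.val.map f := by
      intro f
      exact sum_singleton_map T f
    rw [this nI, this nO, Finset.sum_multiset_singleton]
  have htot : ∑ j, pw j = Fix.val.map .inl + F'.val.map (fun v => .inr (S.ci v, S.co v)) := by
    have h1 : ∀ j, pw j = ((stL j : Multiset V) + (enL j : Multiset V) + ∑ v ∈ sp j, core v).map .inl +
        (flM j + ∑ v ∈ sp j, pad v).map .inr := by
      intro j
      simp only [hpw]
      rw [hBlM]
      simp only [Multiset.map_add, Finset.sum_add_distrib, ← Multiset.coe_mapAddMonoidHom, map_sum]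
      abel
    have h2 : ∑ j, ((stL j : Multiset V) + (enL j : Multiset V) + ∑ v ∈ sp j, core v) = Fix.val := by
      rw [Finset.sum_congr rfl (fun j _ => hstM j), Finset.sum_add_distrib, Finset.sum_fiberwise,
        hcoreSum, hFixval, hUval]
      have h4 : ∑ j, (if P.q j = none then ({tl j} + {hd j} : Multiset V) else 0) =
          Pf.val.map tl + Pf.val.map hd := by
        rw [← Finset.sum_filter, Finset.sum_add_distrib]
        have : ∀ f : Fin k → V, ∑ v ∈ Pf, ({f v} : Multiset V) = Pf.val.map f := by
          intro f
          exact sum_singleton_map Pf f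
        rw [← this tl, ← this hd]
      rw [h4]
      abel
    rw [Finset.sum_congr rfl (fun j _ => h1 j), Finset.sum_add_distrib]
    simp only [← Multiset.coe_mapAddMonoidHom]
    rw [← map_sum, ← map_sum, h2, Finset.sum_add_distrib, hflsum]
    simp only [Multiset.coe_mapAddMonoidHom, Multiset.map_map]
    rfl
  have hcs' : ∀ v ∈ S.F, lb (P.cs v, P.ds v) = chi (S.ci v) - chi (S.co v) := by
    intro v hv; rw [(P.hcF v hv).1, (P.hcF v hv).2]; rfl
  set TB : Multiset (V ⊕ (Bool × Bool)) → ℤ := fun m => (m.map (tb P.cs P.ds)).sum with hTB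
  have TBadd : ∀ m m', TB (m + m') = TB m + TB m' := by intro m m'; simp [hTB]
  have TBsum : ∀ f : Fin k → Multiset (V ⊕ (Bool × Bool)), TB (∑ j, f j) = ∑ j, TB (f j) := by
    intro f
    simp only [hTB, ← Multiset.coe_mapAddMonoidHom, map_sum]
    simp only [← Multiset.coe_sumAddMonoidHom, map_sum]
  have hTBtot : TB (∑ j, pw j) = ∑ j, (chi (P.a j) - chi (P.b j)) := by
    rw [← P.hsel, htot, TBadd, hFixval]
    have h1 : ∀ T : Finset V, TB (T.val.map .inl) = ∑ v ∈ T, lb (P.cs v, P.ds v) := by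
      intro T
      simp only [hTB, Multiset.map_map]
      rfl
    have h2 : TB (F'.val.map (fun v => .inr (S.ci v, S.co v))) = ∑ v ∈ F', lb (P.cs v, P.ds v) := by
      simp only [hTB, Multiset.map_map]
      refine congrArg Multiset.sum (Multiset.map_congr rfl fun v hv => ?_)
      exact (hcs' v (hF'F hv)).symm
    rw [Multiset.map_add, TBadd, h1, h1, h2]
    have h3 := Finset.sum_sdiff (f := fun v => lb (P.cs v, P.ds v)) hUF
    rw [← h3]; ring
  have hst : ∀ j, TB ((stL j : Multiset V).map .inl) = chi (P.a j) - chi (dcl j) := by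
    intro j
    rcases hqj : P.q j with _ | v
    · simp only [hstL, hdcl, hqj, hTB]
      have := hcs' _ (fT j).1
      rw [(fT j).2.1] at this
      simpa [tb] using this
    · simp only [hstL, hdcl, hqj, hTB]
      obtain ⟨hv, hvo⟩ := P.hq j v hqj
      have h1 := hcs' _ (fI v hv).1
      have h2 := hcs' _ (fO v hv).1
      have h3 : P.a j = S.ci (nI v) := (P.hQ j v hqj).2.2.2.2.1
      rw [(fI v hv).2.1] at h1
      rw [(fO v hv).2.1] at h2
      have h4 : lb (P.cs v, P.ds v) = chi (P.cs v) - chi (P.ds v) := rfl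
      rw [h3]
      simp only [Multiset.map_coe, List.map_cons, List.map_nil, Multiset.sum_coe, List.sum_cons, List.sum_nil, tb]
      linarith
  have hen : ∀ j, TB ((enL j : Multiset V).map .inl) = chi (ecl j) - chi (P.b j) := by
    intro j
    rcases hqj : P.q j with _ | v
    · simp only [henL, hecl, hqj, hTB]
      have := hcs' _ (fH j).1
      rw [(fH j).2.1] at this
      simpa [tb] using this
    · simp [henL, hecl, hqj, hTB]
  have hspS : ∀ j, ∀ v ∈ sp j, v ∈ S.Sp := fun j v hv => (Finset.mem_filter.mp hv).1
  have hblS : ∀ j, ∀ x ∈ Bl j, Seg (RT A S.F S.ci S.co S.η) (cls x).1 (cls x).2 (bl x) ∧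
      ((bl x).map (tb P.cs P.ds)).sum = lb (cls x) := by
    intro j x hx
    simp only [hBl, List.mem_append, List.mem_map, Finset.mem_toList, Multiset.mem_toList] at hx
    rcases hx with ⟨v, hv, rfl⟩ | ⟨c, hc, rfl⟩
    · exact ⟨P.hit v (hspS j v hv), P.hitb v (hspS j v hv)⟩
    · refine ⟨⟨List.isChain_singleton _, ⟨c, rfl, rfl⟩, ⟨c, rfl, rfl⟩⟩, ?_⟩
      simp [hbl, hcls, tb]
  have hflat : ∀ L : List (V ⊕ (Bool × Bool)), (∀ x ∈ L, ((bl x).map (tb P.cs P.ds)).sum = lb (cls x)) →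
      ((L.flatMap bl).map (tb P.cs P.ds)).sum = (L.map (fun x => lb (cls x))).sum := by
    intro L
    induction L with
    | nil => intro _; rfl
    | cons x L ih =>
      intro h
      rw [List.flatMap_cons, List.map_append, List.sum_append, List.map_cons, List.sum_cons,
        h x List.mem_cons_self, ih fun y hy => h y (List.mem_cons_of_mem _ hy)]
  have hTBbl : ∀ j, TB ((Bl j).flatMap bl : Multiset _) = ((Bl j).map (fun x => lb (cls x))).sum := by
    intro j
    rw [← hflat _ (fun x hx => (hblS j x hx).2)]
    simp [hTB]
  have hBlsum : ∀ j, ((Bl j).map (fun x => lb (cls x))).sum =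
      ∑ v ∈ sp j, lb (P.icls v) + ((flM j).map lb).sum := by
    intro j
    simp only [hBl, List.map_append, List.sum_append, List.map_map]
    congr 1
    · rw [← Finset.sum_map_toList]; rfl
    · conv_rhs => rw [← Multiset.coe_toList (flM j)]
      rw [Multiset.map_coe, Multiset.sum_coe]; rfl
  have hspP : ∀ j, P.q j = none → sp j = S.Sp.filter (fun v => P.own v = j) := by
    intro j hj; simp only [hsp, hj]; ext; simp
  have hspQ : ∀ j v, P.q j = some v → sp j = ∅ := by
    intro j v hj
    rw [Finset.eq_empty_iff_forall_notMem]
    intro w hw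
    simp only [hsp, Finset.mem_filter, hj] at hw
    exact hw.2.2 (congrArg some ((P.hQ j v hj).1 w hw.1 hw.2.1).symm)
  have hi0Q : ∀ j v, P.q j = some v → j ≠ i0 := by
    rintro j v h rfl; rw [P.hq0] at h; cases h
  have hBB0 : ∀ j, j ≠ i0 → ((Bl j).map (fun x => lb (cls x))).sum = chi (dcl j) - chi (ecl j) := by
    intro j hj
    rw [hBlsum, hflne j hj]
    rcases hqj : P.q j with _ | v
    · rw [hspP j hqj, (P.hP j hj hqj).2.1]
      simp only [hdcl, hecl, hqj]
      rfl
    · rw [hspQ j v hqj, (P.hQ j v hqj).2.2.1]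
      simp only [hdcl, hecl, hqj, Finset.sum_empty, zero_add]
      rfl
  have hTBpw : ∀ j, TB (pw j) = chi (P.a j) - chi (dcl j) + ((Bl j).map (fun x => lb (cls x))).sum +
      (chi (ecl j) - chi (P.b j)) := by
    intro j
    simp only [hpw]
    rw [TBadd, TBadd, hst, hen, hTBbl]
  have hBB : ∀ j, ((Bl j).map (fun x => lb (cls x))).sum = chi (dcl j) - chi (ecl j) := by
    intro j
    by_cases hj : j = i0
    · subst hj
      have h1 := TBsum pw
      rw [hTBtot, ← Finset.add_sum_erase _ _ (Finset.mem_univ j),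
        ← Finset.add_sum_erase _ _ (Finset.mem_univ j)] at h1
      have h2 : ∑ i ∈ Finset.univ.erase j, TB (pw i) = ∑ i ∈ Finset.univ.erase j, (chi (P.a i) - chi (P.b i)) := by
        refine Finset.sum_congr rfl fun i hi => ?_
        rw [hTBpw, hBB0 i (Finset.ne_of_mem_erase hi)]; ring
      rw [h2, hTBpw] at h1
      linarith
    · exact hBB0 j hj
  have hmainc : ∀ c, S.fc c ≠ 0 → c ∈ flM i0 := by
    intro c hc
    rcases P.hsz c with ⟨h3, h4, h5⟩ | h3
    · exact absurd h3 hc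
    · have h9 : ∑ j ∈ Finset.univ.erase i0, (P.fl j).count c + ∑ v ∈ S.Sp, (pad v).count c +
        (3 + 4 * S.η + 8 * S.Sp.card + 8 * k) < S.fc c := h3
      have h8 := hF'c c
      have h1 := hspsum c
      rw [← Multiset.count_pos, hfl0, Multiset.count_sub, hused, Multiset.count_add, Multiset.count_sum']
      omega
  have htrans : ∀ j, (∃ x ∈ Bl j, (cls x).1 ≠ (cls x).2) ∨
      ((P.q j = none → Bl j ≠ []) ∧ ∀ x ∈ Bl j, cls x = (dcl j, dcl j)) := by
    intro j
    have eS : P.q j = none → ∀ v ∈ S.Sp, P.own v = j → .inl v ∈ Bl j := by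
      intro hqj v hv hvo
      simp [hBl, hspP j hqj, hv, hvo]
    have eF : ∀ c ∈ flM j, .inr c ∈ Bl j := by
      intro c hc; simp [hBl, hc]
    by_cases hj : j = i0
    · subst hj
      left
      rcases P.hmain with ⟨v, hv, hvo, h⟩ | ⟨c, hc, hf⟩
      · exact ⟨_, eS P.hq0 v hv hvo, h⟩
      · exact ⟨_, eF c (hmainc c hf), hc⟩
    · rw [hflne j hj] at eF
      rcases hqj : P.q j with _ | v
      · rcases (P.hP j hj hqj).2.2 with ⟨v, hv, hvo, h⟩ | ⟨c, hc, h⟩ | ⟨h1, h2, h3⟩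
        · exact Or.inl ⟨_, eS hqj v hv hvo, h⟩
        · exact Or.inl ⟨_, eF c hc, h⟩
        · right
          refine ⟨fun _ h => ?_, ?_⟩
          · obtain ⟨c, hc⟩ := Multiset.exists_mem_of_ne_zero h1
            have := eF c hc
            rw [h] at this; cases this
          · intro x hx
            have hd' : dcl j = S.co (S.res (.t j (P.a j))) := by simp only [hdcl, hqj]; rfl
            rw [hd']
            simp only [hBl, List.mem_append, List.mem_map, Finset.mem_toList, Multiset.mem_toList, hspP j hqj,
              hflne j hj, Finset.mem_filter] at hx
            rcases hx with ⟨v, hv, rfl⟩ | ⟨c, hc, rfl⟩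
            · exact h2 v hv.1 hv.2
            · exact h3 c hc
      · rcases (P.hQ j v hqj).2.2.2.1 with ⟨c, hc, h⟩ | h3
        · exact Or.inl ⟨_, eF c hc, h⟩
        · right
          refine ⟨fun h => by simp at h, ?_⟩
          intro x hx
          have hd' : dcl j = S.co (S.res (.o v (P.ds v))) := by simp only [hdcl, hqj]; rfl
          rw [hd']
          simp only [hBl, List.mem_append, List.mem_map, Finset.mem_toList, Multiset.mem_toList, hspQ j v hqj,
            hflne j hj, Finset.notMem_empty, false_and, exists_false, false_or] at hx
          obtain ⟨c, hc, rfl⟩ := hx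
          exact h3 c hc
  have harr : ∀ j, ∃ L', L'.Perm (Bl j) ∧ IsCls cls (dcl j) (ecl j) L' := by
    intro j
    refine arrange cls _ (Bl j) rfl _ _ (hBB j) ?_
    rcases htrans j with h | h
    · exact Or.inl h
    · exact Or.inr h.2
  choose L' hLp hLc using harr
  have hBlne : ∀ j, P.q j = none → Bl j ≠ [] := by
    intro j hj
    rcases htrans j with ⟨x, hx, _⟩ | h
    · intro h; rw [h] at hx; cases hx
    · exact h.1 hj
  set w : Fin k → List (V ⊕ (Bool × Bool)) := fun j =>
    (stL j).map .inl ++ ((L' j).flatMap bl ++ (enL j).map .inl) with hw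
  have hwpw : ∀ j, (w j : Multiset (V ⊕ (Bool × Bool))) = pw j := by
    intro j
    simp only [hw, hpw, ← Multiset.coe_add, ← Multiset.map_coe]
    rw [← add_assoc]
    congr 2
    exact Multiset.coe_eq_coe.mpr ((hLp j).flatMap_right bl)
  have hmono := fun x y => RT_mono A hF'F S.ci S.co S.η x y
  have hO' : ∀ v ∈ S.F, missO A F' S.ci v (S.co v) ≤ S.η := fun v hv =>
    (Finset.card_le_card (Finset.filter_subset_filter _ hF'F)).trans (S.hmO v hv)
  have hI' : ∀ v ∈ S.F, missI A F' S.co v (S.ci v) ≤ S.η := fun v hv =>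
    (Finset.card_le_card (Finset.filter_subset_filter _ hF'F)).trans (S.hmI v hv)
  have hch : ∀ j, (.inl (s j) :: (w j ++ [.inl (t j)])).IsChain (RT A F' S.ci S.co S.η) := by
    intro j
    have hseg := seg_flatten A F' S.ci S.co S.η cls bl (L' j) (fun x hx =>
      Seg.mono hmono (hblS j x ((hLp j).mem_iff.mp hx)).1) _ _ (hLc j)
    have e : (.inl (s j) :: (w j ++ [.inl (t j)]) : List (V ⊕ (Bool × Bool))) =
        (.inl (s j) :: (stL j).map .inl) ++ ((L' j).flatMap bl ++ ((enL j).map .inl ++ [.inl (t j)])) := by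
      simp [hw]
    rw [e]
    rcases hqj : P.q j with _ | v
    · have hne := hBlne j hqj
      have hseg' : Seg (RT A F' S.ci S.co S.η) (dcl j) (ecl j) ((L' j).flatMap bl) := by
        rcases hseg with ⟨_, _, h⟩ | h
        · exact absurd (List.Perm.eq_nil (h ▸ (hLp j).symm)) hne
        · exact h
      simp only [hdcl, hecl, hqj] at hseg'
      simp only [hstL, henL, hqj]
      refine word_chain _ _ _ (.inl (tl j)) (.inl (hd j)) (S.co (tl j)) (S.ci (hd j)) ?_ ?_ rfl rfl ?_ ?_ (Or.inr hseg')
      · exact List.isChain_pair.mpr (fT j).2.2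
      · exact List.isChain_pair.mpr (fH j).2.2
      · intro c hc
        show missO A F' S.ci (tl j) c.1 ≤ S.η
        rw [hc]; exact hO' _ (fT j).1
      · intro c hc
        show missI A F' S.co (hd j) c.2 ≤ S.η
        rw [hc]; exact hI' _ (fH j).1
    · obtain ⟨hv, hvo⟩ := P.hq j v hqj
      obtain ⟨_, _, _, _, h5, h6, h7⟩ := P.hQ j v hqj
      simp only [hdcl, hecl, hqj] at hseg
      simp only [hstL, henL, hqj]
      refine word_chain _ _ _ (.inl (nO v)) (.inl (t j)) (S.co (nO v)) (P.b j) ?_ ?_ rfl rfl ?_ ?_ ?_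
      · refine List.isChain_cons_cons.mpr ⟨?_, List.isChain_cons_cons.mpr ⟨(fI v hv).2.2,
          List.isChain_pair.mpr (fO v hv).2.2⟩⟩
        rw [h5] at h6
        exact S.nfO v hv _ (P.hcS v hv).1 j h6
      · exact List.isChain_singleton _
      · intro c hc
        show missO A F' S.ci (nO v) c.1 ≤ S.η
        rw [hc]; exact hO' _ (fO v hv).1
      · intro c hc
        show missI A F' S.co (t j) c.2 ≤ S.η
        rw [hc]
        exact (Finset.card_le_card (Finset.filter_subset_filter _ hF'F)).trans (S.nfm j _ h7)
      · rcases hseg with ⟨h1, h2, _⟩ | h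
        · left
          refine ⟨h1, ?_⟩
          rw [← h2] at h7
          exact S.nfI v hv _ (P.hcS v hv).2 j h7
        · exact Or.inr h
  have hdF'Fix : Disjoint F' Fix := by
    rw [Finset.disjoint_left]
    intro v hv hvF
    rw [hFix, Finset.mem_disjUnion] at hvF
    rcases hvF with h | h
    · exact hSpF v h (hF'F hv)
    · exact (Finset.mem_sdiff.mp hv).2 h
  have hbrF : ∀ j, s j ∉ F' ∧ t j ∉ F' := fun j =>
    ⟨fun h => S.hFBr _ (hF'F h) ((S.hBr _).mpr ⟨j, Or.inl rfl⟩),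
     fun h => S.hFBr _ (hF'F h) ((S.hBr _).mpr ⟨j, Or.inr rfl⟩)⟩
  have hbig : ∀ v ∈ F', 3 + 4 * S.η + 2 * (Fix.card + Fintype.card (Fin k)) <
      (F'.filter (fun q => S.ci q = S.ci v ∧ S.co q = S.co v)).card := by
    intro v hv
    have h1 : (F'.filter (fun q => S.ci q = S.ci v ∧ S.co q = S.co v)).card = (F'.val.map lt).count (lt v) := by
      rw [Multiset.count_map, Finset.card_def, Finset.filter_val]
      congr 1
      refine Multiset.filter_congr fun v _ => ?_
      simp only [hlt, Prod.ext_iff]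
      exact and_congr eq_comm eq_comm
    rw [h1, Fintype.card_fin]
    have h2 := hF'c (lt v)
    rcases P.hsz (lt v) with ⟨h3, _, _⟩ | h3
    · have h4 := hF'le (lt v)
      rw [h3, ← h1] at h4
      have : v ∈ F'.filter (fun q => S.ci q = S.ci v ∧ S.co q = S.co v) := by simp [hv]
      have := Finset.card_pos.mpr ⟨v, this⟩
      omega
    · omega
  obtain ⟨I, hI1, hI2⟩ := tt_main A F' Fix S.ci S.co S.η hdF'Fix (fun v hv => hO' v (hF'F hv))
    (fun v hv => hI' v (hF'F hv)) hbig s t (fun j => (hbrF j).1) (fun j => (hbrF j).2) w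
    (by rw [Finset.sum_congr rfl (fun j _ => hwpw j)]; exact htot) hch
  -- lengths
  have hlen0 : ∀ j, j ≠ i0 → Multiset.card (pw j) = N j - 1 := by
    intro j hj
    have hc : ∀ v, Multiset.card (core v) = 3 := fun v => rfl
    have hp : ∀ v, Multiset.card (pad v) = (P.pre v).length + (P.post v).length := by
      intro v; simp [hpad]
    simp only [hpw]
    rw [hBlM, hflne j hj]
    rcases hqj : P.q j with _ | v
    · rw [← (P.hP j hj hqj).1, hspP j hqj]
      simp only [hstL, henL, hqj, Multiset.card_add, Multiset.card_map, Multiset.card_sum, hc, hp,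
        Multiset.coe_card, List.length_cons, List.length_nil, add_assoc]
      ring
    · rw [← (P.hQ j v hqj).2.1, hspQ j v hqj]
      simp only [hstL, henL, hqj, Multiset.card_add, Multiset.card_map, Finset.sum_empty, Multiset.card_zero,
        Multiset.coe_card, List.length_cons, List.length_nil]
      ring
  have hnb : ∀ x, x ∈ Fix.disjUnion F' hdF'Fix.symm ↔ x ∉ S.Br := by
    intro x
    rw [Finset.mem_disjUnion, hFix, Finset.mem_disjUnion, S.hSp, hF', Finset.mem_sdiff]
    constructor
    · rintro ((h | h) | h)
      · exact h.2
      · exact S.hFBr x (hUF h)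
      · exact S.hFBr x h.1
    · intro h
      by_cases h1 : x ∈ S.F
      · by_cases h2 : x ∈ U
        · exact Or.inl (Or.inr h2)
        · exact Or.inr ⟨h1, h2⟩
      · exact Or.inl (Or.inl ⟨h1, h⟩)
  have hnbcard : Fix.card + F'.card = ∑ j, (N j - 1) := by
    have h1 : Fix.disjUnion F' hdF'Fix.symm = S.Brᶜ := by
      ext x; rw [hnb, Finset.mem_compl]
    have h2 := congrArg Finset.card h1
    rw [Finset.card_disjUnion, Finset.card_compl] at h2
    have := Finset.card_le_univ S.Br
    omega
  have hlen : ∀ j, Multiset.card (pw j) = N j - 1 := by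
    intro j
    by_cases hj : j = i0
    · subst hj
      have h1 : Multiset.card (∑ i, pw i) = ∑ i, (N i - 1) := by
        rw [htot]; simp only [Multiset.card_add, Multiset.card_map, Finset.card_val]; exact hnbcard
      rw [Multiset.card_sum, ← Finset.add_sum_erase _ _ (Finset.mem_univ j),
        ← Finset.add_sum_erase _ _ (Finset.mem_univ j),
        Finset.sum_congr rfl (fun i hi => hlen0 i (Finset.ne_of_mem_erase hi))] at h1
      omega
    · exact hlen0 j hj
  refine ham_of_interiors A s t N S.Br (Fix.disjUnion F' hdF'Fix.symm) S.hBr hnb I hI1 hN ?_ (fun i => (hI2 i).2)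
  intro i
  rw [(hI2 i).1, ← hlen i, ← hwpw i, Multiset.coe_card]
end Asm2

set_option linter.unusedSectionVars false
section Cons
variable {V : Type} [Fintype V] {A : V → V → Prop} {k : ℕ} {s t : Fin k → V}

/-- an item is a segment with the right balance -/
lemma item_ok (S : Setup A s t) (cs ds : V → Bool) (pre post : V → List (Bool × Bool))
    (hcF : ∀ v ∈ S.F, cs v = S.ci v ∧ ds v = S.co v)
    (v : V) (hv : v ∈ S.Sp) (hc : S.In v (cs v)) (hd : S.Out v (ds v)) (x y : Bool)
    (h1 : pre v ≠ []) (h2 : post v ≠ [])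
    (h3 : IsCls id x (S.ci (S.res (.i v (cs v)))) (pre v))
    (h4 : IsCls id (S.co (S.res (.o v (ds v)))) y (post v)) :
    Seg (RT A S.F S.ci S.co S.η) x y
      (itemW (fun v => S.res (.i v (cs v))) (fun v => S.res (.o v (ds v))) pre post v) ∧
    ((itemW (fun v => S.res (.i v (cs v))) (fun v => S.res (.o v (ds v)))
      pre post v).map (tb cs ds)).sum = lb (x, y) := by
  obtain ⟨i1, i2, i3⟩ := S.ri v hv _ hc
  obtain ⟨o1, o2, o3⟩ := S.ro v hv _ hd
  set nI := S.res (.i v (cs v)) with hnI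
  set nO := S.res (.o v (ds v)) with hnO
  have key : ∀ (l : List (Bool × Bool)) (p r : Bool), l ≠ [] → IsCls id p r l →
      Seg (RT A S.F S.ci S.co S.η) p r (l.map .inr) := by
    intro l p r hl h
    have := seg_flatten A S.F S.ci S.co S.η id (fun c => [(.inr c : V ⊕ (Bool × Bool))]) l
      (fun c _ => ⟨List.isChain_singleton _, ⟨c, rfl, rfl⟩, ⟨c, rfl, rfl⟩⟩) p r h
    rw [← List.map_eq_flatMap] at this
    rcases this with ⟨_, _, h⟩ | h
    · exact absurd h hl
    · exact h
  have bal : ∀ (l : List (Bool × Bool)) (p r : Bool), IsCls id p r l →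
      ((l.map (Sum.inr : _ → V ⊕ (Bool × Bool))).map (tb cs ds)).sum = chi p - chi r := by
    intro l
    induction l with
    | nil => intro p r h; have : p = r := h; simp [this]
    | cons c l ih =>
      intro p r h
      obtain ⟨h, h'⟩ := h
      have e := ih _ _ h'
      rw [List.map_cons, List.map_cons, List.sum_cons, e, ← h]
      simp [tb, lb]
  obtain ⟨p1, ⟨u, hu, hux⟩, ⟨z, hz, hzx⟩⟩ := key _ _ _ h1 h3
  obtain ⟨q1, ⟨u', hu', hux'⟩, ⟨z', hz', hzx'⟩⟩ := key _ _ _ h2 h4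
  refine ⟨⟨?_, ⟨u, ?_, hux⟩, ⟨z', ?_, hzx'⟩⟩, ?_⟩
  · simp only [itemW]
    rw [List.isChain_append, List.isChain_append]
    refine ⟨⟨p1, ?_, ?_⟩, q1, ?_⟩
    · exact List.isChain_cons_cons.mpr ⟨i3, List.isChain_pair.mpr o3⟩
    · intro w hw w' hw'
      rw [hz] at hw
      simp only [Option.mem_def, Option.some.injEq, List.head?_cons] at hw hw'
      subst hw; subst hw'
      show missI A S.F S.co nI z.2 ≤ S.η
      rw [hzx]; exact S.hmI _ i1
    · intro w hw w' hw'
      rw [hu'] at hw'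
      rw [List.getLast?_append] at hw
      simp only [Option.mem_def, Option.some.injEq, List.getLast?_cons_cons, List.getLast?_singleton,
        Option.some_or] at hw hw'
      subst hw; subst hw'
      show missO A S.F S.ci nO u'.1 ≤ S.η
      rw [hux']; exact S.hmO _ o1
  · simp only [itemW]
    rw [List.append_assoc, List.head?_append, hu]; rfl
  · simp only [itemW]
    rw [List.getLast?_append, hz']; rfl
  · simp only [itemW]
    rw [List.map_append, List.map_append, List.sum_append, List.sum_append, bal _ _ _ h3, bal _ _ _ h4]
    simp only [List.map_cons, List.map_nil, List.sum_cons, List.sum_nil, tb, lb]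
    rw [← hnI, ← hnO, (hcF _ i1).1, (hcF _ i1).2, (hcF _ o1).1, (hcF _ o1).2, i2, o2]
    ring

/-- vertices capable of the letter `c` -/
noncomputable def Setup.K (S : Setup A s t) (c : Bool × Bool) : Finset V :=
  S.Brᶜ.filter (fun v => S.In v c.1 ∧ S.Out v c.2)
/-- vertices forced to the letter `c` -/
noncomputable def Setup.Nf (S : Setup A s t) (c : Bool × Bool) : Finset V :=
  S.Brᶜ.filter (fun v => ¬ S.In v (!c.1) ∧ ¬ S.Out v (!c.2))
/-- slot surplus -/
noncomputable def Setup.bp (S : Setup A s t) (c : Bool × Bool) (j : Fin k) : ℕ :=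
  (if S.Out (s j) c.2 then 0 else 1) + (if S.In (t j) c.1 then 0 else 1)

lemma card_or_and {α : Type*} (T : Finset α) (p q : α → Prop) [DecidablePred p] [DecidablePred q] :
    (T.filter p).card + (T.filter q).card = (T.filter (fun v => p v ∨ q v)).card +
      (T.filter (fun v => p v ∧ q v)).card := by
  rw [Finset.filter_or, Finset.filter_and, Finset.card_union_add_card_inter]

lemma Setup.KN (S : Setup A s t) (c : Bool × Bool) :
    (S.Nf (!c.1, !c.2)).card + 2 * S.ω + ∑ j, S.bp c j ≤ (S.K c).card := by
  obtain ⟨b1, b2⟩ := c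
  have hO := S.hineqO (!b2)
  have hI := S.hineqI (!b1)
  simp only [Bool.not_not] at hO hI
  have h1 := card_or_and (Finset.univ : Finset V) (fun v => ¬ S.In v b1) (fun v => ¬ S.Out v b2)
  have h2 := Finset.card_filter_add_card_filter_not (s := (Finset.univ : Finset V))
    (fun v => ¬ S.In v b1 ∨ ¬ S.Out v b2)
  rw [Finset.card_univ] at h2
  have h3 : (Finset.univ.filter (fun v => ¬ (¬ S.In v b1 ∨ ¬ S.Out v b2))).card ≤
      (S.K (b1, b2)).card + ((Finset.univ.filter (fun j => S.Out (s j) b2)).card +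
        (Finset.univ.filter (fun j => S.In (t j) b1)).card) := by
    have : Finset.univ.filter (fun v => ¬ (¬ S.In v b1 ∨ ¬ S.Out v b2)) ⊆
        S.K (b1, b2) ∪ ((Finset.univ.filter (fun j => S.Out (s j) b2)).image s ∪
          (Finset.univ.filter (fun j => S.In (t j) b1)).image t) := by
      intro v hv
      simp only [Finset.mem_filter, Finset.mem_univ, true_and, not_or, not_not] at hv
      by_cases hB : v ∈ S.Br
      · obtain ⟨j, rfl | rfl⟩ := (S.hBr v).mp hB
        · refine Finset.mem_union_right _ (Finset.mem_union_left _ ?_)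
          exact Finset.mem_image_of_mem _ (by simp [hv.2])
        · refine Finset.mem_union_right _ (Finset.mem_union_right _ ?_)
          exact Finset.mem_image_of_mem _ (by simp [hv.1])
      · refine Finset.mem_union_left _ ?_
        simp [Setup.K, hB, hv.1, hv.2]
    refine (Finset.card_le_card this).trans ((Finset.card_union_le _ _).trans ?_)
    refine Nat.add_le_add_left ((Finset.card_union_le _ _).trans ?_) _
    exact Nat.add_le_add Finset.card_image_le Finset.card_image_le
  have h4 : (S.Nf (!b1, !b2)).card ≤ (Finset.univ.filter (fun v => ¬ S.In v b1 ∧ ¬ S.Out v b2)).card := by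
    refine Finset.card_le_card fun v hv => ?_
    simp only [Setup.Nf, Bool.not_not, Finset.mem_filter] at hv
    simp [hv.2]
  have h5 : ∑ j, S.bp (b1, b2) j + ((Finset.univ.filter (fun j => S.Out (s j) b2)).card +
        (Finset.univ.filter (fun j => S.In (t j) b1)).card) = 2 * k := by
    rw [Finset.card_filter, Finset.card_filter, ← Finset.sum_add_distrib, ← Finset.sum_add_distrib]
    have : ∀ j ∈ (Finset.univ : Finset (Fin k)), S.bp (b1, b2) j + ((if S.Out (s j) b2 then 1 else 0) +
      (if S.In (t j) b1 then 1 else 0)) = 2 := by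
      intro j _
      simp only [Setup.bp]
      split_ifs <;> rfl
    rw [Finset.sum_congr rfl this]; simp [mul_comm]
  simp only [] at *
  omega

/-- intermediate value selection -/
lemma select (In Out : V → Bool → Prop) (hI : ∀ v, ∃ b, In v b) (hO : ∀ v, ∃ b, Out v b) :
    ∀ (T : Finset V) (D : ℤ),
    D + ((T.filter (fun v => ¬ In v true ∧ ¬ Out v false)).card : ℤ) ≤
      ((T.filter (fun v => In v true ∧ Out v false)).card : ℤ) →
    -D + ((T.filter (fun v => ¬ In v false ∧ ¬ Out v true)).card : ℤ) ≤
      ((T.filter (fun v => In v false ∧ Out v true)).card : ℤ) →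
    ∃ cs ds : V → Bool, (∀ v ∈ T, In v (cs v) ∧ Out v (ds v)) ∧ ∑ v ∈ T, lb (cs v, ds v) = D := by
  intro T
  induction T using Finset.induction_on with
  | empty =>
    intro D h1 h2
    simp at h1 h2
    exact ⟨fun _ => true, fun _ => true, by simp, by simp; omega⟩
  | insert v T hv ih =>
    intro D h1 h2
    have step : ∀ b d, In v b → Out v d →
        (D - lb (b, d)) + ((T.filter (fun v => ¬ In v true ∧ ¬ Out v false)).card : ℤ) ≤
      ((T.filter (fun v => In v true ∧ Out v false)).card : ℤ) →
        -(D - lb (b, d)) + ((T.filter (fun v => ¬ In v false ∧ ¬ Out v true)).card : ℤ) ≤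
      ((T.filter (fun v => In v false ∧ Out v true)).card : ℤ) →
        ∃ cs ds : V → Bool, (∀ w ∈ insert v T, In w (cs w) ∧ Out w (ds w)) ∧
          ∑ w ∈ insert v T, lb (cs w, ds w) = D := by
      intro b d hb hd g1 g2
      obtain ⟨cs, ds, e1, e2⟩ := ih _ g1 g2
      refine ⟨Function.update cs v b, Function.update ds v d, ?_, ?_⟩
      · intro w hw
        by_cases hwv : w = v
        · subst hwv; simpa using ⟨hb, hd⟩
        · simp only [Function.update_of_ne hwv]
          exact e1 w (Finset.mem_of_mem_insert_of_ne hw hwv)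
      · rw [Finset.sum_insert hv]
        have : ∑ w ∈ T, lb (Function.update cs v b w, Function.update ds v d w) = D - lb (b, d) := by
          rw [← e2]
          refine Finset.sum_congr rfl fun w hw => ?_
          have : w ≠ v := fun h => hv (h ▸ hw)
          simp only [Function.update_of_ne this]
        rw [this]; simp
    have hci : ∀ (p : V → Prop) [DecidablePred p], (insert v (T.filter p)).card = (T.filter p).card + 1 :=
      fun p _ => Finset.card_insert_of_notMem fun h => hv (Finset.mem_filter.mp h).1
    have m1 : (T.filter (fun v => ¬ In v true ∧ ¬ Out v false)).card ≤
      (T.filter (fun v => In v false ∧ Out v true)).card := by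
      refine Finset.card_le_card (Finset.monotone_filter_right _ ?_)
      intro w _ hw
      constructor
      · obtain ⟨b, hb⟩ := hI w
        cases b
        · exact hb
        · exact absurd hb hw.1
      · obtain ⟨b, hb⟩ := hO w
        cases b
        · exact absurd hb hw.2
        · exact hb
    have m2 : (T.filter (fun v => ¬ In v false ∧ ¬ Out v true)).card ≤
      (T.filter (fun v => In v true ∧ Out v false)).card := by
      refine Finset.card_le_card (Finset.monotone_filter_right _ ?_)
      intro w _ hw
      constructor
      · obtain ⟨b, hb⟩ := hI w
        cases b
        · exact absurd hb hw.1
        · exact hb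
      · obtain ⟨b, hb⟩ := hO w
        cases b
        · exact hb
        · exact absurd hb hw.2
    have lTF : lb (true, false) = 1 := rfl
    have lFT : lb (false, true) = -1 := rfl
    have lTT : lb (true, true) = 0 := rfl
    have lFF : lb (false, false) = 0 := rfl
    by_cases i1 : In v true <;> by_cases i0 : In v false <;> by_cases o1 : Out v true <;>
      by_cases o0 : Out v false <;>
      simp only [Finset.filter_insert, i1, i0, o1, o0, not_true, not_false_iff, and_true, true_and,
        and_false, false_and, if_true, if_false, hci, and_self,
        not_true_eq_false, not_false_eq_true] at h1 h2 <;> push_cast at h1 h2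
    all_goals first
      | (exfalso; obtain ⟨b, hb⟩ := hI v; cases b <;> contradiction)
      | (exfalso; obtain ⟨b, hb⟩ := hO v; cases b <;> contradiction)
      | skip
    all_goals first
      | exact step true true i1 o1 (by rw [lTT]; omega) (by rw [lTT]; omega)
      | exact step false false i0 o0 (by rw [lFF]; omega) (by rw [lFF]; omega)
      | exact step true false i1 o0 (by rw [lTF]; omega) (by rw [lTF]; omega)
      | exact step false true i0 o1 (by rw [lFT]; omega) (by rw [lFT]; omega)
      | skip
    all_goals
      by_cases hz : D + ((T.filter (fun v => ¬ In v true ∧ ¬ Out v false)).card : ℤ) ≤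
        ((T.filter (fun v => In v true ∧ Out v false)).card : ℤ) <;>
      by_cases hz' : -D + ((T.filter (fun v => ¬ In v false ∧ ¬ Out v true)).card : ℤ) ≤
        ((T.filter (fun v => In v false ∧ Out v true)).card : ℤ)
    all_goals first
      | exact step true true i1 o1 (by rw [lTT]; omega) (by rw [lTT]; omega)
      | exact step false false i0 o0 (by rw [lFF]; omega) (by rw [lFF]; omega)
      | exact step true false i1 o0 (by rw [lTF]; omega) (by rw [lTF]; omega)
      | exact step false true i0 o1 (by rw [lFT]; omega) (by rw [lFT]; omega)

/-- two disjoint transversal sets -/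
lemma two_sets {α : Type*} (K L : Finset α) (x y : ℕ) (hx : x ≤ K.card) (hy : y ≤ L.card)
    (hxy : x + y ≤ (K ∪ L).card) : ∃ P ⊆ K, ∃ Q ⊆ L, Disjoint P Q ∧ P.card = x ∧ Q.card = y := by
  by_cases h : x ≤ (K \ L).card
  · obtain ⟨P, hP, hPc⟩ := Finset.exists_subset_card_eq h
    obtain ⟨Q, hQ, hQc⟩ := Finset.exists_subset_card_eq hy
    refine ⟨P, hP.trans Finset.sdiff_subset, Q, hQ, ?_, hPc, hQc⟩
    rw [Finset.disjoint_left]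
    intro v hv hq
    exact (Finset.mem_sdiff.mp (hP hv)).2 (hQ hq)
  · push Not at h
    obtain ⟨P, hP1, hP2, hPc⟩ := Finset.exists_subsuperset_card_eq (Finset.sdiff_subset (s := K) (t := L)) h.le hx
    have h1 : y ≤ (L \ P).card := by
      have e : (K ∪ L).card ≤ P.card + (L \ P).card := by
        refine (Finset.card_le_card ?_).trans (Finset.card_union_le _ _)
        intro v hv
        simp only [Finset.mem_union, Finset.mem_sdiff] at hv ⊢
        by_cases hp : v ∈ P
        · exact Or.inl hp
        · right
          refine ⟨?_, hp⟩
          rcases hv with hv | hv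
          · by_contra hl
            exact hp (hP1 (Finset.mem_sdiff.mpr ⟨hv, hl⟩))
          · exact hv
      omega
    obtain ⟨Q, hQ, hQc⟩ := Finset.exists_subset_card_eq h1
    refine ⟨P, hP2, Q, hQ.trans Finset.sdiff_subset, ?_, hPc, hQc⟩
    rw [Finset.disjoint_left]
    intro v hv hq
    exact (Finset.mem_sdiff.mp (hQ hq)).2 hv

/-- distribute the elements of a set -/
lemma distribute {α ι : Type*} (i0 : ι) (J : Finset ι) : ∀ (T : Finset α) (τ : ι → ℕ),
    ∑ j ∈ J, τ j ≤ T.card → i0 ∉ J →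
    ∃ own : α → ι, (∀ v, own v = i0 ∨ own v ∈ J) ∧ ∀ j ∈ J, (T.filter (fun v => own v = j)).card = τ j := by
  induction J using Finset.induction_on with
  | empty => intro T τ _ _; exact ⟨fun _ => i0, by simp, by simp⟩
  | insert j J hj ih =>
    intro T τ h hi
    rw [Finset.sum_insert hj] at h
    obtain ⟨P, hP, hPc⟩ := Finset.exists_subset_card_eq (show τ j ≤ T.card by omega)
    have h1 : ∑ i ∈ J, τ i ≤ (T \ P).card := by
      rw [Finset.card_sdiff_of_subset hP]; omega
    have hi' : i0 ∉ J := fun h => hi (Finset.mem_insert_of_mem h)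
    have hij : i0 ≠ j := fun h => hi (h ▸ Finset.mem_insert_self _ _)
    obtain ⟨own, ho, hc⟩ := ih (T \ P) τ h1 hi'
    refine ⟨fun v => if v ∈ P then j else if v ∈ T then own v else i0, ?_, ?_⟩
    · intro v
      dsimp only
      split_ifs
      · right; exact Finset.mem_insert_self _ _
      · rcases ho v with h | h
        · exact Or.inl h
        · exact Or.inr (Finset.mem_insert_of_mem h)
      · left; rfl
    · intro i hiJ
      by_cases hij' : i = j
      · subst hij'
        rw [← hPc]
        congr 1
        ext v
        simp only [Finset.mem_filter]
        constructor
        · rintro ⟨hv, h⟩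
          by_contra hp
          rw [if_neg hp, if_pos hv] at h
          rcases ho v with h' | h'
          · exact hij (h'.symm.trans h)
          · exact hj (h ▸ h')
        · intro hp; exact ⟨hP hp, by rw [if_pos hp]⟩
      · have hiJ' : i ∈ J := Finset.mem_of_mem_insert_of_ne hiJ hij'
        rw [← hc i hiJ']
        congr 1
        ext v
        simp only [Finset.mem_filter, Finset.mem_sdiff]
        constructor
        · rintro ⟨hv, h⟩
          by_cases hp : v ∈ P
          · rw [if_pos hp] at h; exact absurd h.symm hij'
          · rw [if_neg hp, if_pos hv] at h; exact ⟨⟨hv, hp⟩, h⟩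
        · rintro ⟨⟨hv, hp⟩, h⟩
          exact ⟨hv, by rw [if_neg hp, if_pos hv]; exact h⟩
end Cons

set_option linter.unusedSectionVars false
section Mixed
variable {V : Type} [Fintype V] {A : V → V → Prop} {k : ℕ} {s t : Fin k → V}

lemma Setup.nb_eq (S : Setup A s t) : S.Brᶜ = S.F ∪ S.Sp := by
  ext v
  rw [Finset.mem_compl, Finset.mem_union, S.hSp]
  have := S.hFBr v
  tauto

lemma Setup.disj (S : Setup A s t) : Disjoint S.F S.Sp := by
  rw [Finset.disjoint_left]; intro v hv h; exact ((S.hSp v).mp h).1 hv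

lemma Setup.sum_nb (S : Setup A s t) (f : V → ℤ) :
    ∑ v ∈ S.F, f v + ∑ v ∈ S.Sp, f v = ∑ v ∈ S.Brᶜ, f v := by
  rw [S.nb_eq, Finset.sum_union S.disj]

lemma Setup.select_nb (S : Setup A s t) (R : Finset V) (D : ℤ)
    (h1 : D + R.card ≤ 2 * S.ω + ∑ j, (S.bp (true, false) j : ℤ))
    (h2 : -D + R.card ≤ 2 * S.ω + ∑ j, (S.bp (false, true) j : ℤ)) :
    ∃ cs ds : V → Bool, (∀ v ∈ S.Brᶜ \ R, S.In v (cs v) ∧ S.Out v (ds v)) ∧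
      ∑ v ∈ S.Brᶜ \ R, lb (cs v, ds v) = D := by
  have key : ∀ (p : V → Prop) [DecidablePred p], ((S.Brᶜ.filter p).card : ℤ) ≤
      (((S.Brᶜ \ R).filter p).card : ℤ) + R.card := by
    intro p _
    have : S.Brᶜ.filter p ⊆ (S.Brᶜ \ R).filter p ∪ R := by
      intro v hv
      simp only [Finset.mem_union, Finset.mem_filter, Finset.mem_sdiff] at hv ⊢
      tauto
    have := (Finset.card_le_card this).trans (Finset.card_union_le _ _)
    exact_mod_cast this
  have key2 : ∀ (p : V → Prop) [DecidablePred p], (((S.Brᶜ \ R).filter p).card : ℤ) ≤ ((S.Brᶜ.filter p).card : ℤ) := by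
    intro p _
    exact_mod_cast Finset.card_le_card (Finset.filter_subset_filter _ Finset.sdiff_subset)
  have k1 := S.KN (true, false)
  have k2 := S.KN (false, true)
  simp only [Setup.Nf, Setup.K, Bool.not_true, Bool.not_false] at k1 k2
  zify at k1 k2
  refine select S.In S.Out S.hIne S.hOne (S.Brᶜ \ R) D ?_ ?_
  · have := key (fun v => S.In v true ∧ S.Out v false)
    have := key2 (fun v => ¬ S.In v true ∧ ¬ S.Out v false)
    linarith
  · have := key (fun v => S.In v false ∧ S.Out v true)
    have := key2 (fun v => ¬ S.In v false ∧ ¬ S.Out v true)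
    linarith

/-- alternating letters -/
def altM (d : Bool) (r : ℕ) : Multiset (Bool × Bool) :=
  Multiset.replicate ((r + 1) / 2) (d, !d) + Multiset.replicate (r / 2) (!d, d)

lemma altM_card (d : Bool) (r : ℕ) : Multiset.card (altM d r) = r := by
  simp [altM]; omega

lemma altM_sum (d : Bool) (r : ℕ) :
    ((altM d r).map lb).sum = if r % 2 = 1 then chi d - chi (!d) else 0 := by
  simp only [altM, Multiset.map_add, Multiset.map_replicate, Multiset.sum_add, Multiset.sum_replicate, lb]
  have h : (r + 1) / 2 = r / 2 + r % 2 := by omega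
  rw [h]
  rcases Nat.mod_two_eq_zero_or_one r with h | h <;> rw [h] <;> simp <;> ring

lemma altM_count_le (d : Bool) (r : ℕ) (c : Bool × Bool) :
    (altM d r).count c ≤ if c.1 = c.2 then 0 else (r + 1) / 2 := by
  obtain ⟨x, y⟩ := c
  cases d <;> cases x <;> cases y <;> simp [altM, Multiset.count_replicate] <;> omega

lemma altM_mem (d : Bool) (r : ℕ) (c : Bool × Bool) (hc : c ∈ altM d r) : c.1 ≠ c.2 := by
  simp only [altM, Multiset.mem_add] at hc
  rcases hc with hc | hc <;> rw [Multiset.eq_of_mem_replicate hc] <;> cases d <;> simp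

lemma altM_ne (d : Bool) (r : ℕ) (hr : 1 ≤ r) : ∃ c ∈ altM d r, c.1 ≠ c.2 := by
  have : altM d r ≠ 0 := by
    intro h
    have := altM_card d r
    rw [h] at this; simp at this; omega
  obtain ⟨c, hc⟩ := Multiset.exists_mem_of_ne_zero this
  exact ⟨c, hc, altM_mem d r c hc⟩

lemma alt_balance (d e : Bool) (r : ℕ) (h : r % 2 = if d = e then 0 else 1) :
    ((altM d r).map lb).sum = chi d - chi e := by
  rw [altM_sum, h]
  cases d <;> cases e <;> simp

lemma mixed_fl (d e : Bool) (m c1 c3 : ℕ) (hm : 1 ≤ m) (h : c1 + c3 + min m 3 ≤ m) :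
    ∃ fl : Multiset (Bool × Bool), Multiset.card fl = m ∧ (fl.map lb).sum = chi d - chi e ∧
      ((∃ c ∈ fl, c.1 ≠ c.2) ∨ (fl ≠ 0 ∧ ∀ c ∈ fl, c = (d, d))) ∧
      fl.count (true, true) ≤ c1 + 1 ∧ fl.count (false, false) ≤ c3 + 1 ∧
      2 * fl.count (true, false) ≤ m + 1 - c1 - c3 ∧ 2 * fl.count (false, true) ≤ m + 1 - c1 - c3 := by
  set r := m - c1 - c3 with hr
  obtain ⟨adj, hadj, hpar⟩ : ∃ adj, adj ≤ 1 ∧ (r - adj) % 2 = if d = e then 0 else 1 := by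
    rcases Nat.mod_two_eq_zero_or_one r with h1 | h1 <;> by_cases hde : d = e
    · exact ⟨0, by omega, by rw [if_pos hde]; omega⟩
    · exact ⟨1, by omega, by rw [if_neg hde]; omega⟩
    · exact ⟨1, by omega, by rw [if_pos hde]; omega⟩
    · exact ⟨0, by omega, by rw [if_neg hde]; omega⟩
  refine ⟨Multiset.replicate c1 (true, true) + Multiset.replicate c3 (false, false) +
    Multiset.replicate adj (d, d) + altM d (r - adj), ?_, ?_, ?_, ?_, ?_, ?_, ?_⟩
  · simp only [Multiset.card_add, Multiset.card_replicate, altM_card]; omega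
  · rw [Multiset.map_add, Multiset.sum_add, alt_balance d e _ hpar]
    simp [lb]
  · by_cases h0 : r - adj = 0
    · right
      have e1 : m = 1 := by omega
      have e2 : adj = 1 := by omega
      have e3 : c1 = 0 := by omega
      have e4 : c3 = 0 := by omega
      rw [h0, e2, e3, e4]
      simp [altM]
    · left
      obtain ⟨c, hc, hc'⟩ := altM_ne d (r - adj) (by omega)
      exact ⟨c, Multiset.mem_add.mpr (Or.inr hc), hc'⟩
  all_goals
    simp only [Multiset.count_add, Multiset.count_replicate]
  · have := altM_count_le d (r - adj) (true, true)
    simp at this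
    simp [this]
    split_ifs <;> omega
  · have := altM_count_le d (r - adj) (false, false)
    simp at this
    simp [this]
    split_ifs <;> omega
  · have := altM_count_le d (r - adj) (true, false)
    simp at this
    have e2 : (d, d) ≠ (true, false) := by cases d <;> simp
    simp [e2]
    omega
  · have := altM_count_le d (r - adj) (false, true)
    simp at this
    have e2 : (d, d) ≠ (false, true) := by cases d <;> simp
    simp [e2]
    omega

/-- pads of a `B` item -/
noncomputable def preB (S : Setup A s t) (cs : V → Bool) (v : V) : List (Bool × Bool) :=
  if S.ci (S.res (.i v (cs v))) then [(true, false), (false, true)] else [(true, false)]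
/-- pads of a `B` item -/
noncomputable def postB (S : Setup A s t) (ds : V → Bool) (v : V) : List (Bool × Bool) :=
  if S.co (S.res (.o v (ds v))) then [(true, false), (false, true)] else [(false, true)]

lemma padB_count (S : Setup A s t) (cs ds : V → Bool) (v : V) (c : Bool × Bool) :
    ((preB S cs v ++ postB S ds v : List (Bool × Bool)) : Multiset (Bool × Bool)).count c ≤
      if c.1 = c.2 then 0 else 4 := by
  split_ifs with h
  · rw [Nat.le_zero, Multiset.count_eq_zero]
    intro hc
    have : c = (true, false) ∨ c = (false, true) := by
      simp only [preB, postB, Multiset.mem_coe, List.mem_append] at hc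
      rcases hc with hc | hc <;> split_ifs at hc <;> simp at hc <;> tauto
    rcases this with rfl | rfl <;> simp at h
  · refine (Multiset.count_le_card _ _).trans ?_
    simp only [preB, postB, Multiset.coe_card, List.length_append]
    split_ifs <;> simp

lemma itemB_ok (S : Setup A s t) (cs ds : V → Bool)
    (hcF : ∀ v ∈ S.F, cs v = S.ci v ∧ ds v = S.co v)
    (v : V) (hv : v ∈ S.Sp) (hc : S.In v (cs v)) (hd : S.Out v (ds v)) :
    Seg (RT A S.F S.ci S.co S.η) true true
      (itemW (fun v => S.res (.i v (cs v))) (fun v => S.res (.o v (ds v))) (preB S cs) (postB S ds) v) ∧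
    ((itemW (fun v => S.res (.i v (cs v))) (fun v => S.res (.o v (ds v)))
      (preB S cs) (postB S ds) v).map (tb cs ds)).sum = lb (true, true) := by
  refine item_ok S cs ds _ _ hcF v hv hc hd true true ?_ ?_ ?_ ?_
  · rw [preB]; split_ifs <;> simp
  · rw [postB]; split_ifs <;> simp
  · rw [preB]; split_ifs with h
    · simp [IsCls, h]
    · simp [IsCls, h]
  · rw [postB]; split_ifs with h
    · simp [IsCls, h]
    · simp [IsCls, h]

lemma Setup.hcF_of (S : Setup A s t) (cs ds : V → Bool)
    (h : ∀ v ∈ S.F, S.In v (cs v) ∧ S.Out v (ds v)) : ∀ v ∈ S.F, cs v = S.ci v ∧ ds v = S.co v :=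
  fun v hv => ⟨(S.hIF v hv _).mp (h v hv).1, (S.hOF v hv _).mp (h v hv).2⟩

lemma Setup.bp_eq (S : Setup A s t) (c : Bool × Bool) (j : Fin k) :
    (S.bp c j : ℤ) = (if S.Out (s j) c.2 then 0 else 1) + (if S.In (t j) c.1 then 0 else 1) := by
  simp [Setup.bp]

/-- a choice of slots with no unnecessary imbalance -/
lemma slot_choice (S : Setup A s t) (j : Fin k) : ∃ a b, S.Out (s j) a ∧ S.In (t j) b ∧
    chi a - chi b ≤ S.bp (true, false) j ∧ -(chi a - chi b) ≤ S.bp (false, true) j := by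
  by_cases h : ∃ c, S.Out (s j) c ∧ S.In (t j) c
  · obtain ⟨c, h1, h2⟩ := h
    exact ⟨c, c, h1, h2, by simp, by simp⟩
  · push Not at h
    obtain ⟨a, ha⟩ := S.hOne (s j)
    obtain ⟨b, hb⟩ := S.hIne (t j)
    refine ⟨a, b, ha, hb, ?_, ?_⟩ <;> rw [S.bp_eq] <;> cases a <;> cases b <;> simp [chi]
    all_goals first
      | exact absurd hb (h _ ha)
      | skip
    all_goals split_ifs <;> simp_all

lemma tuse_ar (k' U P Q g σ z : ℕ) (h1 : 2 * (k' + 1) * U ≤ k' * z + 6 * (k' + 1) * (k' + 1))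
    (h2 : k' * z ≤ k' * (2 * g + σ)) (h3 : (k' + 1) * (4 * P + 12 * Q + 20 * (k' + 1) + 20 + σ) < g) :
    (k' + 1) * (U + 4 * Q + (3 + 4 * P + 8 * Q + 8 * (k' + 1))) < (k' + 1) * g := by
  have e1 := Nat.zero_le (k' * σ)
  have e2 := Nat.zero_le (k' * P)
  have e3 := Nat.zero_le (k' * Q)
  have e4 := Nat.zero_le (k' * k')
  ring_nf at h1 h2 h3 e1 e2 e3 e4 ⊢
  linarith

lemma luse_ar (k U P Q g σ : ℕ) (h1 : k * U + g ≤ k * g + k * k)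
    (h3 : k * (4 * P + 12 * Q + 20 * k + 20 + σ) < g) :
    k * (U + 4 * Q + (3 + 4 * P + 8 * Q + 8 * k)) < k * g := by
  have e1 := Nat.zero_le (k * σ)
  have e2 := Nat.zero_le (k * P)
  have e3 := Nat.zero_le (k * Q)
  have e4 := Nat.zero_le (k * k)
  ring_nf at h1 h3 e1 e2 e3 e4 ⊢
  linarith

set_option maxHeartbeats 1000000 in
theorem mixed_plan (S : Setup A s t) (N : Fin k → ℕ) (i0 : Fin k) (hN : ∀ j, 4 ≤ N j)
    (hk : k * ∑ j ∈ Finset.univ.erase i0, (N j - 3) + Fintype.card V ≤ k * Fintype.card V)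
    (σ : ℕ) (hbig : ∀ c, k * (4 * S.η + 12 * S.Sp.card + 20 * k + 20 + σ) < S.fc c)
    (hb1 : Fintype.card V ≤ S.fc (true, true) + S.fc (false, false) + 2 * S.fc (true, false) + σ)
    (hb2 : Fintype.card V ≤ S.fc (true, true) + S.fc (false, false) + 2 * S.fc (false, true) + σ)
    (hle : S.fc (true, true) + S.fc (false, false) ≤ Fintype.card V) :
    Nonempty (Plan S N i0) := by
  choose a b ha hb hD1 hD2 using slot_choice S
  obtain ⟨cs, ds, hsel1, hsel2⟩ := S.select_nb ∅ (∑ j, (chi (a j) - chi (b j)))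
    (by
      have := Finset.sum_le_sum fun j (_ : j ∈ Finset.univ) => hD1 j
      simp only [Finset.card_empty, Nat.cast_zero, add_zero]
      linarith [Nat.cast_nonneg (α := ℤ) S.ω])
    (by
      have := Finset.sum_le_sum fun j (_ : j ∈ Finset.univ) => hD2 j
      rw [Finset.sum_neg_distrib] at this
      simp only [Finset.card_empty, Nat.cast_zero, add_zero]
      linarith [Nat.cast_nonneg (α := ℤ) S.ω])
  rw [Finset.sdiff_empty] at hsel1 hsel2
  have hF : ∀ v ∈ S.F, S.In v (cs v) ∧ S.Out v (ds v) := fun v hv => hsel1 v (by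
    rw [S.nb_eq]; exact Finset.mem_union_left _ hv)
  have hS : ∀ v ∈ S.Sp, S.In v (cs v) ∧ S.Out v (ds v) := fun v hv => hsel1 v (by
    rw [S.nb_eq]; exact Finset.mem_union_right _ hv)
  have hcF := S.hcF_of cs ds hF
  set n := Fintype.card V with hn
  set g1 := S.fc (true, true) with hg1
  set g3 := S.fc (false, false) with hg3
  have hnpos : 0 < n := by
    have := hbig (true, true); omega
  set c1 : Fin k → ℕ := fun j => (N j - 3 - 3) * g1 / n with hc1
  set c3 : Fin k → ℕ := fun j => (N j - 3 - 3) * g3 / n with hc3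
  have hc13 : ∀ j, c1 j + c3 j + min (N j - 3) 3 ≤ N j - 3 := by
    intro j
    have h1 : c1 j + c3 j ≤ N j - 3 - 3 := by
      have h1 : c1 j * n ≤ (N j - 3 - 3) * g1 := Nat.div_mul_le_self _ _
      have h2 : c3 j * n ≤ (N j - 3 - 3) * g3 := Nat.div_mul_le_self _ _
      have h3 : (c1 j + c3 j) * n ≤ (N j - 3 - 3) * n := by
        calc (c1 j + c3 j) * n ≤ (N j - 3 - 3) * (g1 + g3) := by linarith [add_mul (c1 j) (c3 j) n, mul_add (N j - 3 - 3) g1 g3]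
          _ ≤ _ := Nat.mul_le_mul_left _ hle
      exact Nat.le_of_mul_le_mul_right h3 hnpos
    omega
  have hfl := fun j => mixed_fl (S.co (S.res (.t j (a j)))) (S.ci (S.res (.h j (b j)))) (N j - 3) (c1 j) (c3 j)
    (by have := hN j; omega) (hc13 j)
  choose fl f1 f2 f3 f4 f5 f6 f7 using hfl
  have hpads : ∀ c, ∑ v ∈ S.Sp, ((preB S cs v ++ postB S ds v : List (Bool × Bool)) :
      Multiset (Bool × Bool)).count c ≤ 4 * S.Sp.card := by
    intro c
    have : ∀ v ∈ S.Sp, ((preB S cs v ++ postB S ds v : List (Bool × Bool)) :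
      Multiset (Bool × Bool)).count c ≤ 4 := fun v _ =>
        (padB_count S cs ds v c).trans (by split_ifs <;> omega)
    have := Finset.sum_le_card_nsmul _ _ _ this
    simpa [mul_comm] using this
  set J := Finset.univ.erase i0 with hJ
  have hJk : J.card ≤ k := by
    have := Finset.card_le_univ J
    simpa using this
  have hkpos : 0 < k := Fin.pos i0
  set Mt := ∑ j ∈ J, (N j - 3) with hMt
  -- loop usage
  have loopuse : ∀ (g : ℕ) (x : Fin k → ℕ), (∀ j, x j ≤ (N j - 3 - 3) * g / n + 1) →
      k * (4 * S.η + 12 * S.Sp.card + 20 * k + 20 + σ) < g →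
      ∑ j ∈ J, x j + 4 * S.Sp.card + (3 + 4 * S.η + 8 * S.Sp.card + 8 * k) < g := by
    intro g x hx hg
    have h1 : ∀ j, n * x j ≤ (N j - 3) * g + n := by
      intro j
      have e1 : n * ((N j - 3 - 3) * g / n) ≤ (N j - 3 - 3) * g := Nat.mul_div_le _ _
      have e2 : (N j - 3 - 3) * g ≤ (N j - 3) * g := Nat.mul_le_mul_right _ (by omega)
      have e3 := Nat.mul_le_mul_left n (hx j)
      rw [mul_add, mul_one] at e3
      omega
    have h2 : n * ∑ j ∈ J, x j ≤ Mt * g + k * n := by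
      rw [Finset.mul_sum]
      refine (Finset.sum_le_sum fun j _ => h1 j).trans ?_
      rw [Finset.sum_add_distrib, ← Finset.sum_mul, Finset.sum_const, smul_eq_mul]
      exact Nat.add_le_add_left (Nat.mul_le_mul_right _ hJk) _
    have h3 : k * Mt * g + n * g ≤ k * n * g := by
      rw [← add_mul]; exact Nat.mul_le_mul_right _ hk
    have h4 : n * (k * ∑ j ∈ J, x j + g) ≤ n * (k * g + k * k) := by
      have := Nat.mul_le_mul_left k h2
      nlinarith
    have h5 := Nat.le_of_mul_le_mul_left h4 hnpos
    have h6 : k * (∑ j ∈ J, x j + 4 * S.Sp.card + (3 + 4 * S.η + 8 * S.Sp.card + 8 * k)) < k * g := luse_ar _ _ _ _ _ _ h5 hg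
    exact Nat.lt_of_mul_lt_mul_left h6
  have tuse : ∀ (g : ℕ) (x : Fin k → ℕ), (∀ j, 2 * x j ≤ N j - 3 + 1 - c1 j - c3 j) →
      k * (4 * S.η + 12 * S.Sp.card + 20 * k + 20 + σ) < g → n ≤ g1 + g3 + 2 * g + σ →
      ∑ j ∈ J, x j + 4 * S.Sp.card + (3 + 4 * S.η + 8 * S.Sp.card + 8 * k) < g := by
    intro g x hx hg hng
    obtain ⟨z, hz⟩ : ∃ z, n = g1 + g3 + z := ⟨n - (g1 + g3), by omega⟩
    have hzg : z ≤ 2 * g + σ := by omega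
    have h1 : ∀ j, n * (2 * x j) ≤ (N j - 3) * z + 6 * n := by
      intro j
      have e1 : (N j - 3 - 3) * g1 < n * (c1 j + 1) := by
        have := Nat.lt_div_mul_add (a := (N j - 3 - 3) * g1) hnpos
        rw [mul_add, mul_one, mul_comm n]; exact this
      have e2 : (N j - 3 - 3) * g3 < n * (c3 j + 1) := by
        have := Nat.lt_div_mul_add (a := (N j - 3 - 3) * g3) hnpos
        rw [mul_add, mul_one, mul_comm n]; exact this
      have e3 : 2 * x j + c1 j + c3 j ≤ N j - 3 + 1 := by
        have := hx j; have := hc13 j; omega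
      have e4 := Nat.mul_le_mul_left n e3
      have e5 : N j - 3 ≤ (N j - 3 - 3) + 3 := by omega
      have e6 := Nat.mul_le_mul_right (g1 + g3) e5
      have e7 : 3 * (g1 + g3) ≤ 3 * n := by omega
      have e8 : n * (N j - 3) = (N j - 3) * (g1 + g3) + (N j - 3) * z := by
        rw [hz]; ring
      nlinarith
    have h2 : n * (2 * ∑ j ∈ J, x j) ≤ Mt * z + k * (6 * n) := by
      rw [Finset.mul_sum, Finset.mul_sum]
      refine (Finset.sum_le_sum fun j _ => h1 j).trans ?_
      rw [Finset.sum_add_distrib, ← Finset.sum_mul, Finset.sum_const, smul_eq_mul]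
      exact Nat.add_le_add_left (Nat.mul_le_mul_right _ hJk) _
    have h3 : k * Mt * z + n * z ≤ k * n * z := by
      rw [← add_mul]; exact Nat.mul_le_mul_right _ hk
    have h4 : n * (2 * k * ∑ j ∈ J, x j + z) ≤ n * (k * z + 6 * k * k) := by
      have := Nat.mul_le_mul_left k h2
      nlinarith
    have h5 := Nat.le_of_mul_le_mul_left h4 hnpos
    -- 2 k·use ≤ (k-1) z + 6 k²
    obtain ⟨k', rfl⟩ : ∃ k', k = k' + 1 := ⟨k - 1, by omega⟩
    have h5' : 2 * (k' + 1) * ∑ j ∈ J, x j ≤ k' * z + 6 * (k' + 1) * (k' + 1) := by nlinarith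
    have h5'' := Nat.mul_le_mul_left k' hzg
    have h6 : (k' + 1) * (∑ j ∈ J, x j + 4 * S.Sp.card + (3 + 4 * S.η + 8 * S.Sp.card + 8 * (k' + 1))) < (k' + 1) * g := tuse_ar _ _ _ _ _ _ _ h5' h5'' hg
    exact Nat.lt_of_mul_lt_mul_left h6
  refine ⟨{ a := a, b := b, cs := cs, ds := ds, pre := preB S cs, post := postB S ds
            icls := fun _ => (true, true), q := fun _ => none, own := fun _ => i0, fl := fl
            ha := ha, hb := hb, hcF := hcF, hcS := hS
            hit := fun v hv => (itemB_ok S cs ds hcF v hv (hS v hv).1 (hS v hv).2).1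
            hitb := fun v hv => (itemB_ok S cs ds hcF v hv (hS v hv).1 (hS v hv).2).2
            hq0 := rfl
            hq := fun j v h => by cases h
            hsel := by rw [S.sum_nb (fun v => lb (cs v, ds v))]; exact hsel2
            hP := ?_
            hQ := fun j v h => by cases h
            hsz := ?_
            hmain := Or.inr ⟨(true, false), by simp, by have := hbig (true, false); omega⟩ }⟩
  · intro j hj _
    have he : S.Sp.filter (fun v => i0 = j) = ∅ := by
      rw [Finset.filter_eq_empty_iff]; intro v _ h; exact hj h.symm
    rw [he, f1 j, f2 j]
    refine ⟨?_, by simp, ?_⟩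
    · have := hN j
      simp; omega
    · rcases f3 j with h | ⟨h, h'⟩
      · exact Or.inr (Or.inl h)
      · exact Or.inr (Or.inr ⟨h, fun v _ h => absurd h.symm hj, h'⟩)
  · intro c
    right
    have hp := hpads c
    suffices h : ∑ j ∈ J, (fl j).count c + 4 * S.Sp.card + (3 + 4 * S.η + 8 * S.Sp.card + 8 * k) < S.fc c by
      have : ∑ j ∈ J, (fl j).count c + ∑ v ∈ S.Sp, ((preB S cs v ++ postB S ds v : List (Bool × Bool)) :
        Multiset (Bool × Bool)).count c + (3 + 4 * S.η + 8 * S.Sp.card + 8 * k) < S.fc c := by omega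
      exact this
    obtain ⟨x, y⟩ := c
    cases x <;> cases y
    · exact loopuse _ _ f5 (hbig _)
    · exact tuse _ _ f7 (hbig _) hb2
    · exact tuse _ _ f6 (hbig _) hb1
    · exact loopuse _ _ f4 (hbig _)
end Mixed

set_option linter.unusedSectionVars false
section Two
variable {V : Type} [Fintype V] {A : V → V → Prop} {k : ℕ} {s t : Fin k → V}

lemma bnot_flip {x y : Bool} (h : y = !x) : x = !y := by subst h; simp

lemma signs {ι : Type*} (E : Finset ι) : ∃ e : ι → Bool,
    0 ≤ ∑ j ∈ E, (chi (e j) - chi (!(e j))) ∧ ∑ j ∈ E, (chi (e j) - chi (!(e j))) ≤ 1 := by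
  induction E using Finset.induction_on with
  | empty => exact ⟨fun _ => true, by simp⟩
  | insert j E hj ih =>
    obtain ⟨e, h1, h2⟩ := ih
    refine ⟨Function.update e j (decide (∑ j ∈ E, (chi (e j) - chi (!(e j))) = 0)), ?_⟩
    have : ∑ i ∈ E, (chi (Function.update e j (decide (∑ j ∈ E, (chi (e j) - chi (!(e j))) = 0)) i) -
        chi (!(Function.update e j (decide (∑ j ∈ E, (chi (e j) - chi (!(e j))) = 0)) i))) =
        ∑ i ∈ E, (chi (e i) - chi (!(e i))) := by
      refine Finset.sum_congr rfl fun i hi => ?_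
      have : i ≠ j := fun h => hj (h ▸ hi)
      rw [Function.update_of_ne this]
    rw [Finset.sum_insert hj, this, Function.update_self]
    by_cases h : ∑ j ∈ E, (chi (e j) - chi (!(e j))) = 0
    · rw [h]; simp [chi]
    · have : ∑ j ∈ E, (chi (e j) - chi (!(e j))) = 1 := by omega
      rw [this]; simp [chi]

/-- choice for the main path -/
lemma slot_main (S : Setup A s t) (j : Fin k) (σ : ℤ) (h0 : 0 ≤ σ) (h1 : σ ≤ 1) :
    ∃ a b, S.Out (s j) a ∧ S.In (t j) b ∧
    chi a - chi b + σ ≤ S.bp (true, false) j ∧ -(chi a - chi b) - σ ≤ S.bp (false, true) j := by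
  have h : σ = 0 ∨ σ = 1 := by omega
  rcases h with rfl | rfl
  · simpa using slot_choice S j
  · obtain ⟨a', ha'⟩ := S.hOne (s j)
    obtain ⟨b', hb'⟩ := S.hIne (t j)
    rw [S.bp_eq, S.bp_eq]
    by_cases ha : S.Out (s j) false <;> by_cases hb : S.In (t j) true
    · exact ⟨false, true, ha, hb, by simp [chi, ha, hb], by simp [chi]; split_ifs <;> simp⟩
    · have hb2 : S.In (t j) false := by cases b' <;> simp_all
      exact ⟨false, false, ha, hb2, by simp [chi, ha, hb], by simp [chi]; split_ifs <;> simp⟩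
    · have ha2 : S.Out (s j) true := by cases a' <;> simp_all
      exact ⟨true, true, ha2, hb, by simp [chi, ha, hb], by simp [chi]; split_ifs <;> simp⟩
    · have hb2 : S.In (t j) false := by cases b' <;> simp_all
      have ha2 : S.Out (s j) true := by cases a' <;> simp_all
      exact ⟨true, false, ha2, hb2, by simp [chi, ha, hb], by simp [chi]; split_ifs <;> simp⟩

/-- non-main, not fully flexible -/
lemma slot_half (S : Setup A s t) (j : Fin k) (p : Prop)
    (h : ∃ a b, S.Out (s j) a ∧ S.In (t j) b ∧ (a = b ↔ p))
    (hE : ¬ (¬ p ∧ (∀ c, S.Out (s j) c) ∧ ∀ c, S.In (t j) c)) :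
    ∃ a b, S.Out (s j) a ∧ S.In (t j) b ∧ (a = b ↔ p) ∧
    chi a - chi b ≤ S.bp (true, false) j ∧ -(chi a - chi b) ≤ S.bp (false, true) j := by
  obtain ⟨a, b, ha, hb, hab⟩ := h
  refine ⟨a, b, ha, hb, hab, ?_⟩
  rw [S.bp_eq, S.bp_eq]
  simp only [Bool.forall_bool] at hE
  cases a <;> cases b <;> simp [chi] <;> simp at hab <;> simp [hab] at hE
  all_goals split_ifs <;> simp_all

lemma slot_O (S : Setup A s t) (j : Fin k) (p : Prop)
    (h : ¬ ∃ a b, S.Out (s j) a ∧ S.In (t j) b ∧ (a = b ↔ p)) :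
    ∃ a b, S.Out (s j) a ∧ S.In (t j) b ∧ (a = b ↔ ¬ p) ∧ ¬ S.Out (s j) (!a) ∧ ¬ S.In (t j) (!b) ∧
    chi a - chi b + 1 ≤ S.bp (true, false) j ∧ -(chi a - chi b) + 1 ≤ S.bp (false, true) j := by
  push Not at h
  obtain ⟨a, ha⟩ := S.hOne (s j)
  obtain ⟨b, hb⟩ := S.hIne (t j)
  have h1 : ¬ S.Out (s j) (!a) := by
    intro h1
    have e1 := h a b ha hb
    have e2 := h (!a) b h1 hb
    cases a <;> cases b <;> simp_all
  have h2 : ¬ S.In (t j) (!b) := by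
    intro h1
    have e1 := h a b ha hb
    have e2 := h a (!b) ha h1
    cases a <;> cases b <;> simp_all
  refine ⟨a, b, ha, hb, ?_, h1, h2, ?_⟩
  · have := h a b ha hb; tauto
  · rw [S.bp_eq, S.bp_eq]
    cases a <;> cases b <;> simp_all [chi]

lemma slots_II (S : Setup A s t) (N : Fin k → ℕ) (i0 : Fin k) :
    ∃ (O : Finset (Fin k)) (a b : Fin k → Bool), i0 ∉ O ∧ (∀ j, S.Out (s j) (a j)) ∧ (∀ j, S.In (t j) (b j)) ∧
      (∀ j, j ≠ i0 → j ∉ O → (a j = b j ↔ N j % 2 = 1)) ∧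
      (∀ j ∈ O, (a j = b j ↔ ¬ N j % 2 = 1) ∧ ¬ S.Out (s j) (!(a j)) ∧ ¬ S.In (t j) (!(b j))) ∧
      (∑ j, (chi (a j) - chi (b j)) + O.card ≤ ∑ j, (S.bp (true, false) j : ℤ)) ∧
      (-∑ j, (chi (a j) - chi (b j)) + O.card ≤ ∑ j, (S.bp (false, true) j : ℤ)) := by
  set O : Finset (Fin k) := Finset.univ.filter (fun j => j ≠ i0 ∧
    ¬ ∃ a b, S.Out (s j) a ∧ S.In (t j) b ∧ (a = b ↔ N j % 2 = 1)) with hO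
  set E : Finset (Fin k) := Finset.univ.filter (fun j => j ≠ i0 ∧ (¬ N j % 2 = 1 ∧ (∀ c, S.Out (s j) c) ∧ ∀ c, S.In (t j) c)) with hE
  obtain ⟨e, e1, e2⟩ := signs E
  set σ := ∑ j ∈ E, (chi (e j) - chi (!(e j))) with hσ
  obtain ⟨am, bm, hm⟩ := slot_main S i0 σ e1 e2
  have key : ∀ j, ∃ a b, S.Out (s j) a ∧ S.In (t j) b ∧ (j = i0 → a = am ∧ b = bm) ∧
      (j ∈ E → a = e j ∧ b = !(e j)) ∧ (j ≠ i0 → j ∉ O → (a = b ↔ N j % 2 = 1)) ∧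
      (j ∈ O → (a = b ↔ ¬ N j % 2 = 1) ∧ ¬ S.Out (s j) (!a) ∧ ¬ S.In (t j) (!b)) ∧
      (j ∉ E → chi a - chi b + (if j ∈ O then 1 else 0) + (if j = i0 then σ else 0) ≤ S.bp (true, false) j) ∧
      (j ∉ E → -(chi a - chi b) + (if j ∈ O then 1 else 0) - (if j = i0 then σ else 0) ≤ S.bp (false, true) j) := by
    intro j
    by_cases h0 : j = i0
    · have hjO : j ∉ O := by rw [hO, Finset.mem_filter]; tauto
      have hjE : j ∉ E := by rw [hE, Finset.mem_filter]; tauto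
      subst h0
      refine ⟨am, bm, hm.1, hm.2.1, fun _ => ⟨rfl, rfl⟩, fun h => absurd h hjE, fun h => absurd rfl h,
        fun h => absurd h hjO, fun _ => ?_, fun _ => ?_⟩
      · rw [if_neg hjO, if_pos rfl]; have := hm.2.2.1; omega
      · rw [if_neg hjO, if_pos rfl]; have := hm.2.2.2; omega
    by_cases h1 : j ∈ E
    · rw [hE, Finset.mem_filter] at h1
      have hjO : j ∉ O := by
        rw [hO, Finset.mem_filter]
        rintro ⟨_, _, h⟩
        exact h ⟨true, false, h1.2.2.2.1 _, h1.2.2.2.2 _, by simp [h1.2.2.1]⟩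
      refine ⟨e j, !(e j), h1.2.2.2.1 _, h1.2.2.2.2 _, fun h => absurd h h0, fun _ => ⟨rfl, rfl⟩, fun _ _ => ?_,
        fun h => absurd h hjO, fun h => absurd (by rw [hE, Finset.mem_filter]; exact h1) h,
        fun h => absurd (by rw [hE, Finset.mem_filter]; exact h1) h⟩
      simp [h1.2.2.1]
    by_cases h2 : j ∈ O
    · have h3 := h2
      rw [hO, Finset.mem_filter] at h3
      obtain ⟨a, b, ha, hb, hab, hna, hnb, x1, x2⟩ := slot_O S j _ h3.2.2
      refine ⟨a, b, ha, hb, fun h => absurd h h0, fun h => absurd h h1, fun _ h => absurd h2 h,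
        fun _ => ⟨hab, hna, hnb⟩, fun _ => ?_, fun _ => ?_⟩
      · rw [if_pos h2, if_neg h0]; omega
      · rw [if_pos h2, if_neg h0]; omega
    · have h3 := h2
      have h4 := h1
      rw [hO, Finset.mem_filter] at h3
      rw [hE, Finset.mem_filter] at h4
      obtain ⟨a, b, ha, hb, hab, x1, x2⟩ := slot_half S j (N j % 2 = 1) (by by_contra h; exact h3 ⟨Finset.mem_univ _, h0, h⟩)
        (fun h => h4 ⟨Finset.mem_univ _, h0, h⟩)
      refine ⟨a, b, ha, hb, fun h => absurd h h0, fun h => absurd h h1, fun _ _ => hab, fun h => absurd h h2,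
        fun _ => ?_, fun _ => ?_⟩
      · rw [if_neg h2, if_neg h0]; omega
      · rw [if_neg h2, if_neg h0]; omega
  choose a b ha hb hi hEE hpar hOO hB1 hB2 using key
  have hEO : ∀ j ∈ E, j ∉ O := by
    intro j h1
    rw [hE, Finset.mem_filter] at h1
    rw [hO, Finset.mem_filter]
    rintro ⟨_, _, h⟩
    exact h ⟨true, false, h1.2.2.2.1 _, h1.2.2.2.2 _, by simp [h1.2.2.1]⟩
  have hi0E : i0 ∉ E := by rw [hE, Finset.mem_filter]; tauto
  have hi0O : i0 ∉ O := by rw [hO, Finset.mem_filter]; tauto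
  have hcard : (O.card : ℤ) = ∑ j ∈ Eᶜ, (if j ∈ O then 1 else 0) := by
    rw [Finset.sum_boole]
    congr 2
    ext j
    simp only [Finset.mem_filter, Finset.mem_compl]
    have := hEO j
    tauto
  have hsi : σ = ∑ j ∈ Eᶜ, (if j = i0 then σ else 0) := by
    rw [Finset.sum_ite_eq', if_pos (Finset.mem_compl.mpr hi0E)]
  have hsE : ∑ j ∈ E, (chi (a j) - chi (b j)) = σ := by
    refine Finset.sum_congr rfl fun j hj => ?_
    rw [(hEE j hj).1, (hEE j hj).2]
  have hsplit : ∀ f : Fin k → ℤ, ∑ j, f j = ∑ j ∈ E, f j + ∑ j ∈ Eᶜ, f j := fun f =>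
    (Finset.sum_add_sum_compl E f).symm
  refine ⟨O, a, b, hi0O, ha, hb, hpar, hOO, ?_, ?_⟩
  · rw [hsplit, hsplit (fun j => (S.bp (true, false) j : ℤ)), hsE]
    have h1 : 0 ≤ ∑ j ∈ E, (S.bp (true, false) j : ℤ) := Finset.sum_nonneg fun j _ => by positivity
    have h2 := Finset.sum_le_sum fun j (hj : j ∈ Eᶜ) => hB1 j (Finset.mem_compl.mp hj)
    rw [Finset.sum_add_distrib, Finset.sum_add_distrib, ← hcard, ← hsi] at h2
    linarith
  · rw [hsplit, hsplit (fun j => (S.bp (false, true) j : ℤ)), hsE]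
    have h1 : 0 ≤ ∑ j ∈ E, (S.bp (false, true) j : ℤ) := Finset.sum_nonneg fun j _ => by positivity
    have h2 := Finset.sum_le_sum fun j (hj : j ∈ Eᶜ) => hB2 j (Finset.mem_compl.mp hj)
    rw [Finset.sum_sub_distrib, Finset.sum_add_distrib, ← hcard, ← hsi, Finset.sum_neg_distrib] at h2
    linarith

set_option maxHeartbeats 1000000 in
theorem two_plan (S : Setup A s t) (N : Fin k → ℕ) (i0 : Fin k) (hN : ∀ j, 4 ≤ N j)
    (hF : ∀ v ∈ S.F, S.ci v ≠ S.co v)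
    (hbig : ∀ c : Bool × Bool, c.1 ≠ c.2 → ∑ j ∈ Finset.univ.erase i0, (N j - 3) + 24 * S.Sp.card + 8 * S.η + 17 * k + 6 < 2 * S.fc c) :
    Nonempty (Plan S N i0) := by
  obtain ⟨O, a, b, hi0O, ha, hb, hpar, hOO, hD1, hD2⟩ := slots_II S N i0
  have hcoF : ∀ v ∈ S.F, S.co v = !(S.ci v) := by
    intro v hv; have := hF v hv
    cases h1 : S.ci v <;> cases h2 : S.co v <;> simp_all
  have hKS : ∀ c, S.K (c, c) ⊆ S.Sp := by
    intro c v hv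
    rw [Setup.K, Finset.mem_filter, S.nb_eq, Finset.mem_union] at hv
    rcases hv.1 with h | h
    · exact absurd (((S.hIF v h _).mp hv.2.1).symm.trans ((S.hOF v h _).mp hv.2.2)) (hF v h)
    · exact h
  have k3 := S.KN (false, false)
  have k1 := S.KN (true, true)
  have hbpO : ∀ j ∈ O, S.bp (false, false) j + S.bp (true, true) j = 2 ∧ (a j = true → 1 ≤ S.bp (false, false) j) ∧
      (a j = false → 1 ≤ S.bp (true, true) j) := by
    intro j hj
    obtain ⟨_, x1, x2⟩ := hOO j hj
    have y1 := ha j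
    have y2 := hb j
    simp only [Setup.bp]
    cases h1 : a j <;> cases h2 : b j <;> rw [h1] at x1 y1 <;> rw [h2] at x2 y2 <;> simp_all
  set OX := O.filter (fun j => a j = true) with hOX
  set OY := O.filter (fun j => a j = false) with hOY
  have hOXY : OX.card + OY.card = O.card := by
    rw [← Finset.card_filter_add_card_filter_not (s := O) (fun j => a j = true), hOX, hOY]
    congr 2
    ext j; simp
  have hx : OX.card ≤ (S.K (false, false)).card := by
    refine le_trans ?_ (le_trans (Nat.le_add_left _ _) k3)
    calc OX.card = ∑ j ∈ OX, 1 := by simp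
      _ ≤ ∑ j ∈ OX, S.bp (false, false) j := Finset.sum_le_sum fun j hj => by
          rw [hOX, Finset.mem_filter] at hj; exact (hbpO j hj.1).2.1 hj.2
      _ ≤ _ := Finset.sum_le_sum_of_subset (Finset.subset_univ _)
  have hy : OY.card ≤ (S.K (true, true)).card := by
    refine le_trans ?_ (le_trans (Nat.le_add_left _ _) k1)
    calc OY.card = ∑ j ∈ OY, 1 := by simp
      _ ≤ ∑ j ∈ OY, S.bp (true, true) j := Finset.sum_le_sum fun j hj => by
          rw [hOY, Finset.mem_filter] at hj; exact (hbpO j hj.1).2.2 hj.2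
      _ ≤ _ := Finset.sum_le_sum_of_subset (Finset.subset_univ _)
  have hxy : OX.card + OY.card ≤ (S.K (false, false) ∪ S.K (true, true)).card := by
    have h1 : O.card * 2 ≤ ∑ j, S.bp (false, false) j + ∑ j, S.bp (true, true) j := by
      rw [← Finset.sum_add_distrib]
      calc O.card * 2 = ∑ j ∈ O, 2 := by simp
        _ ≤ ∑ j ∈ O, (S.bp (false, false) j + S.bp (true, true) j) := Finset.sum_le_sum fun j hj => (hbpO j hj).1.ge
        _ ≤ _ := Finset.sum_le_sum_of_subset (Finset.subset_univ _)
    have h2 := Finset.card_le_card (Finset.subset_union_left (s₁ := S.K (false, false)) (s₂ := S.K (true, true)))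
    have h3 := Finset.card_le_card (Finset.subset_union_right (s₁ := S.K (false, false)) (s₂ := S.K (true, true)))
    omega
  obtain ⟨P, hP, Q, hQ, hPQ, hPc, hQc⟩ := two_sets _ _ _ _ hx hy hxy
  have hRc : ((P ∪ Q).card : ℤ) = O.card := by
    rw [Finset.card_union_of_disjoint hPQ, hPc, hQc, hOXY]
  obtain ⟨cs', ds', hsel1, hsel2⟩ := S.select_nb (P ∪ Q) (∑ j, (chi (a j) - chi (b j)))
    (by rw [hRc]; linarith [Nat.cast_nonneg (α := ℤ) S.ω])
    (by rw [hRc]; linarith [Nat.cast_nonneg (α := ℤ) S.ω])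
  set cs : V → Bool := fun v => if v ∈ P then false else if v ∈ Q then true else cs' v with hcs
  set ds : V → Bool := fun v => if v ∈ P then false else if v ∈ Q then true else ds' v with hds
  have hPS := hP.trans (hKS false)
  have hQS := hQ.trans (hKS true)
  have hRB : P ∪ Q ⊆ S.Brᶜ := by
    rw [S.nb_eq]; exact (Finset.union_subset hPS hQS).trans Finset.subset_union_right
  have hall : ∀ v ∈ S.Brᶜ, S.In v (cs v) ∧ S.Out v (ds v) := by
    intro v hv
    by_cases h1 : v ∈ P
    · have := (Finset.mem_filter.mp (hP h1)).2
      simp only [hcs, hds, if_pos h1]; exact this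
    by_cases h2 : v ∈ Q
    · have := (Finset.mem_filter.mp (hQ h2)).2
      simp only [hcs, hds, if_neg h1, if_pos h2]; exact this
    simp only [hcs, hds, if_neg h1, if_neg h2]
    exact hsel1 v (by simp only [Finset.mem_sdiff, Finset.mem_union]; tauto)
  have hsum : ∑ v ∈ S.Brᶜ, lb (cs v, ds v) = ∑ j, (chi (a j) - chi (b j)) := by
    rw [← Finset.sum_sdiff hRB, ← hsel2]
    have : ∑ v ∈ P ∪ Q, lb (cs v, ds v) = 0 := Finset.sum_eq_zero fun v hv => by
      rw [Finset.mem_union] at hv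
      simp only [lb, hcs, hds]
      by_cases h : v ∈ P
      · simp [h]
      · have := hv.resolve_left h
        simp [h, this]
    rw [this, add_zero]
    refine Finset.sum_congr rfl fun v hv => ?_
    simp only [Finset.mem_sdiff, Finset.mem_union, not_or] at hv
    simp only [hcs, hds, if_neg hv.2.1, if_neg hv.2.2]
  have hFF : ∀ v ∈ S.F, S.In v (cs v) ∧ S.Out v (ds v) := fun v hv => hall v (by
    rw [S.nb_eq]; exact Finset.mem_union_left _ hv)
  have hS : ∀ v ∈ S.Sp, S.In v (cs v) ∧ S.Out v (ds v) := fun v hv => hall v (by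
    rw [S.nb_eq]; exact Finset.mem_union_right _ hv)
  have hcF := S.hcF_of cs ds hFF
  -- owners
  obtain ⟨own1, o1, o1'⟩ := distribute i0 OX P (fun _ => 1) (by simp [hPc]) (fun h => hi0O (Finset.mem_filter.mp h).1)
  obtain ⟨own2, o2, o2'⟩ := distribute i0 OY Q (fun _ => 1) (by simp [hQc]) (fun h => hi0O (Finset.mem_filter.mp h).1)
  set own : V → Fin k := fun v => if v ∈ P then own1 v else if v ∈ Q then own2 v else i0 with hown
  have hownO : ∀ v, own v = i0 ∨ own v ∈ O := by
    intro v
    simp only [hown]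
    split_ifs
    · exact (o1 v).imp id fun h => (Finset.mem_filter.mp h).1
    · exact (o2 v).imp id fun h => (Finset.mem_filter.mp h).1
    · exact Or.inl rfl
  have hex : ∀ j ∈ O, ∃ v ∈ S.Sp, own v = j ∧ cs v = !(a j) ∧ ds v = !(a j) ∧ ∀ w ∈ S.Sp, own w = j → w = v := by
    intro j hj
    have hji : i0 ≠ j := fun h => hi0O (h ▸ hj)
    cases haj : a j
    · have hjO : j ∈ OY := Finset.mem_filter.mpr ⟨hj, haj⟩
      have hjX : j ∉ OX := fun h => by have := (Finset.mem_filter.mp h).2; rw [haj] at this; simp at this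
      obtain ⟨v, hv⟩ := Finset.card_eq_one.mp (o2' j hjO)
      have hv1 : v ∈ Q ∧ own2 v = j := by
        have := (Finset.ext_iff.mp hv v).mpr (by simp)
        simpa using this
      have hvP : v ∉ P := fun h => Finset.disjoint_left.mp hPQ h hv1.1
      refine ⟨v, hQS hv1.1, by simp only [hown, if_neg hvP, if_pos hv1.1]; exact hv1.2,
        by simp only [hcs, if_neg hvP, if_pos hv1.1]; rfl, by simp only [hds, if_neg hvP, if_pos hv1.1]; rfl, ?_⟩
      intro w _ hw
      simp only [hown] at hw
      split_ifs at hw with h1 h2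
      · rcases o1 w with h | h
        · exact absurd (h.symm.trans hw) hji
        · exact absurd (hw ▸ h) hjX
      · have := (Finset.ext_iff.mp hv w).mp (by simpa using (show _ ∧ _ from ⟨h2, hw⟩))
        simpa using this
      · exact absurd hw hji
    · have hjO : j ∈ OX := Finset.mem_filter.mpr ⟨hj, haj⟩
      have hjX : j ∉ OY := fun h => by have := (Finset.mem_filter.mp h).2; rw [haj] at this; simp at this
      obtain ⟨v, hv⟩ := Finset.card_eq_one.mp (o1' j hjO)
      have hv1 : v ∈ P ∧ own1 v = j := by
        have := (Finset.ext_iff.mp hv v).mpr (by simp)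
        simpa using this
      refine ⟨v, hPS hv1.1, by simp only [hown, if_pos hv1.1]; exact hv1.2,
        by simp only [hcs, if_pos hv1.1]; rfl, by simp only [hds, if_pos hv1.1]; rfl, ?_⟩
      intro w _ hw
      simp only [hown] at hw
      split_ifs at hw with h1 h2
      · have := (Finset.ext_iff.mp hv w).mp (by simpa using (show _ ∧ _ from ⟨h1, hw⟩))
        simpa using this
      · rcases o2 w with h | h
        · exact absurd (h.symm.trans hw) hji
        · exact absurd (hw ▸ h) hjX
      · exact absurd hw hji
  haveI : Nonempty V := ⟨s i0⟩
  choose! qq q1 q2 q3 q4 q5 using hex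
  set q : Fin k → Option V := fun j => if j ∈ O then some (qq j) else none with hq
  set fl : Fin k → Multiset (Bool × Bool) := fun j =>
    if j ∈ O then altM (a j) (N j - 4) else altM (!(a j)) (N j - 3) with hfl
  have hpads : ∀ c, ∑ v ∈ S.Sp, ((preB S cs v ++ postB S ds v : List (Bool × Bool)) :
      Multiset (Bool × Bool)).count c ≤ (if c.1 = c.2 then 0 else 4) * S.Sp.card := by
    intro c
    have := Finset.sum_le_card_nsmul _ _ _ (fun v (_ : v ∈ S.Sp) => padB_count S cs ds v c)
    simpa [mul_comm] using this
  have hqv : ∀ j v, q j = some v → j ∈ O ∧ v = qq j := by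
    intro j v h
    simp only [hq] at h
    split_ifs at h with h1
    exact ⟨h1, (Option.some.inj h).symm⟩
  refine ⟨{ a := a, b := b, cs := cs, ds := ds, pre := preB S cs, post := postB S ds
            icls := fun _ => (true, true), q := q, own := own, fl := fl
            ha := ha, hb := hb, hcF := hcF, hcS := hS
            hit := fun v hv => (itemB_ok S cs ds hcF v hv (hS v hv).1 (hS v hv).2).1
            hitb := fun v hv => (itemB_ok S cs ds hcF v hv (hS v hv).1 (hS v hv).2).2
            hq0 := by simp only [hq, if_neg hi0O]
            hq := fun j v h => by
              obtain ⟨h1, rfl⟩ := hqv j v h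
              exact ⟨q1 j h1, q2 j h1⟩
            hsel := by rw [S.sum_nb (fun v => lb (cs v, ds v))]; exact hsum
            hP := ?_
            hQ := ?_
            hsz := ?_
            hmain := Or.inr ⟨(true, false), by simp, by have := hbig (true, false) (by simp); omega⟩ }⟩
  · intro j hj hqj
    have hjO : j ∉ O := by
      intro h; simp only [hq, if_pos h] at hqj; cases hqj
    have hno : ∀ v, own v ≠ j := by
      intro v h; rcases hownO v with h1 | h1
      · exact hj (h.symm.trans h1)
      · exact hjO (h ▸ h1)
    have he : S.Sp.filter (fun v => own v = j) = ∅ := by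
      rw [Finset.filter_eq_empty_iff]; intro v _ h; exact hno v h
    have r1 := S.rt j (a j) (ha j)
    have r2 := S.rh j (b j) (hb j)
    have r3 : S.co (S.res (.t j (a j))) = !(a j) := by rw [hcoF _ r1.1, r1.2.1]
    have r4 : S.ci (S.res (.h j (b j))) = !(b j) := by
      have := hcoF _ r2.1; rw [r2.2.1] at this; exact bnot_flip this
    have h4 := hN j
    simp only [hfl, if_neg hjO]
    rw [he, r3, r4, altM_card, alt_balance (!(a j)) (!(b j))]
    · refine ⟨by simp; omega, by simp, Or.inr (Or.inl (altM_ne _ _ (by omega)))⟩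
    · have := hpar j hj hjO
      by_cases hab : a j = b j
      · rw [if_pos (by rw [hab])]; have := this.mp hab; omega
      · rw [if_neg (by simpa using hab)]
        have : ¬ N j % 2 = 1 := fun h => hab (this.mpr h)
        omega
  · intro j v h
    obtain ⟨h1, rfl⟩ := hqv j v h
    obtain ⟨p1, p2, p3⟩ := hOO j h1
    have hv := hS _ (q1 j h1)
    have r1 := S.ro (qq j) (q1 j h1) (ds (qq j)) hv.2
    have r2 := S.ri (qq j) (q1 j h1) (cs (qq j)) hv.1
    have r3 : S.co (S.res (.o (qq j) (ds (qq j)))) = a j := by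
      rw [hcoF _ r1.1, r1.2.1, q4 j h1]; simp
    have r4 : S.ci (S.res (.i (qq j) (cs (qq j)))) = a j := by
      have := bnot_flip ((r2.2.1).symm.trans (hcoF _ r2.1))
      rw [this, q3 j h1, Bool.not_not]
    have h4 := hN j
    refine ⟨q5 j h1, ?_, ?_, ?_, r4.symm, p2, p3⟩
    · simp only [hfl, if_pos h1, altM_card]; omega
    · simp only [hfl, if_pos h1, r3]
      rw [alt_balance]
      by_cases hab : a j = b j
      · rw [if_pos hab]; have := p1.mp hab; omega
      · rw [if_neg hab]
        have : N j % 2 = 1 := by by_contra h; exact hab (p1.mpr h)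
        omega
    · simp only [hfl, if_pos h1]
      by_cases h0 : N j - 4 = 0
      · right; intro c hc; rw [h0] at hc; simp [altM] at hc
      · left; exact altM_ne _ _ (by omega)
  · intro c
    by_cases hc : c.1 = c.2
    · left
      refine ⟨?_, ?_, ?_⟩
      · rw [Setup.fc, Finset.card_eq_zero, Finset.filter_eq_empty_iff]
        rintro v hv ⟨h1, h2⟩
        exact hF v hv (h1.trans (hc.trans h2.symm))
      · intro j _
        simp only [hfl]
        split_ifs
        · have := altM_count_le (a j) (N j - 4) c; rw [if_pos hc] at this; omega
        · have := altM_count_le (!(a j)) (N j - 3) c; rw [if_pos hc] at this; omega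
      · intro v _
        have := padB_count S cs ds v c
        rw [if_pos hc] at this; exact Nat.le_zero.mp this
    · right
      have hp := hpads c
      rw [if_neg hc] at hp
      have hb := hbig c hc
      have h1 : ∀ j, 2 * (fl j).count c ≤ (N j - 3) + 1 := by
        intro j
        simp only [hfl]
        split_ifs
        · have := altM_count_le (a j) (N j - 4) c; rw [if_neg hc] at this; omega
        · have := altM_count_le (!(a j)) (N j - 3) c; rw [if_neg hc] at this; omega
      have h2 : 2 * ∑ j ∈ Finset.univ.erase i0, (fl j).count c ≤ ∑ j ∈ Finset.univ.erase i0, (N j - 3) + k := by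
        rw [Finset.mul_sum]
        refine (Finset.sum_le_sum fun j _ => h1 j).trans ?_
        rw [Finset.sum_add_distrib]
        refine Nat.add_le_add_left ?_ _
        have := Finset.card_le_univ (Finset.univ.erase i0)
        simpa using this
      show ∑ j ∈ Finset.univ.erase i0, (fl j).count c + ∑ v ∈ S.Sp, ((preB S cs v ++ postB S ds v : List (Bool × Bool)) :
        Multiset (Bool × Bool)).count c + (3 + 4 * S.η + 8 * S.Sp.card + 8 * k) < S.fc c
      omega
end Two

set_option linter.unusedSectionVars false
section Clique
variable {V : Type} [Fintype V] {A : V → V → Prop} {k : ℕ} {s t : Fin k → V}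

lemma split_paths {ι : Type*} (i1 : ι) (N : ι → ℕ) (J : Finset ι) : ∀ T : ℕ, T ≤ ∑ j ∈ J, N j →
    ∃ x : ι → ℕ, (∀ j, x j ≤ N j) ∧ ∑ j ∈ J, x j = T ∧ ∃ i, ∀ j ∈ J, j ≠ i → x j = 0 ∨ x j = N j := by
  induction J using Finset.induction_on with
  | empty => intro T hT; exact ⟨fun _ => 0, by simp, by simp at hT; simp [hT], i1, by simp⟩
  | insert j J hj ih =>
    intro T hT
    rw [Finset.sum_insert hj] at hT
    by_cases h : T ≤ ∑ j ∈ J, N j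
    · obtain ⟨x, h1, h2, i, h3⟩ := ih T h
      refine ⟨Function.update x j 0, ?_, ?_, i, ?_⟩
      · intro l; by_cases hl : l = j
        · subst hl; simp
        · rw [Function.update_of_ne hl]; exact h1 l
      · rw [Finset.sum_insert hj, Function.update_self, zero_add, ← h2]
        refine Finset.sum_congr rfl fun l hl => ?_
        rw [Function.update_of_ne (fun h : l = j => hj (h ▸ hl))]
      · intro l hl hli
        by_cases hlj : l = j
        · subst hlj; simp
        · rw [Function.update_of_ne hlj]
          exact h3 l ((Finset.mem_insert.mp hl).resolve_left hlj) hli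
    · refine ⟨Function.update N j (T - ∑ j ∈ J, N j), ?_, ?_, j, ?_⟩
      · intro l; by_cases hl : l = j
        · subst hl; simp; omega
        · rw [Function.update_of_ne hl]
      · rw [Finset.sum_insert hj, Function.update_self]
        have : ∑ l ∈ J, Function.update N j (T - ∑ j ∈ J, N j) l = ∑ l ∈ J, N l := by
          refine Finset.sum_congr rfl fun l hl => ?_
          rw [Function.update_of_ne (fun h : l = j => hj (h ▸ hl))]
        rw [this]; omega
      · intro l _ hlj
        rw [Function.update_of_ne hlj]; exact Or.inr rfl

lemma pick24 {α : Type*} (K2 K4 N2 N4 : Finset α) (t2 t4 B2 B4 : ℕ) (hN2 : N2 ⊆ K2) (hN4 : N4 ⊆ K4)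
    (d2 : Disjoint N2 K4) (d4 : Disjoint N4 K2) (k2 : N4.card + 2 + B2 ≤ K2.card)
    (k4 : N2.card + 2 + B4 ≤ K4.card) (ht2 : t2 ≤ 1 + B2) (ht4 : t4 ≤ 1 + B4)
    (ht : 2 * (t2 + t4) ≤ 4 + B2 + B4) :
    ∃ (S2 S4 : Finset α) (e : ℕ), N2 ⊆ S2 ∧ S2 ⊆ K2 ∧ N4 ⊆ S4 ∧ S4 ⊆ K4 ∧ Disjoint S2 S4 ∧
      S2.card = t2 + e ∧ S4.card = t4 + e := by
  obtain ⟨e, he⟩ : ∃ e, e = max (N2.card - t2) (N4.card - t4) := ⟨_, rfl⟩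
  have u1 : (K2 ∪ K4).card + 0 = ((K2 \ N2) ∪ (K4 \ N4)).card + (N2.card + N4.card) := by
    have e1 : K2 ∪ K4 = ((K2 \ N2) ∪ (K4 \ N4)) ∪ (N2 ∪ N4) := by
      ext v
      have := @hN2 v
      have := @hN4 v
      simp only [Finset.mem_union, Finset.mem_sdiff]; tauto
    have e2 : Disjoint ((K2 \ N2) ∪ (K4 \ N4)) (N2 ∪ N4) := by
      rw [Finset.disjoint_left]
      intro v
      have : v ∈ N2 → v ∉ K4 := fun h => Finset.disjoint_left.mp d2 h
      have : v ∈ N4 → v ∉ K2 := fun h => Finset.disjoint_left.mp d4 h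
      simp only [Finset.mem_union, Finset.mem_sdiff]; tauto
    have e3 : Disjoint N2 N4 := d2.mono_right hN4
    rw [e1, Finset.card_union_of_disjoint e2, Finset.card_union_of_disjoint e3]; rfl
  have u2 : N2.card + K4.card ≤ (K2 ∪ K4).card := by
    rw [← Finset.card_union_of_disjoint d2]
    exact Finset.card_le_card (Finset.union_subset_union_left hN2)
  have u3 : N4.card + K2.card ≤ (K2 ∪ K4).card := by
    rw [← Finset.card_union_of_disjoint d4, Finset.union_comm K2]
    exact Finset.card_le_card (Finset.union_subset_union_left hN4)
  have c2 := Finset.card_sdiff_add_card_eq_card hN2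
  have c4 := Finset.card_sdiff_add_card_eq_card hN4
  have u4 : K2.card + K4.card ≤ 2 * (K2 ∪ K4).card := by
    have h2 := Finset.card_le_card (Finset.subset_union_left (s₁ := K2) (s₂ := K4))
    have h3 := Finset.card_le_card (Finset.subset_union_right (s₁ := K2) (s₂ := K4))
    omega
  obtain ⟨P, hP, Q, hQ, hPQ, hPc, hQc⟩ := two_sets (K2 \ N2) (K4 \ N4) (t2 + e - N2.card) (t4 + e - N4.card)
    (by omega) (by omega) (by omega)
  have dP : Disjoint N2 P := by
    rw [Finset.disjoint_right]; intro v hv; exact (Finset.mem_sdiff.mp (hP hv)).2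
  have dQ : Disjoint N4 Q := by
    rw [Finset.disjoint_right]; intro v hv; exact (Finset.mem_sdiff.mp (hQ hv)).2
  have hP' := hP.trans Finset.sdiff_subset
  have hQ' := hQ.trans Finset.sdiff_subset
  refine ⟨N2 ∪ P, N4 ∪ Q, e, Finset.subset_union_left, Finset.union_subset hN2 hP', Finset.subset_union_left,
    Finset.union_subset hN4 hQ', ?_, ?_, ?_⟩
  · rw [Finset.disjoint_union_left, Finset.disjoint_union_right, Finset.disjoint_union_right]
    exact ⟨⟨d2.mono_right hN4, d2.mono_right hQ'⟩, ⟨(d4.mono_right hP').symm, hPQ⟩⟩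
  · rw [Finset.card_union_of_disjoint dP]; omega
  · rw [Finset.card_union_of_disjoint dQ]; omega

/-- mismatches -/
noncomputable def Setup.mis (S : Setup A s t) (j : Fin k) (w : Bool × Bool) : ℕ :=
  (if S.Out (s j) w.1 then 0 else 1) + (if S.In (t j) w.2 then 0 else 1)

lemma Setup.mis_add (S : Setup A s t) (j : Fin k) (w : Bool × Bool) :
    S.mis j w + S.mis j (!w.1, !w.2) = S.bp (true, false) j + S.bp (false, true) j := by
  obtain ⟨p, q⟩ := w
  cases p <;> cases q <;> simp [Setup.mis, Setup.bp] <;> omega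

lemma slot_c (S : Setup A s t) (j : Fin k) (w : Bool × Bool) : ∃ (a b : Bool) (x y : ℕ), S.Out (s j) a ∧ S.In (t j) b ∧
    chi a - chi b = (x : ℤ) - y ∧ x ≤ (if w = (true, false) then 1 else 0) + S.bp (true, false) j ∧
    y ≤ (if w = (false, true) then 1 else 0) + S.bp (false, true) j ∧
    x + y ≤ 3 ∧ (x + y = 0 → a = w.1 ∧ b = w.2) ∧ (w.1 ≠ w.2 → 1 ≤ x + y) ∧
    x + y = (if w = (true, false) then 1 else 0) + (if w = (false, true) then 1 else 0) + S.mis j w := by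
  obtain ⟨p, q⟩ := w
  obtain ⟨a', ha'⟩ := S.hOne (s j)
  obtain ⟨b', hb'⟩ := S.hIne (t j)
  have ha : S.Out (s j) (if S.Out (s j) p then p else !p) := by
    split_ifs with h
    · exact h
    · cases p <;> cases a' <;> simp_all
  have hb : S.In (t j) (if S.In (t j) q then q else !q) := by
    split_ifs with h
    · exact h
    · cases q <;> cases b' <;> simp_all
  refine ⟨_, _, (if (p, q) = (true, false) then 1 else 0) + (if p = false ∧ ¬ S.Out (s j) false then 1 else 0) +
    (if q = true ∧ ¬ S.In (t j) true then 1 else 0), (if (p, q) = (false, true) then 1 else 0) +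
    (if p = true ∧ ¬ S.Out (s j) true then 1 else 0) +
    (if q = false ∧ ¬ S.In (t j) false then 1 else 0), ha, hb, ?_⟩
  clear ha hb ha' hb'
  cases p <;> cases q <;> simp only [Setup.mis, Setup.bp] <;>
    [by_cases h1 : S.Out (s j) false; by_cases h1 : S.Out (s j) false; by_cases h1 : S.Out (s j) true; by_cases h1 : S.Out (s j) true] <;>
    [by_cases h2 : S.In (t j) false; by_cases h2 : S.In (t j) false; by_cases h2 : S.In (t j) true; by_cases h2 : S.In (t j) true;
     by_cases h2 : S.In (t j) false; by_cases h2 : S.In (t j) false; by_cases h2 : S.In (t j) true; by_cases h2 : S.In (t j) true] <;>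
    simp [h1, h2, chi]

lemma slot_t (S : Setup A s t) (j : Fin k) : ∃ (a b : Bool) (x y : ℕ), S.Out (s j) a ∧ S.In (t j) b ∧
    chi a - chi b = (x : ℤ) - y ∧ x ≤ S.bp (true, false) j ∧ y ≤ S.bp (false, true) j ∧
    2 * (x + y) ≤ S.bp (true, false) j + S.bp (false, true) j ∧
    ((x = 0 ∧ y = 0 ∧ a = b) ∨ (x + y = 1 ∧ a ≠ b ∧ ¬ S.Out (s j) (!a) ∧ ¬ S.In (t j) (!b))) := by
  by_cases h : ∃ c, S.Out (s j) c ∧ S.In (t j) c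
  · obtain ⟨c, h1, h2⟩ := h
    exact ⟨c, c, 0, 0, h1, h2, by simp, by simp, by simp, by simp, Or.inl ⟨rfl, rfl, rfl⟩⟩
  · push Not at h
    obtain ⟨a, ha⟩ := S.hOne (s j)
    obtain ⟨b, hb⟩ := S.hIne (t j)
    have hab : a ≠ b := fun e => h a ha (e ▸ hb)
    have ha2 : ¬ S.Out (s j) (!a) := fun e => h _ e (by
      have : (!a) = b := by cases a <;> cases b <;> simp_all
      rw [this]; exact hb)
    have hb2 : ¬ S.In (t j) (!b) := fun e => h _ ha (by
      have : a = !b := by cases a <;> cases b <;> simp_all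
      rw [this]; exact e)
    cases a <;> cases b <;> simp at hab
    · exact ⟨false, true, 0, 1, ha, hb, by simp [chi], by simp, by simp_all [Setup.bp], by simp_all [Setup.bp],
        Or.inr ⟨rfl, by simp, ha2, hb2⟩⟩
    · exact ⟨true, false, 1, 0, ha, hb, by simp [chi], by simp_all [Setup.bp], by simp, by simp_all [Setup.bp],
        Or.inr ⟨rfl, by simp, ha2, hb2⟩⟩

/-- orientation -/
def wor (θ : Bool) (w : Bool × Bool) : Bool × Bool := (xor θ w.1, xor θ w.2)

lemma clique_slots (S : Setup A s t) (L : Finset (Fin k)) (w : Fin k → Bool × Bool)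
    (h2 : (L.filter (fun j => w j = (true, false))).card ≤ 1)
    (h4 : (L.filter (fun j => w j = (false, true))).card ≤ 1) :
    ∃ (θ : Bool) (a b : Fin k → Bool) (x y : Fin k → ℕ), (∀ j, S.Out (s j) (a j)) ∧ (∀ j, S.In (t j) (b j)) ∧
      (∀ j, chi (a j) - chi (b j) = (x j : ℤ) - y j) ∧
      (∀ j ∈ L, x j + y j ≤ 3 ∧ (x j + y j = 0 → a j = (wor θ (w j)).1 ∧ b j = (wor θ (w j)).2) ∧
        ((w j).1 ≠ (w j).2 → 1 ≤ x j + y j)) ∧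
      (∀ j, j ∉ L → ((x j = 0 ∧ y j = 0 ∧ a j = b j) ∨
        (x j + y j = 1 ∧ a j ≠ b j ∧ ¬ S.Out (s j) (!(a j)) ∧ ¬ S.In (t j) (!(b j))))) ∧
      ∑ j, x j ≤ 1 + ∑ j, S.bp (true, false) j ∧ ∑ j, y j ≤ 1 + ∑ j, S.bp (false, true) j ∧
      2 * (∑ j, x j + ∑ j, y j) ≤ 4 + ∑ j, S.bp (true, false) j + ∑ j, S.bp (false, true) j := by
  obtain ⟨θ, hθ⟩ : ∃ θ, 2 * ∑ j ∈ L, S.mis j (wor θ (w j)) ≤ ∑ j ∈ L, (S.bp (true, false) j + S.bp (false, true) j) := by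
    have : ∑ j ∈ L, S.mis j (wor false (w j)) + ∑ j ∈ L, S.mis j (wor true (w j)) =
        ∑ j ∈ L, (S.bp (true, false) j + S.bp (false, true) j) := by
      rw [← Finset.sum_add_distrib]
      refine Finset.sum_congr rfl fun j _ => ?_
      rw [← S.mis_add j (w j)]
      simp [wor]
    by_cases h : ∑ j ∈ L, S.mis j (wor false (w j)) ≤ ∑ j ∈ L, S.mis j (wor true (w j))
    · exact ⟨false, by omega⟩
    · exact ⟨true, by omega⟩
  have b2 : ∑ j ∈ L, (if wor θ (w j) = (true, false) then 1 else 0) ≤ 1 := by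
    rw [← Finset.card_filter]
    cases θ
    · refine (Finset.card_le_card ?_).trans h2; intro j; simp [wor, Prod.ext_iff]
    · refine (Finset.card_le_card ?_).trans h4; intro j; simp [wor, Prod.ext_iff]
  have b4 : ∑ j ∈ L, (if wor θ (w j) = (false, true) then 1 else 0) ≤ 1 := by
    rw [← Finset.card_filter]
    cases θ
    · refine (Finset.card_le_card ?_).trans h4; intro j; simp [wor, Prod.ext_iff]
    · refine (Finset.card_le_card ?_).trans h2; intro j; simp [wor, Prod.ext_iff]
  have key : ∀ j, ∃ (a b : Bool) (x y : ℕ), S.Out (s j) a ∧ S.In (t j) b ∧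
      chi a - chi b = (x : ℤ) - y ∧
      (j ∈ L → (x ≤ (if wor θ (w j) = (true, false) then 1 else 0) + S.bp (true, false) j ∧
        y ≤ (if wor θ (w j) = (false, true) then 1 else 0) + S.bp (false, true) j ∧
        x + y ≤ 3 ∧ (x + y = 0 → a = (wor θ (w j)).1 ∧ b = (wor θ (w j)).2) ∧ ((wor θ (w j)).1 ≠ (wor θ (w j)).2 → 1 ≤ x + y) ∧
        x + y = (if wor θ (w j) = (true, false) then 1 else 0) + (if wor θ (w j) = (false, true) then 1 else 0) + S.mis j (wor θ (w j)))) ∧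
      (j ∉ L → (x ≤ S.bp (true, false) j ∧ y ≤ S.bp (false, true) j ∧
    2 * (x + y) ≤ S.bp (true, false) j + S.bp (false, true) j ∧
    ((x = 0 ∧ y = 0 ∧ a = b) ∨ (x + y = 1 ∧ a ≠ b ∧ ¬ S.Out (s j) (!a) ∧ ¬ S.In (t j) (!b))))) := by
    intro j
    by_cases hj : j ∈ L
    · obtain ⟨a, b, x, y, e1, e2, e3, e4⟩ := slot_c S j (wor θ (w j))
      exact ⟨a, b, x, y, e1, e2, e3, fun _ => e4, fun h => absurd hj h⟩
    · obtain ⟨a, b, x, y, e1, e2, e3, e4⟩ := slot_t S j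
      exact ⟨a, b, x, y, e1, e2, e3, fun h => absurd h hj, fun _ => e4⟩
  choose a b x y ha hb hD hL hT using key
  have hsplit : ∀ f : Fin k → ℕ, ∑ j, f j = ∑ j ∈ L, f j + ∑ j ∈ Lᶜ, f j := fun f =>
    (Finset.sum_add_sum_compl L f).symm
  refine ⟨θ, a, b, x, y, ha, hb, hD, ?_, ?_, ?_, ?_, ?_⟩
  · intro j hj
    obtain ⟨_, _, e1, e2, e3, _⟩ := hL j hj
    refine ⟨e1, e2, fun h => e3 ?_⟩
    simpa [wor] using h
  · intro j hj; exact (hT j hj).2.2.2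
  · rw [hsplit, hsplit (S.bp (true, false))]
    have e1 := Finset.sum_le_sum fun j (hj : j ∈ L) => (hL j hj).1
    have e2 := Finset.sum_le_sum fun j (hj : j ∈ Lᶜ) => (hT j (Finset.mem_compl.mp hj)).1
    rw [Finset.sum_add_distrib] at e1
    omega
  · rw [hsplit, hsplit (S.bp (false, true))]
    have e1 := Finset.sum_le_sum fun j (hj : j ∈ L) => (hL j hj).2.1
    have e2 := Finset.sum_le_sum fun j (hj : j ∈ Lᶜ) => (hT j (Finset.mem_compl.mp hj)).2.1
    rw [Finset.sum_add_distrib] at e1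
    omega
  · rw [add_assoc 4, ← Finset.sum_add_distrib, ← Finset.sum_add_distrib, hsplit, hsplit (fun j => S.bp (true, false) j + S.bp (false, true) j)]
    have e1 : ∑ j ∈ L, (x j + y j) = _ := Finset.sum_congr rfl fun j (hj : j ∈ L) => (hL j hj).2.2.2.2.2
    have e2 := Finset.sum_le_sum fun j (hj : j ∈ Lᶜ) => (hT j (Finset.mem_compl.mp hj)).2.2.1
    rw [← Finset.mul_sum] at e2
    simp only [Finset.sum_add_distrib] at e1 e2 hθ ⊢
    omega
end Clique

set_option linter.unusedSectionVars false
section Clique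
variable {V : Type} [Fintype V] {A : V → V → Prop} {k : ℕ} {s t : Fin k → V}

lemma exists_left {α ι : Type*} (i0 : ι) (J : Finset ι) (T : Finset α) (own : α → ι) (τ : ι → ℕ)
    (h1 : ∀ v, own v = i0 ∨ own v ∈ J) (h2 : ∀ j ∈ J, (T.filter (fun v => own v = j)).card = τ j)
    (h : ∑ j ∈ J, τ j < T.card) : ∃ v ∈ T, own v = i0 := by
  by_contra hc
  push Not at hc
  have : T.card = ∑ j ∈ J, (T.filter (fun v => own v = j)).card := by
    refine Finset.card_eq_sum_card_fiberwise fun v hv => ?_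
    exact (h1 v).resolve_left (hc v hv)
  rw [this, Finset.sum_congr rfl h2] at h
  exact lt_irrefl _ h

/-- data of specials in the clique regime -/
lemma clique_specials (S : Setup A s t) (i0 : Fin k) (hω : S.ω = 1) (hF : ∀ v ∈ S.F, S.ci v = S.co v)
    (a b : Fin k → Bool) (x y : Fin k → ℕ) (hD : ∀ j, chi (a j) - chi (b j) = (x j : ℤ) - y j)
    (hx : ∑ j, x j ≤ 1 + ∑ j, S.bp (true, false) j) (hy : ∑ j, y j ≤ 1 + ∑ j, S.bp (false, true) j)
    (hxy : 2 * (∑ j, x j + ∑ j, y j) ≤ 4 + ∑ j, S.bp (true, false) j + ∑ j, S.bp (false, true) j)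
    (h0 : 1 ≤ x i0 + y i0) :
    ∃ (cs ds : V → Bool) (own : V → Fin k), (∀ v ∈ S.Brᶜ, S.In v (cs v) ∧ S.Out v (ds v)) ∧
      ∑ v ∈ S.Brᶜ, lb (cs v, ds v) = ∑ j, (chi (a j) - chi (b j)) ∧
      (∀ j, j ≠ i0 → (S.Sp.filter (fun v => own v = j)).card = x j + y j ∧
        (∀ v ∈ S.Sp, own v = j → cs v ≠ ds v) ∧
        ∑ v ∈ S.Sp.filter (fun v => own v = j), lb (cs v, ds v) = (x j : ℤ) - y j) ∧
      ∃ v ∈ S.Sp, own v = i0 ∧ cs v ≠ ds v := by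
  have hKS : ∀ c : Bool × Bool, c.1 ≠ c.2 → S.K c ⊆ S.Sp := by
    intro c hc v hv
    rw [Setup.K, Finset.mem_filter, S.nb_eq, Finset.mem_union] at hv
    rcases hv.1 with h | h
    · refine absurd ?_ hc
      rw [(S.hIF v h _).mp hv.2.1, (S.hOF v h _).mp hv.2.2, hF v h]
    · exact h
  have k2 := S.KN (true, false)
  have k4 := S.KN (false, true)
  rw [hω] at k2 k4
  simp only [Bool.not_true, Bool.not_false] at k2 k4
  have hall : ∀ v, (∃ b, S.In v b) ∧ (∃ b, S.Out v b) := fun v => ⟨S.hIne v, S.hOne v⟩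
  simp only [Bool.exists_bool] at hall
  obtain ⟨S2, S4, e, n2, s2, n4, s4, d24, c2, c4⟩ := pick24 (S.K (true, false)) (S.K (false, true))
    (S.Nf (true, false)) (S.Nf (false, true)) (∑ j, x j) (∑ j, y j) (∑ j, S.bp (true, false) j)
    (∑ j, S.bp (false, true) j)
    (by
      intro v hv
      have := hall v
      simp only [Setup.Nf, Setup.K, Finset.mem_filter, Bool.not_true, Bool.not_false] at hv ⊢
      tauto)
    (by
      intro v hv
      have := hall v
      simp only [Setup.Nf, Setup.K, Finset.mem_filter, Bool.not_true, Bool.not_false] at hv ⊢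
      tauto)
    (by
      rw [Finset.disjoint_left]
      intro v hv
      simp only [Setup.Nf, Setup.K, Finset.mem_filter, Bool.not_true, Bool.not_false] at hv ⊢
      tauto)
    (by
      rw [Finset.disjoint_left]
      intro v hv
      simp only [Setup.Nf, Setup.K, Finset.mem_filter, Bool.not_true, Bool.not_false] at hv ⊢
      tauto)
    (by omega) (by omega) hx hy hxy
  have hloop : ∀ v, ∃ c, v ∈ S.Brᶜ → v ∉ S2 → v ∉ S4 → S.In v c ∧ S.Out v c := by
    intro v
    by_contra hc
    push Not at hc
    obtain ⟨h1, h2, h3, h4⟩ := hc true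
    obtain ⟨_, _, _, h5⟩ := hc false
    have := hall v
    have i2 : v ∉ S.Nf (true, false) := fun h => h2 (n2 h)
    have i4 : v ∉ S.Nf (false, true) := fun h => h3 (n4 h)
    simp only [Setup.Nf, Finset.mem_filter, Bool.not_true, Bool.not_false] at i2 i4
    tauto
  choose lp hlp using hloop
  have hS2 := s2.trans (hKS (true, false) (by simp))
  have hS4 := s4.trans (hKS (false, true) (by simp))
  have hne : ∀ v, v ∈ S2 → v ∉ S4 := fun v h => Finset.disjoint_left.mp d24 h
  set cs : V → Bool := fun v => if v ∈ S2 then true else if v ∈ S4 then false else lp v with hcs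
  set ds : V → Bool := fun v => if v ∈ S2 then false else if v ∈ S4 then true else lp v with hds
  have l2 : ∀ v ∈ S2, cs v = true ∧ ds v = false := fun v hv => by simp only [hcs, hds, if_pos hv]; simp
  have l4 : ∀ v ∈ S4, cs v = false ∧ ds v = true := fun v hv => by
    have : v ∉ S2 := fun h => hne v h hv
    simp only [hcs, hds, if_pos hv, if_neg this]; simp
  have l0 : ∀ v, v ∉ S2 → v ∉ S4 → cs v = lp v ∧ ds v = lp v := fun v h2 h4 => by
    simp only [hcs, hds, if_neg h2, if_neg h4]; simp
  have hlb : ∀ v, lb (cs v, ds v) = (if v ∈ S2 then 1 else 0) - (if v ∈ S4 then 1 else 0) := by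
    intro v
    by_cases h2 : v ∈ S2
    · rw [(l2 v h2).1, (l2 v h2).2, if_pos h2, if_neg (hne v h2)]; simp [lb, chi]
    by_cases h4 : v ∈ S4
    · rw [(l4 v h4).1, (l4 v h4).2, if_neg h2, if_pos h4]; simp [lb, chi]
    rw [(l0 v h2 h4).1, (l0 v h2 h4).2, if_neg h2, if_neg h4]; simp [lb]
  have hlbs : ∀ T : Finset V, ∑ v ∈ T, lb (cs v, ds v) = ((T ∩ S2).card : ℤ) - (T ∩ S4).card := by
    intro T
    rw [Finset.sum_congr rfl fun v _ => hlb v, Finset.sum_sub_distrib, Finset.sum_boole, Finset.sum_boole,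
      Finset.filter_mem_eq_inter, Finset.filter_mem_eq_inter]
  set J := (Finset.univ : Finset (Fin k)).erase i0 with hJ
  have sx : ∑ j, x j = x i0 + ∑ j ∈ J, x j := (Finset.add_sum_erase _ _ (Finset.mem_univ i0)).symm
  have sy : ∑ j, y j = y i0 + ∑ j ∈ J, y j := (Finset.add_sum_erase _ _ (Finset.mem_univ i0)).symm
  have hi0J : i0 ∉ J := by simp [hJ]
  obtain ⟨own1, o1, o1'⟩ := distribute i0 J S2 x (by omega) hi0J
  obtain ⟨own2, o2, o2'⟩ := distribute i0 J S4 y (by omega) hi0J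
  set own : V → Fin k := fun v => if v ∈ S2 then own1 v else if v ∈ S4 then own2 v else i0 with hown
  have w2 : ∀ v ∈ S2, own v = own1 v := fun v hv => by simp only [hown, if_pos hv]
  have w4 : ∀ v ∈ S4, own v = own2 v := fun v hv => by
    have : v ∉ S2 := fun h => hne v h hv
    simp only [hown, if_pos hv, if_neg this]
  have w0 : ∀ v, v ∉ S2 → v ∉ S4 → own v = i0 := fun v h2 h4 => by
    simp only [hown, if_neg h2, if_neg h4]
  have hinBr : S.Sp ⊆ S.Brᶜ := by rw [S.nb_eq]; exact Finset.subset_union_right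
  refine ⟨cs, ds, own, ?_, ?_, ?_, ?_⟩
  · intro v hv
    by_cases h2 : v ∈ S2
    · rw [(l2 v h2).1, (l2 v h2).2]; exact (Finset.mem_filter.mp (s2 h2)).2
    by_cases h4 : v ∈ S4
    · rw [(l4 v h4).1, (l4 v h4).2]; exact (Finset.mem_filter.mp (s4 h4)).2
    rw [(l0 v h2 h4).1, (l0 v h2 h4).2]; exact hlp v hv h2 h4
  · rw [hlbs, Finset.inter_eq_right.mpr (hS2.trans hinBr), Finset.inter_eq_right.mpr (hS4.trans hinBr), c2, c4]
    rw [Finset.sum_congr rfl fun j _ => hD j, Finset.sum_sub_distrib]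
    push_cast; ring
  · intro j hj
    have hjJ : j ∈ J := by simp [hJ, hj]
    have f2 : (S.Sp.filter (fun v => own v = j)) ∩ S2 = S2.filter (fun v => own1 v = j) := by
      ext v; simp only [Finset.mem_inter, Finset.mem_filter]
      constructor
      · rintro ⟨⟨_, h⟩, h2⟩; exact ⟨h2, (w2 v h2) ▸ h⟩
      · rintro ⟨h2, h⟩; exact ⟨⟨hS2 h2, (w2 v h2).trans h⟩, h2⟩
    have f4 : (S.Sp.filter (fun v => own v = j)) ∩ S4 = S4.filter (fun v => own2 v = j) := by
      ext v; simp only [Finset.mem_inter, Finset.mem_filter]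
      constructor
      · rintro ⟨⟨_, h⟩, h2⟩; exact ⟨h2, (w4 v h2) ▸ h⟩
      · rintro ⟨h2, h⟩; exact ⟨⟨hS4 h2, (w4 v h2).trans h⟩, h2⟩
    have x2 : ((S.Sp.filter (fun v => own v = j)) ∩ S2).card = x j := by
      rw [f2, ← o1' j hjJ]; congr
    have x4 : ((S.Sp.filter (fun v => own v = j)) ∩ S4).card = y j := by
      rw [f4, ← o2' j hjJ]; congr
    refine ⟨?_, ?_, ?_⟩
    · have : S.Sp.filter (fun v => own v = j) = ((S.Sp.filter (fun v => own v = j)) ∩ S2) ∪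
          ((S.Sp.filter (fun v => own v = j)) ∩ S4) := by
        ext v; simp only [Finset.mem_union, Finset.mem_inter, Finset.mem_filter]
        constructor
        · rintro ⟨h1, h⟩
          by_cases h2 : v ∈ S2
          · exact Or.inl ⟨⟨h1, h⟩, h2⟩
          by_cases h4 : v ∈ S4
          · exact Or.inr ⟨⟨h1, h⟩, h4⟩
          exact absurd (h.symm.trans (w0 v h2 h4)) hj
        · rintro (h | h) <;> exact h.1
      rw [this, Finset.card_union_of_disjoint, x2, x4]
      exact d24.mono Finset.inter_subset_right Finset.inter_subset_right
    · intro v _ hv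
      by_cases h2 : v ∈ S2
      · rw [(l2 v h2).1, (l2 v h2).2]; simp
      by_cases h4 : v ∈ S4
      · rw [(l4 v h4).1, (l4 v h4).2]; simp
      exact absurd (hv.symm.trans (w0 v h2 h4)) hj
    · rw [hlbs, x2, x4]
  · by_cases hx0 : 1 ≤ x i0
    · obtain ⟨v, hv, hvo⟩ := exists_left i0 J S2 own1 x o1 (fun j hj => by rw [← o1' j hj]) (by omega)
      exact ⟨v, hS2 hv, (w2 v hv).trans hvo, by rw [(l2 v hv).1, (l2 v hv).2]; simp⟩
    · obtain ⟨v, hv, hvo⟩ := exists_left i0 J S4 own2 y o2 (fun j hj => by rw [← o2' j hj]) (by omega)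
      exact ⟨v, hS4 hv, (w4 v hv).trans hvo, by rw [(l4 v hv).1, (l4 v hv).2]; simp⟩

set_option maxHeartbeats 1000000 in
theorem clique_plan (S : Setup A s t) (N : Fin k → ℕ) (i0 : Fin k) (hN : ∀ j, 4 ≤ N j) (hω : S.ω = 1)
    (hF : ∀ v ∈ S.F, S.ci v = S.co v)
    (hbig : ∀ c : Bool, ∑ j ∈ Finset.univ.erase i0, N j + 60 * k + 20 * S.Sp.card + 8 * S.η + 8 < 2 * S.fc (c, c)) :
    Nonempty (Plan S N i0) := by
  set L : Finset (Fin k) := Finset.univ.filter (fun j => j = i0 ∨ 21 ≤ N j) with hL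
  obtain ⟨X, hXN, hXs, i1, hX⟩ := split_paths i0 N (L.erase i0) ((∑ j ∈ L.erase i0, N j) / 2) (Nat.div_le_self _ _)
  set w : Fin k → Bool × Bool := fun j => if j = i0 then (false, true) else if X j = N j then (true, true) else
    if X j = 0 then (false, false) else (true, false) with hw
  have hi0L : i0 ∈ L := by simp [hL]
  have w0 : w i0 = (false, true) := by simp [hw]
  obtain ⟨θ, a, b, x, y, ha, hb, hD, hLL, hTT, hx, hy, hxy⟩ := clique_slots S L w
    (by
      rw [Finset.card_le_one]
      have : ∀ j ∈ L.filter (fun j => w j = (true, false)), j = i1 := by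
        intro j hj
        rw [Finset.mem_filter] at hj
        have hj0 : j ≠ i0 := by rintro rfl; rw [w0] at hj; simp at hj
        by_contra hji
        have := hX j (Finset.mem_erase.mpr ⟨hj0, hj.1⟩) hji
        have hj2 := hj.2
        simp only [hw, if_neg hj0] at hj2
        split_ifs at hj2 with h1 h2 <;> simp at hj2
        tauto
      intro j hj j' hj'
      rw [this j hj, this j' hj'])
    (by
      rw [Finset.card_le_one]
      have : ∀ j ∈ L.filter (fun j => w j = (false, true)), j = i0 := by
        intro j hj
        rw [Finset.mem_filter] at hj
        by_contra hj0
        have hj2 := hj.2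
        simp only [hw, if_neg hj0] at hj2
        split_ifs at hj2 with h1 h2 <;> simp at hj2
      intro j hj j' hj'
      rw [this j hj, this j' hj'])
  have h0 := (hLL i0 hi0L).2.2 (by rw [w0]; simp)
  obtain ⟨cs, ds, own, hall, hsum, hown, hown0⟩ := clique_specials S i0 hω hF a b x y hD hx hy hxy h0
  have hFF : ∀ v ∈ S.F, S.In v (cs v) ∧ S.Out v (ds v) := fun v hv => hall v (by
    rw [S.nb_eq]; exact Finset.mem_union_left _ hv)
  have hS : ∀ v ∈ S.Sp, S.In v (cs v) ∧ S.Out v (ds v) := fun v hv => hall v (by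
    rw [S.nb_eq]; exact Finset.mem_union_right _ hv)
  have hcF := S.hcF_of cs ds hFF
  have rO : ∀ v ∈ S.Sp, S.co (S.res (.o v (ds v))) = ds v := fun v hv => by
    have := S.ro v hv (ds v) (hS v hv).2
    rw [← hF _ this.1, this.2.1]
  have rI : ∀ v ∈ S.Sp, S.ci (S.res (.i v (cs v))) = cs v := fun v hv => by
    have := S.ri v hv (cs v) (hS v hv).1
    rw [hF _ this.1, this.2.1]
  have rT : ∀ j, S.co (S.res (.t j (a j))) = a j := fun j => by
    have := S.rt j (a j) (ha j)
    rw [← hF _ this.1, this.2.1]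
  have rH : ∀ j, S.ci (S.res (.h j (b j))) = b j := fun j => by
    have := S.rh j (b j) (hb j)
    rw [hF _ this.1, this.2.1]
  set pre : V → List (Bool × Bool) := fun v => [(cs v, cs v)] with hpre
  set post : V → List (Bool × Bool) := fun v => [(ds v, ds v)] with hpost
  have hitem := fun v (hv : v ∈ S.Sp) => item_ok S cs ds pre post hcF v hv (hS v hv).1 (hS v hv).2 (cs v) (ds v)
    (by simp [hpre]) (by simp [hpost]) (by rw [rI v hv]; simp [IsCls, hpre]) (by rw [rO v hv]; simp [IsCls, hpost])
  set m : Fin k → ℕ := fun j => N j - 3 - 5 * (x j + y j) with hm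
  set fl : Fin k → Multiset (Bool × Bool) := fun j =>
    if j ∈ L then Multiset.replicate (min (X j) (m j)) (!θ, !θ) + Multiset.replicate (m j - min (X j) (m j)) (θ, θ)
    else if x j + y j = 0 then Multiset.replicate (N j - 3) (a j, a j) else Multiset.replicate (N j - 4) (b j, b j) with hfl
  have fL : ∀ j ∈ L, fl j = Multiset.replicate (min (X j) (m j)) (!θ, !θ) + Multiset.replicate (m j - min (X j) (m j)) (θ, θ) :=
    fun j hj => by simp only [hfl, if_pos hj]
  have fT0 : ∀ j, j ∉ L → x j + y j = 0 → fl j = Multiset.replicate (N j - 3) (a j, a j) := fun j hj h => by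
    simp only [hfl, if_neg hj, if_pos h]
  have fT1 : ∀ j, j ∉ L → x j + y j ≠ 0 → fl j = Multiset.replicate (N j - 4) (b j, b j) := fun j hj h => by
    simp only [hfl, if_neg hj, if_neg h]
  have floop : ∀ j, ∀ c ∈ fl j, c.1 = c.2 := by
    intro j c hc
    simp only [hfl] at hc
    split_ifs at hc
    · rw [Multiset.mem_add] at hc
      rcases hc with hc | hc <;> rw [Multiset.eq_of_mem_replicate hc]
    · rw [Multiset.eq_of_mem_replicate hc]
    · rw [Multiset.eq_of_mem_replicate hc]
  have flsum : ∀ j, ((fl j).map lb).sum = 0 := by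
    intro j
    refine Multiset.sum_eq_zero fun z hz => ?_
    obtain ⟨c, hc, rfl⟩ := Multiset.mem_map.mp hz
    rw [lb, floop j c hc, sub_self]
  have hLN : ∀ j ∈ L, j ≠ i0 → 21 ≤ N j := by
    intro j hj h; rw [hL, Finset.mem_filter] at hj; exact hj.2.resolve_left h
  have hTN : ∀ j, j ∉ L → N j ≤ 20 := by
    intro j hj; by_contra h
    exact hj (by rw [hL, Finset.mem_filter]; exact ⟨Finset.mem_univ _, Or.inr (by omega)⟩)
  have hQex : ∀ j, ∃ v, j ∉ L → x j + y j = 1 → (v ∈ S.Sp ∧ own v = j ∧ cs v = a j ∧ ds v = b j ∧ ∀ u ∈ S.Sp, own u = j → u = v) := by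
    intro j
    by_cases h : j ∉ L ∧ x j + y j = 1
    · have hji : j ≠ i0 := fun e => h.1 (e ▸ hi0L)
      obtain ⟨q1, q2, q3⟩ := hown j hji
      obtain ⟨v, hv⟩ := Finset.card_eq_one.mp (q1.trans h.2)
      have hmem : ∀ u, (u ∈ S.Sp ∧ own u = j) ↔ u = v := by
        intro u
        have := Finset.ext_iff.mp hv u
        simpa using this
      have hv1 := (hmem v).mpr rfl
      refine ⟨v, fun _ _ => ⟨hv1.1, hv1.2, ?_⟩⟩
      rw [hv, Finset.sum_singleton, ← hD j] at q3
      have hne := q2 v hv1.1 hv1.2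
      have hab : a j ≠ b j := by
        rcases hTT j h.1 with h' | h'
        · omega
        · exact h'.2.1
      refine ⟨?_, ?_, fun u hu huj => (hmem u).mp ⟨hu, huj⟩⟩
      · revert q3 hne hab
        cases cs v <;> cases ds v <;> cases a j <;> cases b j <;> simp [lb, chi]
      · revert q3 hne hab
        cases cs v <;> cases ds v <;> cases a j <;> cases b j <;> simp [lb, chi]
    · exact ⟨s i0, fun h1 h2 => absurd ⟨h1, h2⟩ h⟩
  choose qq hqq using hQex
  set q : Fin k → Option V := fun j => if j ∉ L ∧ x j + y j = 1 then some (qq j) else none with hq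
  have hqv : ∀ j v, q j = some v → (j ∉ L ∧ x j + y j = 1) ∧ v = qq j := by
    intro j v h
    simp only [hq] at h
    split_ifs at h with h1
    exact ⟨h1, (Option.some.inj h).symm⟩
  refine ⟨{ a := a, b := b, cs := cs, ds := ds, pre := pre, post := post
            icls := fun v => (cs v, ds v), q := q, own := own, fl := fl
            ha := ha, hb := hb, hcF := hcF, hcS := hS
            hit := fun v hv => (hitem v hv).1
            hitb := fun v hv => (hitem v hv).2
            hq0 := by simp only [hq]; rw [if_neg]; exact fun h => h.1 hi0L
            hq := fun j v h => by
              obtain ⟨h1, rfl⟩ := hqv j v h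
              have := hqq j h1.1 h1.2
              exact ⟨this.1, this.2.1⟩
            hsel := by rw [S.sum_nb (fun v => lb (cs v, ds v))]; exact hsum
            hP := ?_
            hQ := ?_
            hsz := ?_
            hmain := Or.inl hown0 }⟩
  · intro j hj hqj
    obtain ⟨q1, q2, q3⟩ := hown j hj
    have h4 := hN j
    rw [rT, rH, flsum, add_zero]
    have hlen : ∑ v ∈ S.Sp.filter (fun v => own v = j), (3 + (pre v).length + (post v).length) = 5 * (x j + y j) := by
      rw [← q1]; simp [hpre, hpost, mul_comm]
    rw [hlen]
    refine ⟨?_, by rw [q3, hD], ?_⟩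
    · by_cases hjL : j ∈ L
      · have := hLN j hjL hj
        have := (hLL j hjL).1
        rw [fL j hjL, Multiset.card_add, Multiset.card_replicate, Multiset.card_replicate]
        simp only [hm]; omega
      · have h00 : x j + y j = 0 := by
          rcases hTT j hjL with h | h
          · omega
          · simp only [hq, if_pos (show j ∉ L ∧ x j + y j = 1 from ⟨hjL, h.1⟩)] at hqj; cases hqj
        rw [fT0 j hjL h00, Multiset.card_replicate]; omega
    · by_cases h00 : x j + y j = 0
      · have hno : ∀ v ∈ S.Sp, own v ≠ j := by
          intro v hv h
          rw [h00, Finset.card_eq_zero] at q1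
          have : v ∈ S.Sp.filter (fun v => own v = j) := Finset.mem_filter.mpr ⟨hv, h⟩
          rw [q1] at this; simp at this
        right; right
        refine ⟨?_, fun v hv h => absurd h (hno v hv), ?_⟩
        · by_cases hjL : j ∈ L
          · have := hLN j hjL hj
            intro h
            have h' := congrArg Multiset.card h
            rw [fL j hjL, Multiset.card_add, Multiset.card_replicate, Multiset.card_replicate] at h'
            simp only [hm, Multiset.card_zero] at h'; omega
          · intro h
            have h' := congrArg Multiset.card h
            rw [fT0 j hjL h00, Multiset.card_replicate] at h'
            simp only [Multiset.card_zero] at h'; omega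
        · by_cases hjL : j ∈ L
          · obtain ⟨_, p2, p3⟩ := hLL j hjL
            have p2 := p2 h00
            have hN21 := hLN j hjL hj
            rw [fL j hjL]
            have hwj : (w j).1 = (w j).2 := by by_contra h; have := p3 h; omega
            by_cases hXj : X j = N j
            · have hwv : w j = (true, true) := by simp only [hw, if_neg hj, if_pos hXj]
              rw [hwv] at p2
              have : m j - min (X j) (m j) = 0 := by simp only [hm]; omega
              rw [this]
              intro c hc
              simp only [Multiset.replicate_zero, add_zero] at hc
              rw [Multiset.eq_of_mem_replicate hc, p2.1]
              simp [wor]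
            · by_cases hX0 : X j = 0
              · have hwv : w j = (false, false) := by simp only [hw, if_neg hj, if_neg hXj, if_pos hX0]
                rw [hwv] at p2
                rw [hX0]
                intro c hc
                simp only [Nat.zero_min, Multiset.replicate_zero, zero_add] at hc
                rw [Multiset.eq_of_mem_replicate hc, p2.1]
                simp [wor]
              · simp only [hw, if_neg hj, if_neg hXj, if_neg hX0] at hwj
                simp at hwj
          · rw [fT0 j hjL h00]
            intro c hc; exact Multiset.eq_of_mem_replicate hc
      · left
        have : (S.Sp.filter (fun v => own v = j)).Nonempty := by
          rw [← Finset.card_pos]; omega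
        obtain ⟨v, hv⟩ := this
        rw [Finset.mem_filter] at hv
        exact ⟨v, hv.1, hv.2, q2 v hv.1 hv.2⟩
  · intro j v h
    obtain ⟨h1, rfl⟩ := hqv j v h
    obtain ⟨u1, u2, u3, u4, u5⟩ := hqq j h1.1 h1.2
    have hnf : ¬ S.Out (s j) (!(a j)) ∧ ¬ S.In (t j) (!(b j)) := by
      rcases hTT j h1.1 with h' | h'
      · omega
      · exact h'.2.2
    have h4 := hN j
    have hfj := fT1 j h1.1 (by omega)
    rw [flsum, rO _ u1, rI _ u1, u3, u4]
    refine ⟨u5, ?_, by simp, Or.inr ?_, rfl, hnf⟩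
    · rw [hfj, Multiset.card_replicate]; omega
    · rw [hfj]; intro c hc; exact Multiset.eq_of_mem_replicate hc
  · intro c
    by_cases hc : c.1 = c.2
    · right
      obtain ⟨c, d⟩ := c
      simp only at hc
      subst hc
      have hb' := hbig c
      have hp : ∑ v ∈ S.Sp, ((pre v ++ post v : List (Bool × Bool)) : Multiset (Bool × Bool)).count (c, c) ≤ 2 * S.Sp.card := by
        have : ∀ v ∈ S.Sp, ((pre v ++ post v : List (Bool × Bool)) : Multiset (Bool × Bool)).count (c, c) ≤ 2 := fun v _ =>
          (Multiset.count_le_card _ _).trans (by simp [hpre, hpost])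
        have := Finset.sum_le_card_nsmul _ _ _ this
        simpa [mul_comm] using this
      have hct : ∀ j, (fl j).count (c, c) ≤ (if j ∈ L then (if c = !θ then X j else N j - X j) else 0) + 20 := by
        intro j
        by_cases hjL : j ∈ L
        · rw [if_pos hjL, fL j hjL, Multiset.count_add, Multiset.count_replicate, Multiset.count_replicate]
          have := hXN j
          have hmN : m j ≤ N j := by simp only [hm]; omega
          cases c <;> cases θ <;> simp <;> omega
        · rw [if_neg hjL]
          have := hTN j hjL
          refine (Multiset.count_le_card _ _).trans ?_
          by_cases h00 : x j + y j = 0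
          · rw [fT0 j hjL h00, Multiset.card_replicate]; omega
          · rw [fT1 j hjL h00, Multiset.card_replicate]; omega
      have hsumct : 2 * ∑ j ∈ Finset.univ.erase i0, (fl j).count (c, c) ≤ ∑ j ∈ Finset.univ.erase i0, N j + 1 + 40 * k := by
        have e1 := Finset.sum_le_sum fun j (_ : j ∈ Finset.univ.erase i0) => hct j
        rw [Finset.sum_add_distrib, ← Finset.sum_filter] at e1
        have e2 : (Finset.univ.erase i0).filter (fun j => j ∈ L) = L.erase i0 := by
          ext j; simp
        rw [e2] at e1
        have e3 : ∑ j ∈ Finset.univ.erase i0, 20 ≤ 20 * k := by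
          have := Finset.card_le_univ (Finset.univ.erase i0)
          simp at this ⊢; omega
        have e4 : ∑ j ∈ L.erase i0, N j ≤ ∑ j ∈ Finset.univ.erase i0, N j :=
          Finset.sum_le_sum_of_subset (Finset.erase_subset_erase _ (Finset.subset_univ _))
        have e5 : ∑ j ∈ L.erase i0, X j + ∑ j ∈ L.erase i0, (N j - X j) = ∑ j ∈ L.erase i0, N j := by
          rw [← Finset.sum_add_distrib]
          exact Finset.sum_congr rfl fun j _ => by have := hXN j; omega
        split_ifs at e1
        · omega
        · omega
      show ∑ j ∈ Finset.univ.erase i0, (fl j).count (c, c) + ∑ v ∈ S.Sp, ((pre v ++ post v : List (Bool × Bool)) :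
        Multiset (Bool × Bool)).count (c, c) + (3 + 4 * S.η + 8 * S.Sp.card + 8 * k) < S.fc (c, c)
      omega
    · left
      refine ⟨?_, ?_, ?_⟩
      · rw [Setup.fc, Finset.card_eq_zero, Finset.filter_eq_empty_iff]
        rintro v hv ⟨h1, h2⟩
        exact hc (h1.symm.trans ((hF v hv).trans h2))
      · intro j _
        rw [Multiset.count_eq_zero]
        exact fun h => hc (floop j c h)
      · intro v _
        rw [Multiset.count_eq_zero]
        intro h
        simp only [hpre, hpost, Multiset.mem_coe, List.mem_append, List.mem_singleton] at h
        rcases h with h | h <;> rw [h] at hc <;> simp at hc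
end Clique

set_option linter.unusedSectionVars false
section Phase

lemma matching4 {C V : Type} [Fintype C] (hC : Fintype.card C ≤ 4) (Low Cand : C → Finset V)
    (R : C → V → V → Prop) (D : ℕ) (hirr : ∀ c u y, R c u y → u ≠ y)
    (hdeg : ∀ c, ∀ u ∈ Low c, ((Cand c).filter (fun y => R c u y)).card ≤ D) :
    ∀ (n : ℕ) (m : C → ℕ), ∑ c, m c = n → (∀ c, 0 < m c → 8 * m c + 8 * D < (Cand c).card) →
      (∀ c, ∀ y ∈ Cand c, m c ≤ ((Low c).filter (fun u => R c u y)).card) →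
      ∃ M : Finset (C × V × V), (∀ p ∈ M, p.2.1 ∈ Low p.1 ∧ p.2.2 ∈ Cand p.1 ∧ R p.1 p.2.1 p.2.2) ∧
        (∀ p ∈ M, ∀ q ∈ M, p.2.1 = q.2.1 → p = q) ∧ (∀ p ∈ M, ∀ q ∈ M, p.2.2 = q.2.2 → p = q) ∧
        (∀ p ∈ M, ∀ q ∈ M, p.2.1 ≠ q.2.2) ∧
        ∀ c, (M.filter (fun p => p.1 = c)).card = m c := by
  intro n
  induction n with
  | zero =>
    intro m hm _ _
    refine ⟨∅, by simp, by simp, by simp, by simp, fun c => ?_⟩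
    have := (Finset.sum_eq_zero_iff.mp hm) c (Finset.mem_univ _)
    simp [this]
  | succ n ih =>
    intro m hm h1 h2
    have hne : (Finset.univ : Finset C).Nonempty := by
      by_contra h
      rw [Finset.not_nonempty_iff_eq_empty] at h
      rw [h] at hm; simp at hm
    obtain ⟨c, _, hc⟩ := Finset.exists_max_image Finset.univ m hne
    have hm4 : n + 1 ≤ 4 * m c := by
      rw [← hm]
      refine (Finset.sum_le_card_nsmul _ _ _ hc).trans ?_
      rw [smul_eq_mul, Finset.card_univ]
      exact Nat.mul_le_mul_right _ hC
    have hcpos : 0 < m c := by omega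
    have hle : ∀ d, Function.update m c (m c - 1) d ≤ m d := by
      intro d
      by_cases hd : d = c
      · subst hd; simp
      · rw [Function.update_of_ne hd]
    obtain ⟨M, g1, g2, g3, g4, g5⟩ := ih (Function.update m c (m c - 1))
      (by
        rw [Finset.sum_update_of_mem (Finset.mem_univ _)]
        have := Finset.sum_eq_add_sum_sdiff_singleton_of_mem (Finset.mem_univ c) m
        omega)
      (fun d hd => by have := h1 d (lt_of_lt_of_le hd (hle d)); have := hle d; omega)
      (fun d y hy => (hle d).trans (h2 d y hy))
    have hMc : M.card = n := by
      rw [Finset.card_eq_sum_card_fiberwise (f := fun p => p.1) (t := Finset.univ) (fun _ _ => Finset.mem_univ _)]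
      rw [Finset.sum_congr rfl fun d _ => g5 d, Finset.sum_update_of_mem (Finset.mem_univ _)]
      have := Finset.sum_eq_add_sum_sdiff_singleton_of_mem (Finset.mem_univ c) m
      omega
    set Z := M.image (fun p => p.2.1) ∪ M.image (fun p => p.2.2) with hZ
    have hZc : Z.card ≤ 8 * m c := by
      rw [hZ]
      refine (Finset.card_union_le _ _).trans ?_
      refine (Nat.add_le_add Finset.card_image_le Finset.card_image_le).trans ?_
      omega
    obtain ⟨u, hu, y, hy, hR⟩ : ∃ u ∈ Low c \ Z, ∃ y ∈ Cand c \ Z, R c u y := by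
      by_contra hno
      push Not at hno
      have := Finset.card_mul_le_card_mul (s := Cand c \ Z) (t := Low c ∩ Z) (fun y u => R c u y) (m := m c) (n := D)
        (by
          intro y hy
          refine (h2 c y (Finset.mem_sdiff.mp hy).1).trans (Finset.card_le_card ?_)
          intro u hu
          rw [Finset.mem_filter] at hu
          rw [Finset.mem_bipartiteAbove, Finset.mem_inter]
          refine ⟨⟨hu.1, ?_⟩, hu.2⟩
          by_contra huZ
          exact hno u (Finset.mem_sdiff.mpr ⟨hu.1, huZ⟩) y hy hu.2)
        (by
          intro u hu
          refine le_trans (Finset.card_le_card ?_) (hdeg c u (Finset.mem_inter.mp hu).1)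
          intro y hy
          rw [Finset.mem_bipartiteBelow] at hy
          exact Finset.mem_filter.mpr ⟨(Finset.mem_sdiff.mp hy.1).1, hy.2⟩)
      have e1 : (Low c ∩ Z).card ≤ 8 * m c := (Finset.card_le_card Finset.inter_subset_right).trans hZc
      have e2 : (Cand c).card - Z.card ≤ (Cand c \ Z).card := Finset.le_card_sdiff _ _
      have e3 := h1 c hcpos
      have e4 : 8 * D + 1 ≤ (Cand c \ Z).card := by omega
      have e5 := Nat.mul_le_mul_right (m c) e4
      have e6 := Nat.mul_le_mul_right D e1
      nlinarith
    rw [Finset.mem_sdiff] at hu hy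
    have hZ1 : ∀ p ∈ M, p.2.1 ∈ Z := fun p hp => Finset.mem_union_left _ (Finset.mem_image_of_mem _ hp)
    have hZ2 : ∀ p ∈ M, p.2.2 ∈ Z := fun p hp => Finset.mem_union_right _ (Finset.mem_image_of_mem _ hp)
    have hnew : (c, u, y) ∉ M := fun h => hu.2 (hZ1 _ h)
    refine ⟨insert (c, u, y) M, ?_, ?_, ?_, ?_, ?_⟩
    · intro p hp
      rcases Finset.mem_insert.mp hp with rfl | hp
      · exact ⟨hu.1, hy.1, hR⟩
      · exact g1 p hp
    · intro p hp q hq h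
      rcases Finset.mem_insert.mp hp with rfl | hp <;> rcases Finset.mem_insert.mp hq with rfl | hq
      · rfl
      · have h9 := hZ1 q hq
        simp only at h
        first | rw [h] at h9 | rw [← h] at h9
        exact absurd h9 hu.2
      · have h9 := hZ1 p hp
        simp only at h
        first | rw [h] at h9 | rw [← h] at h9
        exact absurd h9 hu.2
      · exact g2 p hp q hq h
    · intro p hp q hq h
      rcases Finset.mem_insert.mp hp with rfl | hp <;> rcases Finset.mem_insert.mp hq with rfl | hq
      · rfl
      · have h9 := hZ2 q hq
        simp only at h
        first | rw [h] at h9 | rw [← h] at h9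
        exact absurd h9 hy.2
      · have h9 := hZ2 p hp
        simp only at h
        first | rw [h] at h9 | rw [← h] at h9
        exact absurd h9 hy.2
      · exact g3 p hp q hq h
    · intro p hp q hq h
      rcases Finset.mem_insert.mp hp with rfl | hp <;> rcases Finset.mem_insert.mp hq with rfl | hq
      · exact hirr _ _ _ hR h
      · have h9 := hZ2 q hq
        simp only at h
        first | rw [h] at h9 | rw [← h] at h9
        exact absurd h9 hu.2
      · have h9 := hZ1 p hp
        simp only at h
        first | rw [h] at h9 | rw [← h] at h9
        exact absurd h9 hy.2
      · exact g4 p hp q hq h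
    · intro d
      rw [Finset.filter_insert]
      by_cases hd : c = d
      · subst hd
        rw [if_pos rfl, Finset.card_insert_of_notMem (fun h => hnew (Finset.mem_filter.mp h).1), g5, Function.update_self]
        omega
      · rw [if_neg hd, g5, Function.update_of_ne (Ne.symm hd)]

/-- greedy system of distinct representatives -/
lemma greedy {ι V : Type} (R : Finset ι) (Cnd : ι → Finset V) (v0 : V) : (∀ r ∈ R, R.card ≤ (Cnd r).card) →
    ∃ f : ι → V, (∀ r ∈ R, f r ∈ Cnd r) ∧ ∀ r ∈ R, ∀ r' ∈ R, f r = f r' → r = r' := by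
  induction R using Finset.induction_on with
  | empty => intro _; exact ⟨fun _ => v0, by simp, by simp⟩
  | insert r R hr ih =>
    intro h
    rw [Finset.card_insert_of_notMem hr] at h
    obtain ⟨f, f1, f2⟩ := ih (fun r' hr' => by have := h r' (Finset.mem_insert_of_mem hr'); omega)
    obtain ⟨y, hy⟩ : (Cnd r \ R.image f).Nonempty := by
      rw [← Finset.card_pos]
      have := Finset.le_card_sdiff (R.image f) (Cnd r)
      have := h r (Finset.mem_insert_self _ _)
      have := Finset.card_image_le (s := R) (f := f)
      omega
    rw [Finset.mem_sdiff] at hy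
    have hne : ∀ r' ∈ R, r' ≠ r := fun r' h e => hr (e ▸ h)
    refine ⟨Function.update f r y, ?_, ?_⟩
    · intro r' hr'
      rcases Finset.mem_insert.mp hr' with rfl | hr'
      · rw [Function.update_self]; exact hy.1
      · rw [Function.update_of_ne (hne r' hr')]; exact f1 r' hr'
    · intro p hp q hq hpq
      rcases Finset.mem_insert.mp hp with hp' | hp' <;> rcases Finset.mem_insert.mp hq with hq' | hq'
      · rw [hp', hq']
      · subst hp'
        rw [Function.update_self, Function.update_of_ne (hne q hq')] at hpq
        exact absurd (Finset.mem_image.mpr ⟨q, hq', hpq.symm⟩) hy.2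
      · subst hq'
        rw [Function.update_self, Function.update_of_ne (hne p hp')] at hpq
        exact absurd (Finset.mem_image.mpr ⟨p, hp', hpq⟩) hy.2
      · rw [Function.update_of_ne (hne p hp'), Function.update_of_ne (hne q hq')] at hpq
        exact f2 p hp' q hq' hpq
end Phase

set_option linter.unusedSectionVars false

/-- the adjacency relation read from the two sides -/
def Rl {V : Type} (A : V → V → Prop) (o : Bool) (u y : V) : Prop := if o = true then A u y else A y u

/-- raw input data of the cleaning phase -/
structure Pre {V : Type} [Fintype V] (A : V → V → Prop) {k : ℕ} (s t : Fin k → V) where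
  tc : Bool → V → Bool
  Bad : Finset V
  Ra : Finset V
  Br : Finset V
  ω : ℕ
  D : ℕ
  Db : ℕ
  dl : ℕ
  Sb : ℕ
  hloop : ∀ v, ¬ A v v
  hBr : ∀ x, x ∈ Br ↔ ∃ i, x = s i ∨ x = t i
  hBrc : Br.card ≤ 2 * k
  hdeg : ∀ o v, Fintype.card V + 2 * k ≤ 2 * (Finset.univ.filter (fun y => Rl A o v y)).card
  hcls : ∀ o b, 2 * (Finset.univ.filter (fun y => tc o y = b)).card ≤ Fintype.card V + 2 * dl
  hbad : ∀ o v, v ∉ Bad → (Finset.univ.filter (fun y => tc o y = tc (!o) v ∧ ¬ Rl A o v y)).card ≤ D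
  hω : ω ≤ 1
  hRa : ω = 1 → ∀ v, v ∉ Ra → tc true v = tc false v
  h1 : Ra.card + 5 * Bad.card + 4 * dl + 12 * k + 8 ≤ Sb
  h2 : 6 * Sb + 6 * k ≤ Db
  h3 : 8 * k * dl + 16 * k * Db + 6 * Sb + 6 * k ≤ D
  h4 : 60 * D < Fintype.card V
  h5 : dl + Db ≤ D

namespace Pre
variable {V : Type} [Fintype V] {A : V → V → Prop} {k : ℕ} {s t : Fin k → V} (p : Pre A s t)

/-- degree into a class -/
noncomputable def dg (o : Bool) (v : V) (b : Bool) : ℕ :=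
  (Finset.univ.filter (fun y => Rl A o v y ∧ p.tc o y = b)).card

/-- classes initially allowed -/
def Al0 (o : Bool) (v : V) (b : Bool) : Prop :=
  if v ∈ p.Br then p.Db ≤ p.dg o v b else if v ∈ p.Bad then p.D ≤ p.dg o v b else b = p.tc (!o) v

/-- vertices forced to one class -/
noncomputable def P (o b : Bool) : Finset V := Finset.univ.filter (fun v => ¬ p.Al0 o v (!b))

/-- number of vertices which have to be relaxed -/
noncomputable def r (o b : Bool) : ℕ := (p.P o b).card + k + p.ω - Fintype.card V / 2

/-- vertices with many exceptional arcs -/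
noncomputable def Hi (o b : Bool) : Finset V :=
  (p.P o b).filter (fun v => v ∉ p.Br ∧ p.D ≤ p.dg o v (!b))

/-- vertices with few exceptional arcs -/
noncomputable def Low (o b : Bool) : Finset V :=
  (p.P o b).filter (fun v => v ∉ p.Br ∧ ¬ p.D ≤ p.dg o v (!b))

lemma exists_Hf (o b : Bool) : ∃ h ⊆ p.Hi o b, h.card = min (p.r o b) (p.Hi o b).card :=
  Finset.exists_subset_card_eq (min_le_right _ _)

/-- chosen relaxed vertices -/
noncomputable def Hf (o b : Bool) : Finset V := (p.exists_Hf o b).choose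
lemma Hf_sub (o b : Bool) : p.Hf o b ⊆ p.Hi o b := (p.exists_Hf o b).choose_spec.1
lemma Hf_card (o b : Bool) : (p.Hf o b).card = min (p.r o b) (p.Hi o b).card := (p.exists_Hf o b).choose_spec.2

/-- good vertices for the branch vertices -/
def Good (y : V) : Prop := ∀ o, ∀ z ∈ p.Br,
  (¬ p.Al0 o z (!(p.tc o y)) → Rl A o z y) ∧ (¬ p.Al0 o z (p.tc o y) → ¬ Rl A o z y)

/-- candidates for matching -/
noncomputable def Cand (o b : Bool) : Finset V := Finset.univ.filter (fun y => p.tc o y = (!b) ∧ p.Good y ∧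
  y ∉ p.Br ∧ y ∉ p.Bad ∧ y ∉ p.Ra ∧ ∀ o' b', y ∉ p.Hf o' b')

lemma dg_add (o : Bool) (v : V) (b : Bool) : Fintype.card V + 2 * k ≤ 2 * (p.dg o v b + p.dg o v (!b)) := by
  refine (p.hdeg o v).trans ?_
  have : (Finset.univ.filter (fun y => Rl A o v y)).card ≤ p.dg o v b + p.dg o v (!b) := by
    unfold dg
    rw [← Finset.card_filter_add_card_filter_not (s := Finset.univ.filter (fun y => Rl A o v y)) (fun y => p.tc o y = b)]
    rw [Finset.filter_filter, Finset.filter_filter]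
    refine Nat.add_le_add le_rfl (Finset.card_le_card ?_)
    intro y hy
    simp only [Finset.mem_filter, Finset.mem_univ, true_and] at hy ⊢
    refine ⟨hy.1, ?_⟩
    cases h1 : p.tc o y <;> cases b <;> simp_all
  omega

lemma dg_miss (o : Bool) (v : V) (b : Bool) :
    p.dg o v b + (Finset.univ.filter (fun y => p.tc o y = b ∧ ¬ Rl A o v y)).card =
      (Finset.univ.filter (fun y => p.tc o y = b)).card := by
  rw [← Finset.card_filter_add_card_filter_not (s := Finset.univ.filter (fun y => p.tc o y = b)) (fun y => Rl A o v y)]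
  rw [Finset.filter_filter, Finset.filter_filter]
  unfold dg
  congr 2
  ext y; simp only [Finset.mem_filter, Finset.mem_univ, true_and]; tauto

lemma cls_low (o b : Bool) : Fintype.card V ≤ 2 * (Finset.univ.filter (fun y => p.tc o y = b)).card + 2 * p.dl := by
  have h := p.hcls o (!b)
  have h2 := Finset.card_filter_add_card_filter_not (s := (Finset.univ : Finset V)) (fun y => p.tc o y = b)
  have h3 : (Finset.univ.filter (fun y => ¬ p.tc o y = b)).card ≤ (Finset.univ.filter (fun y => p.tc o y = (!b))).card := by
    apply Finset.card_le_card
    intro y hy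
    simp only [Finset.mem_filter, Finset.mem_univ, true_and] at hy ⊢
    cases h1 : p.tc o y <;> cases b <;> simp_all
  rw [Finset.card_univ] at h2
  omega

lemma Db_le : p.Db ≤ p.D := by have := p.h5; omega
lemma Sb_le : p.Sb ≤ p.Db := by have := p.h2; omega

lemma br_miss (o : Bool) (z : V) (hz : z ∈ p.Br) (b : Bool) (h : ¬ p.Al0 o z (!b)) :
    (Finset.univ.filter (fun y => p.tc o y = b ∧ ¬ Rl A o z y)).card ≤ p.dl + p.Db := by
  rw [Al0, if_pos hz] at h
  have h1 := p.dg_add o z b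
  have h2 := p.dg_miss o z b
  have h3 := p.hcls o b
  omega

lemma Al0_nonempty (o : Bool) (v : V) : ∃ b, p.Al0 o v b := by
  by_contra h
  push Not at h
  have e1 := h true
  have e2 := h false
  have e3 := p.dg_add o v true
  have := p.Db_le
  have := p.h4
  unfold Al0 at e1 e2
  simp only [Bool.not_true] at e3
  split_ifs at e1 e2
  · omega
  · omega
  · cases h' : p.tc (!o) v <;> simp_all

lemma nonGood : (Finset.univ.filter (fun y => ¬ p.Good y)).card ≤ 8 * k * p.dl + 16 * k * p.Db := by
  have hsub : Finset.univ.filter (fun y => ¬ p.Good y) ⊆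
      ((Finset.univ : Finset (Bool × Bool)) ×ˢ p.Br).biUnion (fun q =>
        (Finset.univ.filter (fun y => ¬ p.Al0 q.1.1 q.2 (!q.1.2) ∧ p.tc q.1.1 y = q.1.2 ∧ ¬ Rl A q.1.1 q.2 y)) ∪
        (Finset.univ.filter (fun y => ¬ p.Al0 q.1.1 q.2 q.1.2 ∧ p.tc q.1.1 y = q.1.2 ∧ Rl A q.1.1 q.2 y))) := by
    intro y hy
    rw [Finset.mem_filter] at hy
    have hy := hy.2
    unfold Good at hy
    push Not at hy
    obtain ⟨o, z, hz, h⟩ := hy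
    refine Finset.mem_biUnion.mpr ⟨((o, p.tc o y), z), Finset.mem_product.mpr ⟨Finset.mem_univ _, hz⟩, ?_⟩
    by_cases h1 : ¬ p.Al0 o z (!(p.tc o y)) → Rl A o z y
    · have := h h1
      exact Finset.mem_union_right _ (Finset.mem_filter.mpr ⟨Finset.mem_univ _, this.1, rfl, this.2⟩)
    · push Not at h1
      exact Finset.mem_union_left _ (Finset.mem_filter.mpr ⟨Finset.mem_univ _, h1.1, rfl, h1.2⟩)
  refine (Finset.card_le_card hsub).trans ?_
  refine (Finset.card_biUnion_le_card_mul _ _ (p.dl + 2 * p.Db) ?_).trans ?_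
  · rintro ⟨⟨o, b⟩, z⟩ hq
    have hz := (Finset.mem_product.mp hq).2
    simp only at hz ⊢
    refine (Finset.card_union_le _ _).trans ?_
    have e1 : (Finset.univ.filter (fun y => ¬ p.Al0 o z (!b) ∧ p.tc o y = b ∧ ¬ Rl A o z y)).card ≤ p.dl + p.Db := by
      by_cases h : p.Al0 o z (!b)
      · rw [Finset.filter_false_of_mem (fun y _ hh => hh.1 h)]; simp
      · refine le_trans (Finset.card_le_card ?_) (p.br_miss o z hz b h)
        intro y hy
        simp only [Finset.mem_filter, Finset.mem_univ, true_and] at hy ⊢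
        exact hy.2
    have e2 : (Finset.univ.filter (fun y => ¬ p.Al0 o z b ∧ p.tc o y = b ∧ Rl A o z y)).card ≤ p.Db := by
      by_cases h : p.Al0 o z b
      · rw [Finset.filter_false_of_mem (fun y _ hh => hh.1 h)]; simp
      · have h' := h
        rw [Al0, if_pos hz] at h'
        refine le_trans (Finset.card_le_card ?_) (le_of_not_ge h')
        intro y hy
        simp only [Finset.mem_filter, Finset.mem_univ, true_and] at hy ⊢
        exact ⟨hy.2.2, hy.2.1⟩
    omega
  · rw [Finset.card_product]
    have : (Finset.univ : Finset (Bool × Bool)).card = 4 := rfl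
    rw [this]
    have := Nat.mul_le_mul_right (p.dl + 2 * p.Db) (Nat.mul_le_mul_left 4 p.hBrc)
    refine this.trans (le_of_eq ?_)
    ring

lemma P_card (o b : Bool) : 2 * (p.P o b).card ≤ Fintype.card V + 2 * p.dl + 2 * p.Bad.card + 4 * k := by
  have hsub : p.P o b ⊆ (Finset.univ.filter (fun y => p.tc (!o) y = b)) ∪ p.Bad ∪ p.Br := by
    intro v hv
    rw [P, Finset.mem_filter] at hv
    have hv := hv.2
    unfold Al0 at hv
    simp only [Finset.mem_union, Finset.mem_filter, Finset.mem_univ, true_and]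
    split_ifs at hv with h1 h2
    · exact Or.inr h1
    · exact Or.inl (Or.inr h2)
    · left; left
      cases h : p.tc (!o) v <;> cases b <;> simp_all
  have e1 := Finset.card_le_card hsub
  have e2 := Finset.card_union_le (Finset.univ.filter (fun y => p.tc (!o) y = b) ∪ p.Bad) p.Br
  have e3 := Finset.card_union_le (Finset.univ.filter (fun y => p.tc (!o) y = b)) p.Bad
  have e4 := p.hcls (!o) b
  have e5 := p.hBrc
  omega

lemma r_le (o b : Bool) : p.r o b ≤ p.dl + p.Bad.card + 3 * k + 2 := by
  have := p.P_card o b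
  have := p.hω
  unfold r
  omega

lemma Low_deg (c : Bool × Bool) (u : V) (hu : u ∈ p.Low c.1 c.2) :
    ((p.Cand c.1 c.2).filter (fun y => Rl A c.1 u y)).card ≤ p.D := by
  rw [Low, Finset.mem_filter] at hu
  refine le_trans (Finset.card_le_card ?_) (le_of_not_ge hu.2.2)
  intro y hy
  rw [Finset.mem_filter, Cand, Finset.mem_filter] at hy
  simp only [Finset.mem_filter, Finset.mem_univ, true_and]
  exact ⟨hy.2, hy.1.2.1⟩

lemma Rl_flip (o : Bool) (u y : V) : Rl A (!o) y u ↔ Rl A o u y := by cases o <;> simp [Rl]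
lemma Rl_irr (q : Pre A s t) (o : Bool) (u y : V) (h : Rl A o u y) : u ≠ y := by
  rintro rfl
  cases o <;> simp [Rl] at h <;> exact q.hloop _ h

lemma Cand_deg (c : Bool × Bool) (y : V) (hy : y ∈ p.Cand c.1 c.2) :
    p.r c.1 c.2 - (p.Hi c.1 c.2).card ≤ ((p.Low c.1 c.2).filter (fun u => Rl A c.1 u y)).card := by
  obtain ⟨o, b⟩ := c
  simp only at hy ⊢
  rw [Cand, Finset.mem_filter] at hy
  obtain ⟨-, h1, h2, h3, h4, h5, h6⟩ := hy
  have hd := p.hdeg (!o) y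
  simp only [Rl_flip] at hd
  have hsub : Finset.univ.filter (fun u => Rl A o u y) ⊆
      ((p.Low o b).filter (fun u => Rl A o u y) ∪ p.Hi o b) ∪ ((Finset.univ \ p.P o b).filter (fun u => Rl A o u y)) := by
    intro u hu
    rw [Finset.mem_filter] at hu
    by_cases hP : u ∈ p.P o b
    · have hBr : u ∉ p.Br := by
        intro hb
        have h9 := (h2 o u hb).2
        rw [h1] at h9
        rw [P, Finset.mem_filter] at hP
        exact h9 hP.2 hu.2
      refine Finset.mem_union_left _ ?_
      by_cases hh : p.D ≤ p.dg o u (!b)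
      · exact Finset.mem_union_right _ (Finset.mem_filter.mpr ⟨hP, hBr, hh⟩)
      · exact Finset.mem_union_left _ (Finset.mem_filter.mpr ⟨Finset.mem_filter.mpr ⟨hP, hBr, hh⟩, hu.2⟩)
    · exact Finset.mem_union_right _ (Finset.mem_filter.mpr ⟨Finset.mem_sdiff.mpr ⟨Finset.mem_univ _, hP⟩, hu.2⟩)
  have e1 := Finset.card_le_card hsub
  have e2 := Finset.card_union_le ((p.Low o b).filter (fun u => Rl A o u y) ∪ p.Hi o b) ((Finset.univ \ p.P o b).filter (fun u => Rl A o u y))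
  have e3 := Finset.card_union_le ((p.Low o b).filter (fun u => Rl A o u y)) (p.Hi o b)
  have e5 : (Finset.univ \ p.P o b).card + (p.P o b).card = Fintype.card V := by
    rw [← Finset.card_univ]; exact Finset.card_sdiff_add_card_eq_card (Finset.subset_univ _)
  have e4 : ((Finset.univ \ p.P o b).filter (fun u => Rl A o u y)).card + p.ω ≤ (Finset.univ \ p.P o b).card := by
    by_cases hw : p.ω = 1
    · have hy' : y ∈ Finset.univ \ p.P o b := by
        refine Finset.mem_sdiff.mpr ⟨Finset.mem_univ _, fun hP => ?_⟩
        rw [P, Finset.mem_filter] at hP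
        apply hP.2
        rw [Al0, if_neg h3, if_neg h4, ← h1]
        have := p.hRa hw y h5
        cases o
        · exact this.symm
        · exact this
      rw [hw]
      have : ((Finset.univ \ p.P o b).filter (fun u => Rl A o u y)).card < (Finset.univ \ p.P o b).card :=
        Finset.card_lt_card (Finset.ssubset_iff_subset_ne.mpr ⟨Finset.filter_subset _ _, fun h => by
          rw [← h, Finset.mem_filter] at hy'
          exact Rl_irr p o y y hy'.2 rfl⟩)
      omega
    · have : p.ω = 0 := by have := p.hω; omega
      rw [this]
      exact Finset.card_filter_le _ _
  unfold r
  omega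
end Pre

set_option linter.unusedSectionVars false

namespace Pre
variable {V : Type} [Fintype V] {A : V → V → Prop} {k : ℕ} {s t : Fin k → V} (p : Pre A s t)

/-- all relaxed vertices of the first kind -/
noncomputable def HA : Finset V := (Finset.univ : Finset (Bool × Bool)).biUnion (fun c => p.Hf c.1 c.2)

lemma HA_mem (o b : Bool) (v : V) (h : v ∈ p.Hf o b) : v ∈ p.HA :=
  Finset.mem_biUnion.mpr ⟨(o, b), Finset.mem_univ _, h⟩

lemma HA_card : p.HA.card ≤ ∑ c : Bool × Bool, min (p.r c.1 c.2) (p.Hi c.1 c.2).card := by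
  refine Finset.card_biUnion_le.trans (le_of_eq ?_)
  exact Finset.sum_congr rfl fun c _ => p.Hf_card c.1 c.2

lemma r_sum : ∑ c : Bool × Bool, p.r c.1 c.2 ≤ 4 * (p.dl + p.Bad.card + 3 * k + 2) := by
  refine (Finset.sum_le_card_nsmul _ _ _ (fun c _ => p.r_le c.1 c.2)).trans (le_of_eq ?_)
  rfl

lemma min_sum : ∑ c : Bool × Bool, min (p.r c.1 c.2) (p.Hi c.1 c.2).card +
    ∑ c : Bool × Bool, (p.r c.1 c.2 - (p.Hi c.1 c.2).card) = ∑ c : Bool × Bool, p.r c.1 c.2 := by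
  rw [← Finset.sum_add_distrib]
  exact Finset.sum_congr rfl fun c _ => by omega

lemma Cand_card (c : Bool × Bool) : 8 * (p.r c.1 c.2 - (p.Hi c.1 c.2).card) + 8 * p.D < (p.Cand c.1 c.2).card := by
  obtain ⟨o, b⟩ := c
  simp only
  have hsub : Finset.univ.filter (fun y => p.tc o y = (!b)) ⊆
      p.Cand o b ∪ (Finset.univ.filter (fun y => ¬ p.Good y) ∪ (p.Br ∪ (p.Bad ∪ (p.Ra ∪ p.HA)))) := by
    intro y hy
    by_contra h
    simp only [Finset.mem_union, not_or, Finset.mem_filter, Finset.mem_univ, true_and, not_not] at h hy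
    apply h.1
    exact Finset.mem_filter.mpr ⟨Finset.mem_univ _, hy, h.2.1, h.2.2.1, h.2.2.2.1, h.2.2.2.2.1,
      fun o' b' h' => h.2.2.2.2.2 (p.HA_mem o' b' y h')⟩
  have e1 := Finset.card_le_card hsub
  have e2 := Finset.card_union_le (p.Cand o b) (Finset.univ.filter (fun y => ¬ p.Good y) ∪ (p.Br ∪ (p.Bad ∪ (p.Ra ∪ p.HA))))
  have e3 := Finset.card_union_le (Finset.univ.filter (fun y => ¬ p.Good y)) (p.Br ∪ (p.Bad ∪ (p.Ra ∪ p.HA)))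
  have e4 := Finset.card_union_le p.Br (p.Bad ∪ (p.Ra ∪ p.HA))
  have e5 := Finset.card_union_le p.Bad (p.Ra ∪ p.HA)
  have e6 := Finset.card_union_le p.Ra p.HA
  have e7 := p.HA_card
  have e8 := p.min_sum
  have e9 := p.r_sum
  have e10 := p.nonGood
  have e11 := p.cls_low o (!b)
  have e12 := p.r_le o b
  have := p.h1
  have := p.h2
  have := p.h3
  have := p.h4
  have := p.h5
  have := p.hBrc
  omega

lemma exists_M : ∃ M : Finset ((Bool × Bool) × V × V),
    (∀ q ∈ M, q.2.1 ∈ p.Low q.1.1 q.1.2 ∧ q.2.2 ∈ p.Cand q.1.1 q.1.2 ∧ Rl A q.1.1 q.2.1 q.2.2) ∧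
    (∀ q ∈ M, ∀ q' ∈ M, q.2.1 = q'.2.1 → q = q') ∧ (∀ q ∈ M, ∀ q' ∈ M, q.2.2 = q'.2.2 → q = q') ∧
    (∀ q ∈ M, ∀ q' ∈ M, q.2.1 ≠ q'.2.2) ∧
    ∀ c, (M.filter (fun q => q.1 = c)).card = p.r c.1 c.2 - (p.Hi c.1 c.2).card := by
  have := matching4 (C := Bool × Bool) (V := V) (by simp) (fun c => p.Low c.1 c.2) (fun c => p.Cand c.1 c.2)
    (fun c u y => Rl A c.1 u y) p.D (fun c u y h => Rl_irr p c.1 u y h) (fun c u hu => p.Low_deg c u hu)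
    _ (fun c => p.r c.1 c.2 - (p.Hi c.1 c.2).card) rfl (fun c _ => p.Cand_card c) (fun c y hy => p.Cand_deg c y hy)
  obtain ⟨M, h1, h2, h3, h4, h5⟩ := this
  refine ⟨M, h1, h2, h3, h4, fun c => ?_⟩
  rw [← h5 c]
  congr

/-- the matching -/
noncomputable def M : Finset ((Bool × Bool) × V × V) := p.exists_M.choose
lemma M_mem : ∀ q ∈ p.M, q.2.1 ∈ p.Low q.1.1 q.1.2 ∧ q.2.2 ∈ p.Cand q.1.1 q.1.2 ∧ Rl A q.1.1 q.2.1 q.2.2 :=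
  p.exists_M.choose_spec.1
lemma M_inj1 : ∀ q ∈ p.M, ∀ q' ∈ p.M, q.2.1 = q'.2.1 → q = q' := p.exists_M.choose_spec.2.1
lemma M_inj2 : ∀ q ∈ p.M, ∀ q' ∈ p.M, q.2.2 = q'.2.2 → q = q' := p.exists_M.choose_spec.2.2.1
lemma M_disj : ∀ q ∈ p.M, ∀ q' ∈ p.M, q.2.1 ≠ q'.2.2 := p.exists_M.choose_spec.2.2.2.1
lemma M_card : ∀ c, (p.M.filter (fun q => q.1 = c)).card = p.r c.1 c.2 - (p.Hi c.1 c.2).card :=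
  p.exists_M.choose_spec.2.2.2.2

lemma M_total : p.M.card = ∑ c : Bool × Bool, (p.r c.1 c.2 - (p.Hi c.1 c.2).card) := by
  rw [Finset.card_eq_sum_card_fiberwise (f := fun q => q.1) (t := Finset.univ) (fun _ _ => Finset.mem_univ _)]
  exact Finset.sum_congr rfl fun c _ => p.M_card c

/-- final allowed classes -/
def Al (o : Bool) (v : V) (b : Bool) : Prop :=
  p.Al0 o v b ∨ v ∈ p.Hf o (!b) ∨ ∃ y, ((o, !b), v, y) ∈ p.M

/-- special vertices -/
noncomputable def Sp : Finset V := (p.Bad ∪ (p.Ra ∪ (p.HA ∪ p.M.image (fun q => q.2.1)))) \ p.Br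

/-- free vertices -/
noncomputable def F : Finset V := Finset.univ.filter (fun v => v ∉ p.Br ∧ v ∉ p.Sp)

lemma pre_card : p.Bad.card + p.Ra.card + p.HA.card + p.M.card ≤ p.Sb := by
  have e7 := p.HA_card
  have e8 := p.min_sum
  have e9 := p.r_sum
  have := p.h1
  rw [p.M_total]
  omega

lemma Sp_card : p.Sp.card ≤ p.Sb := by
  refine (Finset.card_le_card Finset.sdiff_subset).trans ?_
  refine (Finset.card_union_le _ _).trans ?_
  refine (Nat.add_le_add_left ((Finset.card_union_le _ _).trans (Nat.add_le_add_left ((Finset.card_union_le _ _).trans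
    (Nat.add_le_add_left Finset.card_image_le _)) _)) _).trans ?_
  have := p.pre_card
  omega

lemma F_mem (v : V) : v ∈ p.F ↔ v ∉ p.Br ∧ v ∉ p.Bad ∧ v ∉ p.Ra ∧ v ∉ p.HA ∧ ∀ q ∈ p.M, q.2.1 ≠ v := by
  rw [F, Finset.mem_filter, Sp]
  simp only [Finset.mem_univ, true_and, Finset.mem_sdiff, Finset.mem_union, Finset.mem_image]
  constructor
  · rintro ⟨h1, h2⟩
    refine ⟨h1, ?_, ?_, ?_, ?_⟩
    · intro h; exact h2 ⟨Or.inl h, h1⟩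
    · intro h; exact h2 ⟨Or.inr (Or.inl h), h1⟩
    · intro h; exact h2 ⟨Or.inr (Or.inr (Or.inl h)), h1⟩
    · intro q hq h; exact h2 ⟨Or.inr (Or.inr (Or.inr ⟨q, hq, h⟩)), h1⟩
  · rintro ⟨h1, h2, h3, h4, h5⟩
    refine ⟨h1, ?_⟩
    rintro ⟨h | h | h | ⟨q, hq, h⟩, -⟩
    · exact h2 h
    · exact h3 h
    · exact h4 h
    · exact h5 q hq h

lemma Al_F (o : Bool) (v : V) (hv : v ∈ p.F) (b : Bool) : p.Al o v b ↔ b = p.tc (!o) v := by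
  rw [F_mem] at hv
  obtain ⟨h1, h2, h3, h4, h5⟩ := hv
  rw [Al, Al0, if_neg h1, if_neg h2]
  constructor
  · rintro (h | h | ⟨y, h⟩)
    · exact h
    · exact absurd (p.HA_mem _ _ _ h) h4
    · exact absurd rfl (h5 _ h)
  · exact Or.inl

lemma ineq (o b : Bool) : 2 * (Finset.univ.filter (fun v => ¬ p.Al o v (!b))).card + 2 * k + 2 * p.ω ≤ Fintype.card V := by
  set Q := Finset.univ.filter (fun v => ¬ p.Al o v (!b)) with hQ
  set U := (p.M.filter (fun q => q.1 = (o, b))).image (fun q => q.2.1) with hU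
  have hUL : U ⊆ p.Low o b := by
    intro v hv
    obtain ⟨q, hq, rfl⟩ := Finset.mem_image.mp hv
    rw [Finset.mem_filter] at hq
    have := (p.M_mem q hq.1).1
    rw [hq.2] at this
    exact this
  have hUc : U.card = p.r o b - (p.Hi o b).card := by
    have h0 := p.M_card (o, b)
    simp only at h0
    rw [← h0]
    exact Finset.card_image_of_injOn (fun q hq q' hq' h => p.M_inj1 q (Finset.mem_filter.mp hq).1 q' (Finset.mem_filter.mp hq').1 h)
  have hdis : Disjoint (p.Hf o b) U := by
    rw [Finset.disjoint_left]
    intro v h1 h2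
    have h1 := p.Hf_sub o b h1
    have h2 := hUL h2
    rw [Hi, Finset.mem_filter] at h1
    rw [Low, Finset.mem_filter] at h2
    exact h2.2.2 h1.2.2
  have hdis2 : Disjoint Q (p.Hf o b ∪ U) := by
    rw [Finset.disjoint_left]
    intro v h1 h2
    rw [hQ, Finset.mem_filter] at h1
    apply h1.2
    rcases Finset.mem_union.mp h2 with h | h
    · right; left; rw [Bool.not_not]; exact h
    · right; right
      obtain ⟨⟨c, u, y⟩, hq, rfl⟩ := Finset.mem_image.mp h
      rw [Finset.mem_filter] at hq
      have h9 := hq.2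
      simp only at h9
      subst h9
      rw [Bool.not_not]
      exact ⟨y, hq.1⟩
  have hsub : Q ∪ (p.Hf o b ∪ U) ⊆ p.P o b := by
    refine Finset.union_subset ?_ (Finset.union_subset ?_ ?_)
    · intro v hv
      rw [hQ, Finset.mem_filter] at hv
      exact Finset.mem_filter.mpr ⟨Finset.mem_univ _, fun h => hv.2 (Or.inl h)⟩
    · exact (p.Hf_sub o b).trans (Finset.filter_subset _ _)
    · exact hUL.trans (Finset.filter_subset _ _)
  have e1 := Finset.card_le_card hsub
  rw [Finset.card_union_of_disjoint hdis2, Finset.card_union_of_disjoint hdis, p.Hf_card, hUc] at e1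
  have e2 : (p.P o b).card + k + p.ω - Fintype.card V / 2 = p.r o b := rfl
  omega

/-- the side, vertex and class of a request -/
def key (s t : Fin k → V) : Req V k → Bool × V × Bool
  | .o v b => (true, v, b)
  | .i v b => (false, v, b)
  | .t j b => (true, s j, b)
  | .h j b => (false, t j, b)

/-- dedicated partner -/
def ded (r : Req V k) (y : V) : Prop := (((key s t r).1, !(key s t r).2.2), (key s t r).2.1, y) ∈ p.M

/-- candidates for a request -/
noncomputable def RC (r : Req V k) : Finset V :=
  Finset.univ.filter (fun y => y ∈ p.F ∧ (∀ q ∈ p.M, q.2.2 ≠ y) ∧ p.tc (key s t r).1 y = (key s t r).2.2 ∧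
    Rl A (key s t r).1 (key s t r).2.1 y ∧ ((key s t r).2.1 ∈ p.Br ∨ p.Good y))

/-- all valid requests -/
abbrev OK (r : Req V k) : Prop := ReqOK p.Sp (p.Al false) (p.Al true) s t r

lemma OK_key (r : Req V k) (h : p.OK r) : p.Al (key s t r).1 (key s t r).2.1 (key s t r).2.2 ∧
    ((key s t r).2.1 ∈ p.Sp ∨ (key s t r).2.1 ∈ p.Br) := by
  cases r with
  | o v b => exact ⟨h.2, Or.inl h.1⟩
  | i v b => exact ⟨h.2, Or.inl h.1⟩
  | t j b => exact ⟨h, Or.inr ((p.hBr _).mpr ⟨j, Or.inl rfl⟩)⟩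
  | h j b => exact ⟨h, Or.inr ((p.hBr _).mpr ⟨j, Or.inr rfl⟩)⟩

/-- finset containing all valid requests -/
noncomputable def RQ : Finset (Req V k) :=
  ((p.Sp ×ˢ (Finset.univ : Finset Bool)).image (fun q => Req.o q.1 q.2) ∪
   (p.Sp ×ˢ (Finset.univ : Finset Bool)).image (fun q => Req.i q.1 q.2)) ∪
  (((Finset.univ : Finset (Fin k)) ×ˢ (Finset.univ : Finset Bool)).image (fun q => Req.t q.1 q.2) ∪
   ((Finset.univ : Finset (Fin k)) ×ˢ (Finset.univ : Finset Bool)).image (fun q => Req.h q.1 q.2))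

lemma RQ_card : p.RQ.card ≤ 4 * p.Sb + 4 * k := by
  have e := p.Sp_card
  refine (Finset.card_union_le _ _).trans ?_
  refine (Nat.add_le_add (Finset.card_union_le _ _) (Finset.card_union_le _ _)).trans ?_
  refine (Nat.add_le_add (Nat.add_le_add Finset.card_image_le Finset.card_image_le)
    (Nat.add_le_add Finset.card_image_le Finset.card_image_le)).trans ?_
  simp only [Finset.card_product, Finset.card_univ, Fintype.card_bool, Fintype.card_fin]
  omega

lemma RQ_mem (r : Req V k) (h : p.OK r) : r ∈ p.RQ := by
  simp only [RQ, Finset.mem_union, Finset.mem_image, Finset.mem_product, Finset.mem_univ, and_true, true_and]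
  cases r with
  | o v b => exact Or.inl (Or.inl ⟨(v, b), h.1, rfl⟩)
  | i v b => exact Or.inl (Or.inr ⟨(v, b), h.1, rfl⟩)
  | t j b => exact Or.inr (Or.inl ⟨(j, b), rfl⟩)
  | h j b => exact Or.inr (Or.inr ⟨(j, b), rfl⟩)

lemma dg_big (o : Bool) (v : V) (b : Bool) (hv : v ∉ p.Br) (h : p.Al o v b) (hM : ¬ ∃ y, ((o, !b), v, y) ∈ p.M) :
    p.D ≤ p.dg o v b := by
  rcases h with h | h | h
  · rw [Al0, if_neg hv] at h
    split_ifs at h with h2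
    · exact h
    · have e1 := p.hbad o v h2
      rw [← h] at e1
      have e2 := p.dg_miss o v b
      have e3 := p.cls_low o b
      have := p.h4
      have := p.h5
      omega
  · have h := p.Hf_sub _ _ h
    rw [Hi, Finset.mem_filter, Bool.not_not] at h
    exact h.2.2
  · exact absurd h hM

lemma RC_card (r : Req V k) (h : p.OK r) (hd : ¬ ∃ y, p.ded r y) : p.RQ.card ≤ (p.RC r).card := by
  obtain ⟨h1, h2⟩ := p.OK_key r h
  unfold ded at hd
  unfold RC
  generalize (key s t r).1 = o at *
  generalize (key s t r).2.1 = v at *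
  generalize (key s t r).2.2 = b at *
  have e0 := p.RQ_card
  have e1 := p.Sp_card
  have eB := p.hBrc
  have eM : (p.M.image (fun q => q.2.2)).card ≤ p.Sb := Finset.card_image_le.trans (by have := p.pre_card; omega)
  have := p.h1
  have := p.h2
  have := p.h3
  by_cases hv : v ∈ p.Br
  · have hA : p.Db ≤ p.dg o v b := by
      rcases h1 with h | h | ⟨y, h⟩
      · rw [Al0, if_pos hv] at h; exact h
      · have h := p.Hf_sub _ _ h
        rw [Hi, Finset.mem_filter] at h
        exact absurd hv h.2.1
      · have h := (p.M_mem _ h).1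
        rw [Low, Finset.mem_filter] at h
        exact absurd hv h.2.1
    have hsub : Finset.univ.filter (fun y => Rl A o v y ∧ p.tc o y = b) ⊆
      Finset.univ.filter (fun y => y ∈ p.F ∧ (∀ q ∈ p.M, q.2.2 ≠ y) ∧ p.tc o y = b ∧ Rl A o v y ∧ (v ∈ p.Br ∨ p.Good y))
        ∪ (p.Br ∪ (p.Sp ∪ p.M.image (fun q => q.2.2))) := by
      intro y hy
      by_contra hn
      rw [Finset.mem_union, not_or, Finset.mem_union, not_or, Finset.mem_union, not_or, Finset.mem_image] at hn
      rw [Finset.mem_filter] at hy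
      apply hn.1
      refine Finset.mem_filter.mpr ⟨Finset.mem_univ _, Finset.mem_filter.mpr ⟨Finset.mem_univ _, hn.2.1, hn.2.2.1⟩, ?_, hy.2.2, hy.2.1, Or.inl hv⟩
      intro q hq h
      exact hn.2.2.2 ⟨q, hq, h⟩
    have f1 := Finset.card_le_card hsub
    have f2 := Finset.card_union_le (Finset.univ.filter (fun y => y ∈ p.F ∧ (∀ q ∈ p.M, q.2.2 ≠ y) ∧ p.tc o y = b ∧ Rl A o v y ∧ (v ∈ p.Br ∨ p.Good y))) (p.Br ∪ (p.Sp ∪ p.M.image (fun q => q.2.2)))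
    have f3 := Finset.card_union_le p.Br (p.Sp ∪ p.M.image (fun q => q.2.2))
    have f4 := Finset.card_union_le p.Sp (p.M.image (fun q => q.2.2))
    have f5 : p.Db ≤ (Finset.univ.filter (fun y => Rl A o v y ∧ p.tc o y = b)).card := hA
    omega
  · have hA := p.dg_big o v b hv h1 hd
    have hsub : Finset.univ.filter (fun y => Rl A o v y ∧ p.tc o y = b) ⊆
      Finset.univ.filter (fun y => y ∈ p.F ∧ (∀ q ∈ p.M, q.2.2 ≠ y) ∧ p.tc o y = b ∧ Rl A o v y ∧ (v ∈ p.Br ∨ p.Good y))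
        ∪ (Finset.univ.filter (fun y => ¬ p.Good y) ∪ (p.Br ∪ (p.Sp ∪ p.M.image (fun q => q.2.2)))) := by
      intro y hy
      by_contra hn
      rw [Finset.mem_union, not_or, Finset.mem_union, not_or, Finset.mem_union, not_or, Finset.mem_union, not_or, Finset.mem_image] at hn
      rw [Finset.mem_filter] at hy
      apply hn.1
      have hg : p.Good y := by
        by_contra hg
        exact hn.2.1 (Finset.mem_filter.mpr ⟨Finset.mem_univ _, hg⟩)
      refine Finset.mem_filter.mpr ⟨Finset.mem_univ _, Finset.mem_filter.mpr ⟨Finset.mem_univ _, hn.2.2.1, hn.2.2.2.1⟩, ?_, hy.2.2, hy.2.1, Or.inr hg⟩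
      intro q hq h
      exact hn.2.2.2.2 ⟨q, hq, h⟩
    have f1 := Finset.card_le_card hsub
    have f2 := Finset.card_union_le (Finset.univ.filter (fun y => y ∈ p.F ∧ (∀ q ∈ p.M, q.2.2 ≠ y) ∧ p.tc o y = b ∧ Rl A o v y ∧ (v ∈ p.Br ∨ p.Good y))) (Finset.univ.filter (fun y => ¬ p.Good y) ∪ (p.Br ∪ (p.Sp ∪ p.M.image (fun q => q.2.2))))
    have f0 := Finset.card_union_le (Finset.univ.filter (fun y => ¬ p.Good y)) (p.Br ∪ (p.Sp ∪ p.M.image (fun q => q.2.2)))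
    have f3 := Finset.card_union_le p.Br (p.Sp ∪ p.M.image (fun q => q.2.2))
    have f4 := Finset.card_union_le p.Sp (p.M.image (fun q => q.2.2))
    have f5 : p.D ≤ (Finset.univ.filter (fun y => Rl A o v y ∧ p.tc o y = b)).card := hA
    have f6 := p.nonGood
    omega

/-- property of an assigned representative -/
def RP (r : Req V k) (y : V) : Prop := y ∈ p.F ∧ p.tc (key s t r).1 y = (key s t r).2.2 ∧
    Rl A (key s t r).1 (key s t r).2.1 y ∧ ((key s t r).2.1 ∈ p.Br ∨ p.Good y)

lemma ded_RP (r : Req V k) (y : V) (h : p.ded r y) : p.RP r y ∧ (key s t r).2.1 ∉ p.Br := by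
  unfold ded at h
  obtain ⟨h1, h2, h3⟩ := p.M_mem _ h
  rw [Cand, Finset.mem_filter] at h2
  rw [Low, Finset.mem_filter] at h1
  obtain ⟨-, g1, g2, g3, g4, g5, g6⟩ := h2
  refine ⟨⟨(p.F_mem _).mpr ⟨g3, g4, g5, ?_, ?_⟩, ?_, h3, Or.inr g2⟩, h1.2.1⟩
  · intro hh
    obtain ⟨c, -, hc⟩ := Finset.mem_biUnion.mp hh
    exact g6 _ _ hc
  · intro q hq
    exact p.M_disj q hq _ h
  · rw [Bool.not_not] at g1; exact g1

lemma key_inj (r r' : Req V k) (h : p.OK r) (h' : p.OK r') (hb : (key s t r).2.1 ∉ p.Br)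
    (he : key s t r = key s t r') : r = r' := by
  have hs : ∀ j, s j ∈ p.Br := fun j => (p.hBr _).mpr ⟨j, Or.inl rfl⟩
  have ht : ∀ j, t j ∈ p.Br := fun j => (p.hBr _).mpr ⟨j, Or.inr rfl⟩
  have hb' := hb
  rw [he] at hb'
  cases r with
  | o v b =>
    cases r' with
    | o v' b' => simp only [key, Prod.mk.injEq] at he; rw [he.2.1, he.2.2]
    | i v' b' => simp [key] at he
    | t j b' => exact absurd (hs j) hb'
    | h j b' => exact absurd (ht j) hb'
  | i v b =>
    cases r' with
    | o v' b' => simp [key] at he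
    | i v' b' => simp only [key, Prod.mk.injEq] at he; rw [he.2.1, he.2.2]
    | t j b' => exact absurd (hs j) hb'
    | h j b' => exact absurd (ht j) hb'
  | t j b => exact absurd (hs j) hb
  | h j b => exact absurd (ht j) hb

lemma exists_res (v0 : V) : ∃ f : Req V k → V, (∀ r, p.OK r → p.RP r (f r)) ∧
    ∀ r r', p.OK r → p.OK r' → f r = f r' → r = r' := by
  obtain ⟨g, g1, g2⟩ := greedy (p.RQ.filter (fun r => p.OK r ∧ ¬ ∃ y, p.ded r y)) p.RC v0
    (fun r hr => (Finset.card_filter_le _ _).trans (p.RC_card r (Finset.mem_filter.mp hr).2.1 (Finset.mem_filter.mp hr).2.2))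
  have hg : ∀ r, p.OK r → (¬ ∃ y, p.ded r y) → r ∈ p.RQ.filter (fun r => p.OK r ∧ ¬ ∃ y, p.ded r y) :=
    fun r h1 h2 => Finset.mem_filter.mpr ⟨p.RQ_mem r h1, h1, h2⟩
  have hgc : ∀ r, p.OK r → (¬ ∃ y, p.ded r y) → p.RP r (g r) ∧ ∀ q ∈ p.M, q.2.2 ≠ g r := by
    intro r h1 h2
    have := g1 r (hg r h1 h2)
    rw [RC, Finset.mem_filter] at this
    exact ⟨⟨this.2.1, this.2.2.2⟩, this.2.2.1⟩
  refine ⟨fun r => if h : ∃ y, p.ded r y then h.choose else g r, ?_, ?_⟩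
  · intro r hr
    by_cases h : ∃ y, p.ded r y
    · simp only [dif_pos h]; exact (p.ded_RP r _ h.choose_spec).1
    · simp only [dif_neg h]; exact (hgc r hr h).1
  · intro r r' hr hr' he
    by_cases h : ∃ y, p.ded r y <;> by_cases h' : ∃ y, p.ded r' y
    · simp only [dif_pos h, dif_pos h'] at he
      have e1 := h.choose_spec
      have e2 := h'.choose_spec
      have e3 := p.M_inj2 _ e1 _ e2 he
      simp only [Prod.mk.injEq] at e3
      refine p.key_inj r r' hr hr' (p.ded_RP r _ e1).2 ?_
      have := e3.1.2
      rw [Bool.not_inj_iff] at this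
      exact Prod.ext e3.1.1 (Prod.ext e3.2.1 this)
    · simp only [dif_pos h, dif_neg h'] at he
      exact absurd he ((hgc r' hr' h').2 _ h.choose_spec)
    · simp only [dif_neg h, dif_pos h'] at he
      exact absurd he.symm ((hgc r hr h).2 _ h'.choose_spec)
    · simp only [dif_neg h, dif_neg h'] at he
      exact g2 r (hg r hr h) r' (hg r' hr' h') he

lemma mk_setup (v0 : V) : ∃ S : Setup A s t, S.ci = p.tc true ∧ S.co = p.tc false ∧ S.η = p.D ∧ S.ω = p.ω ∧
    S.Br = p.Br ∧ S.Sp.card ≤ p.Sb ∧ (∀ v ∈ S.F, v ∉ p.Ra) := by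
  obtain ⟨f, f1, f2⟩ := p.exists_res v0
  have hmm : ∀ o v b, (p.F.filter (fun q => p.tc o q = b ∧ ¬ Rl A o v q)).card ≤
      (Finset.univ.filter (fun q => p.tc o q = b ∧ ¬ Rl A o v q)).card :=
    fun o v b => Finset.card_le_card (Finset.filter_subset_filter _ (Finset.subset_univ _))
  have hs : ∀ j, s j ∈ p.Br := fun j => (p.hBr _).mpr ⟨j, Or.inl rfl⟩
  have ht : ∀ j, t j ∈ p.Br := fun j => (p.hBr _).mpr ⟨j, Or.inr rfl⟩
  have hSpBr : ∀ v ∈ p.Sp, v ∉ p.Br := fun v hv => (Finset.mem_sdiff.mp hv).2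
  refine ⟨{ ci := p.tc true, co := p.tc false, In := p.Al false, Out := p.Al true, F := p.F, Sp := p.Sp,
            Br := p.Br, η := p.D, ω := p.ω, res := f, hBr := p.hBr,
            hFBr := fun x hx => ((p.F_mem x).mp hx).1
            hSp := ?_
            hIne := fun v => (p.Al0_nonempty false v).imp fun b h => Or.inl h
            hOne := fun v => (p.Al0_nonempty true v).imp fun b h => Or.inl h
            hIF := fun v hv b => p.Al_F false v hv b
            hOF := fun v hv b => p.Al_F true v hv b
            hmO := ?_
            hmI := ?_
            ro := ?_, ri := ?_, rt := ?_, rh := ?_, rinj := f2, nfO := ?_, nfI := ?_, nfm := ?_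
            hineqO := fun b => p.ineq true b
            hineqI := fun b => p.ineq false b }, rfl, rfl, rfl, rfl, rfl, p.Sp_card, fun v hv => ((p.F_mem v).mp hv).2.2.1⟩
  · intro x
    rw [F, Finset.mem_filter]
    have := hSpBr x
    simp only [Finset.mem_univ, true_and]
    tauto
  · intro v hv
    have h := p.hbad true v ((p.F_mem v).mp hv).2.1
    exact (hmm true v _).trans h
  · intro v hv
    have h := p.hbad false v ((p.F_mem v).mp hv).2.1
    exact (hmm false v _).trans h
  · intro v hv b h
    have := f1 (.o v b) ⟨hv, h⟩
    exact ⟨this.1, this.2.1, this.2.2.1⟩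
  · intro v hv b h
    have := f1 (.i v b) ⟨hv, h⟩
    exact ⟨this.1, this.2.1, this.2.2.1⟩
  · intro j b h
    have := f1 (.t j b) h
    exact ⟨this.1, this.2.1, this.2.2.1⟩
  · intro j b h
    have := f1 (.h j b) h
    exact ⟨this.1, this.2.1, this.2.2.1⟩
  · intro v hv b h j hj
    have := (f1 (.i v b) ⟨hv, h⟩).2.2.2.resolve_left (hSpBr v hv)
    exact (this true (s j) (hs j)).1 (fun h' => hj (Or.inl h'))
  · intro v hv b h j hj
    have := (f1 (.o v b) ⟨hv, h⟩).2.2.2.resolve_left (hSpBr v hv)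
    exact (this false (t j) (ht j)).1 (fun h' => hj (Or.inl h'))
  · intro j b hj
    have := p.br_miss false (t j) (ht j) b (fun h' => hj (Or.inl h'))
    exact (hmm false (t j) b).trans (this.trans p.h5)
end Pre

set_option linter.unusedSectionVars false

section Fin
variable {V : Type} [Fintype V] {A : V → V → Prop} {k : ℕ} {s t : Fin k → V}

/-- number of vertices of a letter -/
noncomputable def cn (tc : Bool → V → Bool) (c : Bool × Bool) : ℕ :=
  (Finset.univ.filter (fun v => tc true v = c.1 ∧ tc false v = c.2)).card

lemma cn_total (tc : Bool → V → Bool) : Fintype.card V =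
    cn tc (true, true) + cn tc (true, false) + cn tc (false, true) + cn tc (false, false) := by
  have h1 := Finset.card_filter_add_card_filter_not (s := (Finset.univ : Finset V)) (fun y => tc true y = true)
  have h2 := Finset.card_filter_add_card_filter_not (s := Finset.univ.filter (fun y => tc true y = true)) (fun y => tc false y = true)
  have h3 := Finset.card_filter_add_card_filter_not (s := Finset.univ.filter (fun y => ¬ tc true y = true)) (fun y => tc false y = true)
  simp only [Finset.filter_filter, Finset.card_univ, Bool.not_eq_true] at h1 h2 h3
  unfold cn
  simp only
  omega

lemma cls_true (tc : Bool → V → Bool) (b : Bool) :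
    (Finset.univ.filter (fun y => tc true y = b)).card = cn tc (b, true) + cn tc (b, false) := by
  have h2 := Finset.card_filter_add_card_filter_not (s := Finset.univ.filter (fun y => tc true y = b)) (fun y => tc false y = true)
  simp only [Finset.filter_filter, Bool.not_eq_true] at h2
  unfold cn
  simp only
  omega

lemma cls_false (tc : Bool → V → Bool) (b : Bool) :
    (Finset.univ.filter (fun y => tc false y = b)).card = cn tc (true, b) + cn tc (false, b) := by
  have h2 := Finset.card_filter_add_card_filter_not (s := Finset.univ.filter (fun y => tc false y = b)) (fun y => tc true y = true)
  simp only [Finset.filter_filter, Bool.not_eq_true] at h2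
  unfold cn
  simp only
  simp only [and_comm] at h2 ⊢
  omega

/-- missing pairs -/
noncomputable def Mis (A : V → V → Prop) (tc : Bool → V → Bool) : Finset (V × V) :=
  Finset.univ.filter (fun q => tc false q.1 = tc true q.2 ∧ ¬ A q.1 q.2)

/-- missing pairs at a vertex -/
noncomputable def ms (A : V → V → Prop) (tc : Bool → V → Bool) (o : Bool) (v : V) : Finset V :=
  Finset.univ.filter (fun y => tc o y = tc (!o) v ∧ ¬ Rl A o v y)

lemma ms_sum (tc : Bool → V → Bool) (o : Bool) : ∑ v, (ms A tc o v).card = (Mis A tc).card := by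
  cases o
  · rw [Finset.card_eq_sum_card_fiberwise (f := fun q => q.2) (t := Finset.univ) (fun _ _ => Finset.mem_univ _)]
    refine Finset.sum_congr rfl fun v _ => ?_
    refine Finset.card_bij (fun y _ => (y, v)) ?_ ?_ ?_
    · intro y hy
      simpa [ms, Mis, Rl] using hy
    · intro y _ y' _ h
      exact (Prod.mk.inj h).1
    · rintro ⟨y, w⟩ hq
      simp only [Finset.mem_filter] at hq
      obtain ⟨h1, rfl⟩ := hq
      refine ⟨y, ?_, rfl⟩
      simpa [ms, Mis, Rl] using h1
  · rw [Finset.card_eq_sum_card_fiberwise (f := fun q => q.1) (t := Finset.univ) (fun _ _ => Finset.mem_univ _)]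
    refine Finset.sum_congr rfl fun v _ => ?_
    refine Finset.card_bij (fun y _ => (v, y)) ?_ ?_ ?_
    · intro y hy
      have : tc true y = tc false v ∧ ¬ A v y := by simpa [ms, Rl] using hy
      simp [Mis, this.1.symm, this.2]
    · intro y _ y' _ h
      exact (Prod.mk.inj h).2
    · rintro ⟨w, y⟩ hq
      simp only [Finset.mem_filter] at hq
      obtain ⟨h1, rfl⟩ := hq
      refine ⟨y, ?_, rfl⟩
      have : tc false w = tc true y ∧ ¬ A w y := by simpa [Mis] using h1
      simp [ms, Rl, this.1.symm, this.2]

/-- bad vertices -/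
noncomputable def BadS (A : V → V → Prop) (tc : Bool → V → Bool) (D : ℕ) : Finset V :=
  Finset.univ.filter (fun v => D < (ms A tc true v).card ∨ D < (ms A tc false v).card)

lemma BadS_card (tc : Bool → V → Bool) (u D : ℕ) (hu : u ≤ D) (hu0 : 0 < u) (h : 2 * (Mis A tc).card ≤ u * u) :
    (BadS A tc D).card ≤ u := by
  have e : (BadS A tc D).card * u ≤ ∑ v, ((ms A tc true v).card + (ms A tc false v).card) := by
    rw [← smul_eq_mul]
    refine le_trans (Finset.card_nsmul_le_sum _ (fun v => (ms A tc true v).card + (ms A tc false v).card) _ ?_)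
      (Finset.sum_le_sum_of_subset (Finset.subset_univ _))
    intro v hv
    rw [BadS, Finset.mem_filter] at hv
    rcases hv.2 with h | h <;> omega
  rw [Finset.sum_add_distrib, ms_sum, ms_sum] at e
  have : (BadS A tc D).card * u ≤ u * u := by omega
  exact Nat.le_of_mul_le_mul_right this hu0

/-- abstract input of the final step -/
structure Inp (A : V → V → Prop) {k : ℕ} (s t : Fin k → V) where
  tc : Bool → V → Bool
  u : ℕ
  M : ℕ
  Br : Finset V
  hBr : ∀ x, x ∈ Br ↔ ∃ i, x = s i ∨ x = t i
  hBrc : Br.card ≤ 2 * k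
  hloop : ∀ v, ¬ A v v
  hdeg : ∀ o v, Fintype.card V + 2 * k ≤ 2 * (Finset.univ.filter (fun y => Rl A o v y)).card
  hM : 1000 * (k + 1) ≤ M
  hu : M ≤ u
  hn : M * (M * (M * (M * (M * (M * (M * (M * u))))))) ≤ Fintype.card V
  hd1 : cn tc (true, true) ≤ cn tc (false, false) + u
  hd2 : cn tc (false, false) ≤ cn tc (true, true) + u
  hd3 : cn tc (true, false) ≤ cn tc (false, true) + u
  hd4 : cn tc (false, true) ≤ cn tc (true, false) + u
  hMis : 2 * (Mis A tc).card ≤ u * u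

variable (I : Inp A s t)

lemma Inp.cls (o b : Bool) : 2 * (Finset.univ.filter (fun y => I.tc o y = b)).card ≤ Fintype.card V + 2 * I.u := by
  have h0 := cn_total I.tc
  have := I.hd1; have := I.hd2; have := I.hd3; have := I.hd4
  cases o
  · rw [cls_false]; cases b <;> omega
  · rw [cls_true]; cases b <;> omega

lemma arith (M k Sb : ℕ) (hM : 1000 * (k + 1) ≤ M) : 1000 * (k * Sb) + 1000 * Sb ≤ M * Sb := by
  have := Nat.mul_le_mul_right Sb hM
  have e : 1000 * (k + 1) * Sb = 1000 * (k * Sb) + 1000 * Sb := by ring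
  omega

lemma Inp.toPre (Ra : Finset V) (ω Sb : ℕ) (hω : ω ≤ 1) (hRa : ω = 1 → ∀ v, v ∉ Ra → I.tc true v = I.tc false v)
    (h1 : Ra.card + 11 * I.u ≤ Sb) (h4 : 60 * (I.M * (I.M * Sb)) < Fintype.card V) :
    ∃ p : Pre A s t, p.tc = I.tc ∧ p.Ra = Ra ∧ p.ω = ω ∧ p.D = I.M * (I.M * Sb) ∧ p.Sb = Sb ∧ p.Br = I.Br := by
  have a1 := arith I.M k Sb I.hM
  have a2 := arith I.M k (I.M * Sb) I.hM
  have hM := I.hM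
  have hu := I.hu
  have hkS : k * I.u ≤ k * Sb := Nat.mul_le_mul_left _ (by omega)
  have hb : (BadS A I.tc (I.M * (I.M * Sb))).card ≤ I.u := BadS_card I.tc I.u _ (by omega) (by omega) I.hMis
  refine ⟨{ tc := I.tc, Bad := BadS A I.tc (I.M * (I.M * Sb)), Ra := Ra, Br := I.Br, ω := ω, D := I.M * (I.M * Sb),
            Db := I.M * Sb, dl := I.u, Sb := Sb, hloop := I.hloop, hBr := I.hBr, hBrc := I.hBrc, hdeg := I.hdeg,
            hcls := I.cls, hbad := ?_, hω := hω, hRa := hRa, h1 := ?_, h2 := ?_, h3 := ?_, h4 := h4, h5 := ?_ },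
            rfl, rfl, rfl, rfl, rfl, rfl⟩
  · intro o v hv
    rw [BadS, Finset.mem_filter, not_and, not_or] at hv
    have := hv (Finset.mem_univ _)
    cases o
    · exact le_of_not_gt this.2
    · exact le_of_not_gt this.1
  · omega
  · omega
  · rw [Nat.mul_assoc, Nat.mul_assoc]; omega
  · omega

lemma fc_ge (S : Setup A s t) (tc : Bool → V → Bool) (hci : S.ci = tc true) (hco : S.co = tc false) (c : Bool × Bool) :
    cn tc c ≤ S.fc c + S.Sp.card + S.Br.card ∧ S.fc c ≤ cn tc c := by
  unfold cn Setup.fc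
  rw [hci, hco]
  constructor
  · have : Finset.univ.filter (fun v => tc true v = c.1 ∧ tc false v = c.2) ⊆
      (S.F.filter (fun v => tc true v = c.1 ∧ tc false v = c.2) ∪ S.Sp) ∪ S.Br := by
      intro v hv
      rw [Finset.mem_filter] at hv
      by_cases h1 : v ∈ S.Br
      · exact Finset.mem_union_right _ h1
      · refine Finset.mem_union_left _ ?_
        by_cases h2 : v ∈ S.F
        · exact Finset.mem_union_left _ (Finset.mem_filter.mpr ⟨h2, hv.2⟩)
        · exact Finset.mem_union_right _ ((S.hSp v).mpr ⟨h2, h1⟩)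
    refine (Finset.card_le_card this).trans ((Finset.card_union_le _ _).trans ?_)
    exact Nat.add_le_add_right (Finset.card_union_le _ _) _
  · exact Finset.card_le_card (Finset.filter_subset_filter _ (Finset.subset_univ _))

lemma main_len (N : Fin k → ℕ) (i0 : Fin k) (n B : ℕ) (hN : ∀ j, 4 ≤ N j) (hmax : ∀ j, N j ≤ N i0)
    (hsum : ∑ j, (N j - 1) + B = n) :
    k * ∑ j ∈ Finset.univ.erase i0, (N j - 3) + n ≤ k * n ∧
      ∑ j ∈ Finset.univ.erase i0, N j ≤ ∑ j ∈ Finset.univ.erase i0, (N j - 3) + 3 * k := by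
  have hk : 0 < k := i0.pos
  have hc : (Finset.univ.erase i0).card + 1 = k := by
    rw [Finset.card_erase_of_mem (Finset.mem_univ _), Finset.card_univ, Fintype.card_fin]; omega
  have e1 : ∑ j ∈ Finset.univ.erase i0, (N j - 3) + (N i0 - 1) + B ≤ n := by
    rw [← hsum, ← Finset.sum_erase_add _ _ (Finset.mem_univ i0)]
    have : ∑ j ∈ Finset.univ.erase i0, (N j - 3) ≤ ∑ j ∈ Finset.univ.erase i0, (N j - 1) :=
      Finset.sum_le_sum fun j _ => by omega
    omega
  have e2 : ∑ j, (N j - 1) ≤ k * (N i0 - 1) := by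
    refine (Finset.sum_le_card_nsmul _ _ (N i0 - 1) (fun j _ => by have := hmax j; omega)).trans (le_of_eq ?_)
    rw [Finset.card_univ, Fintype.card_fin, smul_eq_mul]
  constructor
  · have e3 := Nat.mul_le_mul_left k e1
    have e4 : B ≤ k * B := Nat.le_mul_of_pos_left _ hk
    rw [Nat.mul_add, Nat.mul_add] at e3
    omega
  · have : ∑ j ∈ Finset.univ.erase i0, N j ≤ ∑ j ∈ Finset.univ.erase i0, ((N j - 3) + 3) :=
      Finset.sum_le_sum fun j _ => by omega
    rw [Finset.sum_add_distrib, Finset.sum_const, smul_eq_mul] at this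
    have := Nat.mul_le_mul_right 3 (show (Finset.univ.erase i0).card ≤ k by omega)
    omega

lemma two_arith (k X n R f : ℕ) (hk : 0 < k) (h1 : k * X + n ≤ k * n) (h2 : n ≤ 2 * f + R) (Y : ℕ) (h3 : k * (R + Y) < n) :
    X + Y < 2 * f := by
  by_contra h
  push Not at h
  have e1 := Nat.mul_le_mul_left k h
  have e2 := Nat.mul_le_mul_left k h2
  rw [Nat.mul_add] at e1 e2 h3
  omega

set_option maxHeartbeats 1000000 in
lemma Inp.final (N : Fin k → ℕ) (hk : 0 < k) (hN : ∀ j, 4 ≤ N j)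
    (hNsum : ∑ j, (N j - 1) + I.Br.card = Fintype.card V) :
    ∃ g, IsHamSubdivision A (fun i => (s i, t i)) N g := by
  haveI : Nonempty (Fin k) := ⟨⟨0, hk⟩⟩
  obtain ⟨i0, -, hmax⟩ := Finset.exists_max_image Finset.univ N Finset.univ_nonempty
  have hmax : ∀ j, N j ≤ N i0 := fun j => hmax j (Finset.mem_univ _)
  obtain ⟨m1, m2⟩ := main_len N i0 _ _ hN hmax hNsum
  suffices hh : ∃ S : Setup A s t, S.Br = I.Br ∧ Nonempty (Plan S N i0) by
    obtain ⟨S, hS, ⟨P⟩⟩ := hh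
    exact assembly S N i0 P (fun j => by have := hN j; omega) (by rw [hS]; exact hNsum)
  have hM := I.hM
  have hu := I.hu
  have hn := I.hn
  have hBrc := I.hBrc
  have hd1 := I.hd1
  have hd2 := I.hd2
  have hd3 := I.hd3
  have hd4 := I.hd4
  have htot := cn_total I.tc
  set u := I.u with hudef
  set M := I.M with hMdef
  set n := Fintype.card V with hndef
  set x1 := M * u with hx1
  set x2 := M * x1 with hx2
  set x3 := M * x2 with hx3
  set x4 := M * x3 with hx4
  set x5 := M * x4 with hx5
  set x6 := M * x5 with hx6
  set x7 := M * x6 with hx7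
  have b1 : 1000 * (k * u) + 1000 * u ≤ x1 := arith M k u hM
  have b2 : 1000 * (k * x1) + 1000 * x1 ≤ x2 := arith M k x1 hM
  have b3 : 1000 * (k * x2) + 1000 * x2 ≤ x3 := arith M k x2 hM
  have b4 : 1000 * (k * x3) + 1000 * x3 ≤ x4 := arith M k x3 hM
  have b5 : 1000 * (k * x4) + 1000 * x4 ≤ x5 := arith M k x4 hM
  have b6 : 1000 * (k * x5) + 1000 * x5 ≤ x6 := arith M k x5 hM
  have b7 : 1000 * (k * x6) + 1000 * x6 ≤ x7 := arith M k x6 hM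
  have b8 : 1000 * (k * x7) + 1000 * x7 ≤ n := (arith M k x7 hM).trans hn
  by_cases c1 : cn I.tc (true, true) ≤ x4 ∨ cn I.tc (false, false) ≤ x4
  · have hcard : (Finset.univ.filter (fun v => I.tc true v = I.tc false v)).card ≤
        cn I.tc (true, true) + cn I.tc (false, false) := by
      unfold cn
      refine le_trans (Finset.card_le_card ?_) (Finset.card_union_le _ _)
      intro v hv
      simp only [Finset.mem_filter, Finset.mem_union, Finset.mem_univ, true_and] at hv ⊢
      cases h : I.tc false v <;> simp [hv, h]
    obtain ⟨p, p1, p2, p3, p4, p5, p6⟩ := I.toPre (Finset.univ.filter (fun v => I.tc true v = I.tc false v)) 0 x5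
      (by omega) (by omega) (by omega) (show 60 * x7 < n by omega)
    replace p4 : p.D = x7 := p4
    obtain ⟨S, s1, s2, s3, s4, s5, s6, s7⟩ := p.mk_setup (s i0)
    rw [p1] at s1 s2
    refine ⟨S, s5.trans p6, two_plan S N i0 hN ?_ ?_⟩
    · intro v hv
      have := s7 v hv
      rw [p2] at this
      rw [s1, s2]
      simpa using this
    · intro c hc
      have hf := (fc_ge S I.tc s1 s2 c).1
      rw [s5, p6] at hf
      rw [p5] at s6
      rw [s3, p4]
      have hfc : n ≤ 2 * S.fc c + 3 * x5 := by
        rcases c with ⟨c, d⟩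
        cases c <;> cases d <;> simp only [ne_eq, not_true_eq_false, reduceCtorEq, not_false_eq_true] at hc <;> omega
      have := two_arith k (∑ j ∈ Finset.univ.erase i0, (N j - 3)) n (3 * x5) (S.fc c) hk m1 hfc (24 * S.Sp.card + 8 * x7 + 17 * k + 6)
        (lt_of_le_of_lt (Nat.mul_le_mul_left k (show _ ≤ 9 * x7 by omega)) (by
          rw [Nat.mul_left_comm]; omega))
      omega
  by_cases c2 : cn I.tc (true, false) ≤ x4 ∨ cn I.tc (false, true) ≤ x4
  · have hcard : (Finset.univ.filter (fun v => I.tc true v ≠ I.tc false v)).card ≤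
        cn I.tc (true, false) + cn I.tc (false, true) := by
      unfold cn
      refine le_trans (Finset.card_le_card ?_) (Finset.card_union_le _ _)
      intro v hv
      simp only [Finset.mem_filter, Finset.mem_union, Finset.mem_univ, true_and] at hv ⊢
      cases h : I.tc false v <;> cases h' : I.tc true v <;> simp_all
    obtain ⟨p, p1, p2, p3, p4, p5, p6⟩ := I.toPre (Finset.univ.filter (fun v => I.tc true v ≠ I.tc false v)) 1 x5
      (by omega) (fun _ v hv => by simpa using hv) (by omega) (show 60 * x7 < n by omega)
    replace p4 : p.D = x7 := p4
    obtain ⟨S, s1, s2, s3, s4, s5, s6, s7⟩ := p.mk_setup (s i0)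
    rw [p1] at s1 s2
    refine ⟨S, s5.trans p6, clique_plan S N i0 hN (s4.trans p3) ?_ ?_⟩
    · intro v hv
      have := s7 v hv
      rw [p2] at this
      rw [s1, s2]
      simpa using this
    · intro c
      have hf := (fc_ge S I.tc s1 s2 (c, c)).1
      rw [s5, p6] at hf
      rw [p5] at s6
      rw [s3, p4]
      have hfc : n ≤ 2 * S.fc (c, c) + 3 * x5 := by
        cases c <;> omega
      have := two_arith k (∑ j ∈ Finset.univ.erase i0, (N j - 3)) n (3 * x5) (S.fc (c, c)) hk m1 hfc (20 * S.Sp.card + 8 * x7 + 63 * k + 8)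
        (lt_of_le_of_lt (Nat.mul_le_mul_left k (show _ ≤ 9 * x7 by omega)) (by
          rw [Nat.mul_left_comm]; omega))
      omega
  push Not at c1 c2
  obtain ⟨p, p1, p2, p3, p4, p5, p6⟩ := I.toPre ∅ 0 x1
    (by omega) (by omega) (by rw [Finset.card_empty]; omega) (show 60 * x3 < n by omega)
  replace p4 : p.D = x3 := p4
  obtain ⟨S, s1, s2, s3, s4, s5, s6, s7⟩ := p.mk_setup (s i0)
  rw [p1] at s1 s2
  rw [p5] at s6
  have f1 := fc_ge S I.tc s1 s2 (true, true)
  have f2 := fc_ge S I.tc s1 s2 (true, false)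
  have f3 := fc_ge S I.tc s1 s2 (false, true)
  have f4 := fc_ge S I.tc s1 s2 (false, false)
  rw [s5, p6] at f1 f2 f3 f4
  refine ⟨S, s5.trans p6, mixed_plan S N i0 hN m1 (10 * x1) ?_ ?_ ?_ ?_⟩
  · intro c
    rw [s3, p4]
    have h1 : k * (4 * x3 + 12 * S.Sp.card + 20 * k + 20 + 10 * x1) ≤ k * (5 * x3) := Nat.mul_le_mul_left k (by omega)
    have h2 := Nat.mul_left_comm k 5 x3
    refine lt_of_le_of_lt h1 ?_
    rcases c with ⟨c, d⟩
    cases c <;> cases d <;> omega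
  · omega
  · omega
  · omega
end Fin

set_option linter.unusedSectionVars false

section Last

lemma ncard_filter {X : Type} [Fintype X] (P : X → Prop) [DecidablePred P] : {x | P x}.ncard = (Finset.univ.filter P).card := by
  rw [← Set.ncard_coe_finset]
  congr 1
  ext x; simp

lemma exists_ix {V : Type} (W : Fin 4 → Set V) (h1 : ∀ i j, i ≠ j → Disjoint (W i) (W j)) (h2 : (⋃ i, W i) = Set.univ) :
    ∃ ix : V → Fin 4, ∀ i, W i = {v | ix v = i} := by
  have : ∀ v, ∃ i, v ∈ W i := fun v => by
    have : v ∈ ⋃ i, W i := by rw [h2]; trivial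
    exact Set.mem_iUnion.mp this
  choose ix hix using this
  refine ⟨ix, fun i => ?_⟩
  ext v
  constructor
  · intro hv
    by_contra hne
    exact Set.disjoint_left.mp (h1 (ix v) i hne) (hix v) hv
  · rintro rfl
    exact hix v

/-- in/out classes of the four parts -/
def t4 (o : Bool) (i : Fin 4) : Bool := if o = true then decide (i = 0 ∨ i = 1) else decide (i = 0 ∨ i = 3)

lemma t4_pairs : ∀ i j : Fin 4, t4 false i = t4 true j →
    j = i + 1 ∨ ((i = 0 ∨ i = 2) ∧ j = i) ∨ ((i = 1 ∨ i = 3) ∧ j = i + 2) := by decide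

lemma t4_TT : ∀ i : Fin 4, (t4 true i = true ∧ t4 false i = true) ↔ i = 0 := by decide
lemma t4_TF : ∀ i : Fin 4, (t4 true i = true ∧ t4 false i = false) ↔ i = 1 := by decide
lemma t4_FF : ∀ i : Fin 4, (t4 true i = false ∧ t4 false i = false) ↔ i = 2 := by decide
lemma t4_FT : ∀ i : Fin 4, (t4 true i = false ∧ t4 false i = true) ↔ i = 3 := by decide

variable {V : Type} [Fintype V] {A : V → V → Prop}

lemma arcs_miss (ix : V → Fin 4) (i j : Fin 4) :
    arcsCount A {v | ix v = i} {v | ix v = j} +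
      (Finset.univ.filter (fun q : V × V => (ix q.1 = i ∧ ix q.2 = j) ∧ ¬ A q.1 q.2)).card =
      ({v | ix v = i} : Set V).ncard * ({v | ix v = j} : Set V).ncard := by
  unfold arcsCount
  rw [ncard_filter, ncard_filter, ncard_filter, ← Finset.card_product]
  rw [← Finset.card_filter_add_card_filter_not (s := (Finset.univ.filter (fun v => ix v = i)) ×ˢ (Finset.univ.filter (fun v => ix v = j)))
    (fun q => A q.1 q.2)]
  congr 2
  · ext q; simp [and_assoc]
  · ext q; simp

lemma real_miss (Q n m a x : ℕ) (hQ : 0 < Q) (h : a + m = x) (h2 : (x : ℝ) - (1 / (Q : ℝ)) * (n : ℝ) ^ 2 ≤ (a : ℝ)) :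
    Q * m ≤ n * n := by
  have hQ' : (0 : ℝ) < Q := by exact_mod_cast hQ
  have h3 : (a : ℝ) + m = x := by exact_mod_cast h
  have h4 : (m : ℝ) ≤ 1 / (Q : ℝ) * (n : ℝ) ^ 2 := by linarith
  have h5 := mul_le_mul_of_nonneg_left h4 hQ'.le
  have h6 : (Q : ℝ) * (1 / (Q : ℝ) * (n : ℝ) ^ 2) = (n : ℝ) * n := by field_simp
  rw [h6] at h5
  exact_mod_cast h5

lemma real_diff (Q n x y : ℕ) (hQ : 0 < Q) (h : |(x : ℝ) - (y : ℝ)| ≤ (1 / (Q : ℝ)) * (n : ℝ)) :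
    Q * x ≤ Q * y + n ∧ Q * y ≤ Q * x + n := by
  have hQ' : (0 : ℝ) < Q := by exact_mod_cast hQ
  rw [abs_le] at h
  have h6 : (Q : ℝ) * (1 / (Q : ℝ) * (n : ℝ)) = n := by field_simp
  have h1 := mul_le_mul_of_nonneg_left h.1 hQ'.le
  have h2 := mul_le_mul_of_nonneg_left h.2 hQ'.le
  rw [mul_neg, h6] at h1
  rw [h6] at h2
  constructor
  · have : (Q : ℝ) * x ≤ Q * y + n := by linarith
    exact_mod_cast this
  · have : (Q : ℝ) * y ≤ Q * x + n := by linarith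
    exact_mod_cast this

lemma Mis_bound (ix : V → Fin 4) (Q : ℕ) (n : ℕ)
    (h : ∀ i j, t4 false i = t4 true j →
      Q * (Finset.univ.filter (fun q : V × V => (ix q.1 = i ∧ ix q.2 = j) ∧ ¬ A q.1 q.2)).card ≤ n * n) :
    Q * (Mis A (fun o v => t4 o (ix v))).card ≤ 16 * (n * n) := by
  rw [Finset.card_eq_sum_card_fiberwise (f := fun q => (ix q.1, ix q.2)) (t := Finset.univ) (fun _ _ => Finset.mem_univ _),
    Finset.mul_sum]
  refine (Finset.sum_le_card_nsmul _ _ (n * n) ?_).trans (le_of_eq ?_)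
  · rintro ⟨i, j⟩ -
    by_cases hij : t4 false i = t4 true j
    · refine le_trans (Nat.mul_le_mul_left _ (Finset.card_le_card ?_)) (h i j hij)
      intro q hq
      simp only [Mis, Finset.mem_filter, Finset.mem_univ, true_and, Prod.mk.injEq] at hq ⊢
      exact ⟨hq.2, hq.1.2⟩
    · rw [Finset.filter_false_of_mem]
      · simp
      · intro q hq he
        simp only [Mis, Finset.mem_filter, Finset.mem_univ, true_and, Prod.mk.injEq] at hq he
        rw [he.1, he.2] at hq
        exact hij hq.1
  · rw [smul_eq_mul]; rfl

lemma nest (M u : ℕ) : M * (M * (M * (M * (M * (M * (M * (M * u))))))) = M ^ 8 * u := by ring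

lemma num1 (M u n : ℕ) (hM : 1000 ≤ M) (h2 : n ≤ 2 * (M ^ 8 * u)) : n ≤ M ^ 17 * u := by
  have : M ^ 8 * (2 * u) ≤ M ^ 8 * (M ^ 9 * u) := by
    refine Nat.mul_le_mul_left _ (Nat.mul_le_mul_right _ ?_)
    calc 2 ≤ M := by omega
      _ = M ^ 1 := (pow_one M).symm
      _ ≤ M ^ 9 := Nat.pow_le_pow_right (by omega) (by norm_num)
  calc n ≤ 2 * (M ^ 8 * u) := h2
    _ = M ^ 8 * (2 * u) := by ring
    _ ≤ M ^ 8 * (M ^ 9 * u) := this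
    _ = M ^ 17 * u := by ring

lemma num2 (M u n m : ℕ) (hM : 1000 ≤ M) (h2 : n ≤ 2 * (M ^ 8 * u)) (h : M ^ 17 * m ≤ 16 * (n * n)) : 2 * m ≤ u * u := by
  have e1 := Nat.mul_le_mul h2 h2
  have e2 : M ^ 16 * (128 * (u * u)) ≤ M ^ 16 * (M * (u * u)) :=
    Nat.mul_le_mul_left _ (Nat.mul_le_mul_right _ (by omega))
  have e3 : M ^ 17 * (2 * m) ≤ M ^ 17 * (u * u) := by
    calc M ^ 17 * (2 * m) = 2 * (M ^ 17 * m) := by ring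
      _ ≤ 2 * (16 * (n * n)) := Nat.mul_le_mul_left _ h
      _ ≤ 2 * (16 * (2 * (M ^ 8 * u) * (2 * (M ^ 8 * u)))) := Nat.mul_le_mul_left _ (Nat.mul_le_mul_left _ e1)
      _ = M ^ 16 * (128 * (u * u)) := by ring
      _ ≤ M ^ 16 * (M * (u * u)) := e2
      _ = M ^ 17 * (u * u) := by ring
  exact Nat.le_of_mul_le_mul_left e3 (Nat.pow_pos (by omega))

lemma num3 (M u n x y : ℕ) (hM : 1000 ≤ M) (h2 : n ≤ M ^ 17 * u) (h : M ^ 17 * x ≤ M ^ 17 * y + n) : x ≤ y + u := by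
  have : M ^ 17 * x ≤ M ^ 17 * (y + u) := by rw [Nat.mul_add]; omega
  exact Nat.le_of_mul_le_mul_left this (Nat.pow_pos (by omega))

lemma deg_real (n k d : ℕ) (h : (n : ℝ) / 2 + k ≤ d) : n + 2 * k ≤ 2 * d := by
  have : (n : ℝ) + 2 * k ≤ 2 * d := by linarith
  exact_mod_cast this

lemma mk_inp {W' : Type} [Fintype W'] {k : ℕ} (a : Fin k → W' × W')
    (hδH : ∀ w : W', ∃ i, w = (a i).1 ∨ w = (a i).2) (hk : 0 < k)
    (hloop : ∀ v, ¬ A v v) (hn : 4 * (1000 * (k + 1)) ^ 17 ≤ Fintype.card V)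
    (hdeg : ∀ v : V, (Fintype.card V : ℝ) / 2 + k ≤ (outDeg A v : ℝ) ∧
                    (Fintype.card V : ℝ) / 2 + k ≤ (inDeg A v : ℝ))
    (hE : InEC1 A (1 / (((1000 * (k + 1)) ^ 17 : ℕ) : ℝ))) (f : W' → V) (hf : Function.Injective f) :
    ∃ I : Inp A (fun i => f (a i).1) (fun i => f (a i).2), I.Br.card = Fintype.card W' := by
  obtain ⟨W, w1, w2, w3, w4, w5, w6, w7⟩ := hE
  obtain ⟨ix, hix⟩ := exists_ix W w1 w2
  generalize hMd : 1000 * (k + 1) = M at *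
  have hM : 1000 ≤ M := by omega
  have hQ : 0 < M ^ 17 := Nat.pow_pos (by omega)
  have hnM : M ^ 9 ≤ Fintype.card V := by
    refine le_trans (Nat.pow_le_pow_right (by omega) (show 9 ≤ 17 by norm_num)) ?_
    omega
  have h8 : 0 < M ^ 8 := Nat.pow_pos (by omega)
  set u := Fintype.card V / M ^ 8 with hu
  have hMu : M ≤ u := by
    rw [hu, Nat.le_div_iff_mul_le h8, ← pow_succ']
    exact hnM
  have hlow : M ^ 8 * u ≤ Fintype.card V := Nat.mul_div_le _ _
  have hup : Fintype.card V ≤ 2 * (M ^ 8 * u) := by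
    have h1 := Nat.lt_mul_div_succ (Fintype.card V) h8
    have h2 : M ^ 8 * 1 ≤ M ^ 8 * u := Nat.mul_le_mul_left _ (by omega)
    rw [← hu, Nat.mul_add] at h1
    omega
  have hup2 := num1 M u _ hM hup
  have d02 := real_diff (M ^ 17) _ _ _ hQ w3
  have d13 := real_diff (M ^ 17) _ _ _ hQ w4
  simp only [hix] at d02 d13
  have hBr : ∀ x, x ∈ Finset.univ.image f ↔ ∃ i, x = f (a i).1 ∨ x = f (a i).2 := by
    intro x
    rw [Finset.mem_image]
    constructor
    · rintro ⟨w, -, rfl⟩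
      obtain ⟨i, hi | hi⟩ := hδH w
      · exact ⟨i, Or.inl (by rw [hi])⟩
      · exact ⟨i, Or.inr (by rw [hi])⟩
    · rintro ⟨i, rfl | rfl⟩
      · exact ⟨_, Finset.mem_univ _, rfl⟩
      · exact ⟨_, Finset.mem_univ _, rfl⟩
  have hBrc : (Finset.univ.image f).card ≤ 2 * k := by
    have : Finset.univ.image f ⊆ (Finset.univ.image (fun i => f (a i).1)) ∪ (Finset.univ.image (fun i => f (a i).2)) := by
      intro x hx
      obtain ⟨i, hi | hi⟩ := (hBr x).mp hx
      · exact Finset.mem_union_left _ (Finset.mem_image.mpr ⟨i, Finset.mem_univ _, hi.symm⟩)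
      · exact Finset.mem_union_right _ (Finset.mem_image.mpr ⟨i, Finset.mem_univ _, hi.symm⟩)
    refine (Finset.card_le_card this).trans ((Finset.card_union_le _ _).trans ?_)
    refine (Nat.add_le_add Finset.card_image_le Finset.card_image_le).trans ?_
    rw [Finset.card_univ, Fintype.card_fin]; omega
  have hcn : ∀ (c : Bool × Bool) (i : Fin 4), (∀ j, (t4 true j = c.1 ∧ t4 false j = c.2) ↔ j = i) →
      cn (fun o v => t4 o (ix v)) c = ({v | ix v = i} : Set V).ncard := by
    intro c i hc
    rw [ncard_filter]
    unfold cn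
    congr 1
    ext v
    simp only [Finset.mem_filter, Finset.mem_univ, true_and]
    exact hc (ix v)
  refine ⟨{ tc := fun o v => t4 o (ix v), u := u, M := M, Br := Finset.univ.image f, hBr := hBr, hBrc := hBrc,
            hloop := hloop, hdeg := ?_, hM := hMd.le, hu := hMu, hn := ?_, hd1 := ?_, hd2 := ?_, hd3 := ?_, hd4 := ?_,
            hMis := ?_ }, ?_⟩
  · intro o v
    cases o
    · have := deg_real _ _ _ (hdeg v).2
      unfold inDeg at this
      rw [ncard_filter] at this
      exact this
    · have := deg_real _ _ _ (hdeg v).1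
      unfold outDeg at this
      rw [ncard_filter] at this
      exact this
  · rw [nest]; exact hlow
  · rw [hcn (true, true) 0 t4_TT, hcn (false, false) 2 t4_FF]; exact num3 M u _ _ _ hM hup2 d02.1
  · rw [hcn (true, true) 0 t4_TT, hcn (false, false) 2 t4_FF]; exact num3 M u _ _ _ hM hup2 d02.2
  · rw [hcn (true, false) 1 t4_TF, hcn (false, true) 3 t4_FT]; exact num3 M u _ _ _ hM hup2 d13.1
  · rw [hcn (true, false) 1 t4_TF, hcn (false, true) 3 t4_FT]; exact num3 M u _ _ _ hM hup2 d13.2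
  · refine num2 M u (Fintype.card V) _ hM hup (Mis_bound ix (M ^ 17) _ ?_)
    intro i j hij
    refine real_miss (M ^ 17) (Fintype.card V) _ _ _ hQ (arcs_miss (A := A) ix i j) ?_
    rw [Nat.cast_mul]
    rcases t4_pairs i j hij with rfl | ⟨h, rfl⟩ | ⟨h, rfl⟩
    · have := w5 i
      rw [hix i, hix (i + 1)] at this
      exact this
    · have := w6 j h
      rw [hix j, pow_two] at this
      exact this
    · have := w7 i h
      rw [hix i, hix (i + 2)] at this
      exact this
  · exact (Finset.card_image_of_injective _ hf).trans Finset.card_univ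
end Last

/-- **Lemma (the extremal case).**  Let `H` be a digraph with `k` arcs and `δ(H) ≥ 1`.
There are a constant `C₀` and constants `α, β, ε` with `1/C₀ < α, β ≪ ε ≪ 1` such that
for every `C ≥ C₀`: if `D` is a digraph on `n ≥ Ck` vertices with `δ⁰(D) ≥ n/2 + k`
belonging to Extremal Case 1 (**EC1**) with parameter `ε`, then `D` is arbitrary
Hamiltonian `H`-linked with parameters `α, β`. -/
theorem extremal_case_H_linked
    {W' : Type} [Fintype W'] {k : ℕ} (a : Fin k → W' × W')
    (ha : Function.Injective a)
    (hδH : ∀ w : W', ∃ i, w = (a i).1 ∨ w = (a i).2) :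
    ∃ (C₀ : ℕ) (α β ε : ℝ), 0 < C₀ ∧
      ((C₀ : ℝ))⁻¹ < α ∧ ((C₀ : ℝ))⁻¹ < β ∧ α < ε ∧ β < ε ∧ ε < 1 ∧
      ∀ C : ℕ, C₀ ≤ C →
        ∀ (V : Type) [Fintype V] (A : V → V → Prop),
          (∀ v, ¬ A v v) →
          C * k ≤ Fintype.card V →
          (∀ v : V, (Fintype.card V : ℝ) / 2 + k ≤ (outDeg A v : ℝ) ∧
                    (Fintype.card V : ℝ) / 2 + k ≤ (inDeg A v : ℝ)) →
          InEC1 A ε →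
          ArbHamHLinked A a α β := by
  have hQ : 1 < (1000 * (k + 1)) ^ 17 := Nat.one_lt_pow (by norm_num) (by omega)
  have hQ' : (1 : ℝ) < (((1000 * (k + 1)) ^ 17 : ℕ) : ℝ) := by exact_mod_cast hQ
  have hα : ((4 * (1000 * (k + 1)) ^ 17 : ℕ) : ℝ)⁻¹ < 1 / (2 * (((1000 * (k + 1)) ^ 17 : ℕ) : ℝ)) := by
    rw [Nat.cast_mul, one_div]
    apply inv_strictAnti₀
    · linarith
    · push_cast at hQ' ⊢; linarith
  have hε : 1 / (2 * (((1000 * (k + 1)) ^ 17 : ℕ) : ℝ)) < 1 / (((1000 * (k + 1)) ^ 17 : ℕ) : ℝ) := by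
    rw [one_div, one_div]
    apply inv_strictAnti₀ <;> linarith
  refine ⟨4 * (1000 * (k + 1)) ^ 17, 1 / (2 * (((1000 * (k + 1)) ^ 17 : ℕ) : ℝ)),
    1 / (2 * (((1000 * (k + 1)) ^ 17 : ℕ) : ℝ)), 1 / (((1000 * (k + 1)) ^ 17 : ℕ) : ℝ), by omega, hα, hα, hε, hε, ?_, ?_⟩
  · rw [one_div]; exact inv_lt_one_of_one_lt₀ hQ'
  intro C hC V _ A hloop hn hdeg hE f hf N hN _ hsum
  rcases Nat.eq_zero_or_pos k with hk | hk
  · subst hk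
    refine ⟨fun i => i.elim0, fun i => i.elim0, fun i => i.elim0, fun x => ?_⟩
    exfalso
    haveI : IsEmpty W' := ⟨fun w => (hδH w).choose.elim0⟩
    have h0 : Fintype.card W' = 0 := Fintype.card_eq_zero
    rw [h0] at hsum
    simp only [Finset.univ_eq_empty, Finset.sum_empty] at hsum
    have := Fintype.card_pos_iff.mpr ⟨x⟩
    omega
  · have hn' : 4 * (1000 * (k + 1)) ^ 17 ≤ Fintype.card V :=
      (hC.trans (Nat.le_mul_of_pos_right C hk)).trans hn
    obtain ⟨I, hI⟩ := mk_inp a hδH hk hloop hn' hdeg hE f hf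
    exact I.final N hk hN (by rw [hI]; exact hsum)
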